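/- Let X be a finitely irreducible countable Markov shift, φ: X → ℝ measurable with Gibbs state μ_φ, and let I be the rate function of the LDP for the empirical-measure distributions ξ_n under μ_φ. Then for every bounded continuous ψ: X → ℝ the limit Q(ψ) = lim_{n→∞} (1/n) log ∫ exp(S_nψ) dμ_φ exists and satisfies Q(ψ) = sup_{μ ∈ M} ( ∫ψ dμ - I(μ) ); moreover, by convex duality, I(μ) = sup_{ψ ∈ C(X)} ( ∫ψ dμ - Q(ψ) ) for every μ ∈ M, where C(X) is the space of bounded continuous real-valued functions on X. -/

import Mathlib

open MeasureTheory Filter Topology Set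
open scoped ENNReal NNReal

namespace CMS

/-! ### Generic dynamical notions -/

variable {X : Type*}

/-- Birkhoff sum `S_n φ`. -/
noncomputable def birkhoff (T : X → X) (φ : X → ℝ) (n : ℕ) (x : X) : ℝ :=
  ∑ i ∈ Finset.range n, φ (T^[i] x)

/-- A measure is invariant under `T`. -/
def Invariant [MeasurableSpace X] (T : X → X) (μ : Measure X) : Prop :=
  Measure.map T μ = μ

/-- `∫ φ dμ > -∞`, i.e. the negative part of `φ` is integrable. -/
def IntegralGtBot [MeasurableSpace X] (φ : X → ℝ) (μ : Measure X) : Prop :=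
  (∫⁻ x, ENNReal.ofReal (-φ x) ∂μ) ≠ ⊤

/-- The integral of `φ`, with values in `EReal` (defined whenever one of the parts is finite). -/
noncomputable def eintegral [MeasurableSpace X] (φ : X → ℝ) (μ : Measure X) : EReal :=
  ((∫⁻ x, ENNReal.ofReal (φ x) ∂μ : ℝ≥0∞) : EReal) -
    ((∫⁻ x, ENNReal.ofReal (-φ x) ∂μ : ℝ≥0∞) : EReal)

/-- Entropy of the countable partition induced by a map `g` with countable range. -/
noncomputable def partitionEntropy [MeasurableSpace X] {α : Type*} (μ : Measure X) (g : X → α) :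
    ℝ≥0∞ :=
  ∑' a : α, ENNReal.ofReal (-((μ (g ⁻¹' {a})).toReal * Real.log ((μ (g ⁻¹' {a})).toReal)))

/-- Kolmogorov–Sinaĭ entropy of `T` with respect to `μ`: the supremum over finite measurable
partitions (coded by maps `X → ℕ` with finite range) of the asymptotic entropy of iterated
joins of the partition. -/
noncomputable def entropy [MeasurableSpace X] (T : X → X) (μ : Measure X) : ℝ≥0∞ :=
  ⨆ (p : X → ℕ) (_ : Measurable p ∧ (Set.range p).Finite),
    atTop.liminf fun n : ℕ =>
      ENNReal.ofReal ((n : ℝ)⁻¹) * partitionEntropy μ (fun x => fun i : Fin n => p (T^[i] x))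

/-- The empirical measure `δ_x^n = (1/n) ∑_{i<n} δ_{T^i x}` (with junk convention `n = 0 ↦ n = 1`,
irrelevant since only `n ≥ 1` is ever used). -/
noncomputable def empirical [MeasurableSpace X] (T : X → X) (x : X) (n : ℕ) :
    ProbabilityMeasure X :=
  ⟨((max n 1 : ℕ) : ℝ≥0∞)⁻¹ • ∑ i ∈ Finset.range (max n 1), Measure.dirac (T^[i] x), by
    refine ⟨?_⟩
    have h1 : (∑ i ∈ Finset.range (max n 1), Measure.dirac (T^[i] x)) Set.univ
        = ((max n 1 : ℕ) : ℝ≥0∞) := by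
      rw [Measure.finset_sum_apply]
      simp
    rw [Measure.smul_apply, h1, smul_eq_mul, ENNReal.inv_mul_cancel] <;> simp⟩

noncomputable instance [MeasurableSpace X] [TopologicalSpace X] [OpensMeasurableSpace X] :
    MeasurableSpace (ProbabilityMeasure X) := borel _

/-- Sets of periodic points. -/
def perSet (T : X → X) (n : ℕ) : Set X := {x | T^[n] x = x}

/-- Sets of iterated preimages of a point. -/
def preimSet (T : X → X) (n : ℕ) (y : X) : Set X := {x | T^[n] x = y}

/-- The partition function `Z_n(φ, C)` over a subset `C`. -/
noncomputable def Zfn [MeasurableSpace X] (T : X → X) (φ : X → ℝ) (n : ℕ) (C : Set X) : ℝ≥0∞ :=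
  ∑' x : C, ENNReal.ofReal (Real.exp (birkhoff T φ n x))

/-- The distribution of the empirical measures under `μ`. -/
noncomputable def empDistr [MeasurableSpace X] [TopologicalSpace X] [OpensMeasurableSpace X]
    (T : X → X) (μ : Measure X) (n : ℕ) : Measure (ProbabilityMeasure X) :=
  Measure.map (fun x => empirical T x n) μ

/-- The distribution `Z_n(φ,C)⁻¹ ∑_{x ∈ C} e^{S_nφ(x)} δ_{δ_x^n}` on the space of probability
measures, for a countable set `C` (of weighted periodic points or iterated preimages). -/
noncomputable def weightedDistr [MeasurableSpace X] [TopologicalSpace X] [OpensMeasurableSpace X]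
    (T : X → X) (φ : X → ℝ) (n : ℕ) (C : Set X) : Measure (ProbabilityMeasure X) :=
  (Zfn T φ n C)⁻¹ •
    Measure.sum (fun x : C =>
      ENNReal.ofReal (Real.exp (birkhoff T φ n x)) • Measure.dirac (empirical T (x : X) n))

/-! ### Large deviations notions -/

variable {Y : Type*}

/-- The large deviation principle for a sequence of (sub)probability measures with rate
function `J`. -/
def HasLDP [TopologicalSpace Y] [MeasurableSpace Y] (μ : ℕ → Measure Y) (J : Y → EReal) : Prop :=
  (∀ G : Set Y, IsOpen G →
      -(⨅ y ∈ G, J y) ≤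
        atTop.liminf fun n : ℕ => (((n : ℝ)⁻¹ : ℝ) : EReal) * ENNReal.log (μ n G)) ∧
  (∀ K : Set Y, IsClosed K →
      atTop.limsup (fun n : ℕ => (((n : ℝ)⁻¹ : ℝ) : EReal) * ENNReal.log (μ n K)) ≤
        -(⨅ y ∈ K, J y))

/-- Exponential tightness of a sequence of measures. -/
def ExpTight [TopologicalSpace Y] [MeasurableSpace Y] (μ : ℕ → Measure Y) : Prop :=
  ∀ L : ℝ, 0 < L → ∃ K : Set Y, IsCompact K ∧
    atTop.limsup (fun n : ℕ => (((n : ℝ)⁻¹ : ℝ) : EReal) * ENNReal.log (μ n Kᶜ)) ≤ ((-L : ℝ) : EReal)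

/-- A good rate function: lower semicontinuous with compact sublevel sets. -/
def GoodRate [TopologicalSpace Y] (J : Y → EReal) : Prop :=
  LowerSemicontinuous J ∧ ∀ α : ℝ, 0 ≤ α → IsCompact {y | J y ≤ (α : EReal)}

/-- The rate function `I(μ) = - inf_{G ∋ μ} sup_G F`. -/
noncomputable def rateOf [TopologicalSpace Y] (F : Y → EReal) (μ : Y) : EReal :=
  -(⨅ (G : Set Y) (_ : IsOpen G ∧ μ ∈ G), ⨆ ν ∈ G, F ν)

/-- The convex combination `t μ + (1-t) ν` of two probability measures. -/
noncomputable def mix [MeasurableSpace X] (t : ℝ) (h0 : 0 ≤ t) (h1 : t ≤ 1)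
    (μ ν : ProbabilityMeasure X) : ProbabilityMeasure X :=
  ⟨ENNReal.ofReal t • (μ : Measure X) + ENNReal.ofReal (1 - t) • (ν : Measure X), by
    refine ⟨?_⟩
    simp only [Measure.add_apply, Measure.smul_apply, smul_eq_mul, measure_univ, mul_one]
    rw [← ENNReal.ofReal_add h0 (by linarith)]
    norm_num⟩

/-- Convexity of a rate function on probability measures. -/
def ConvexRate [MeasurableSpace X] (J : ProbabilityMeasure X → EReal) : Prop :=
  ∀ μ ν : ProbabilityMeasure X, ∀ t : ℝ, ∀ (h0 : 0 ≤ t) (h1 : t ≤ 1),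
    J (mix t h0 h1 μ ν) ≤ ((t : ℝ) : EReal) * J μ + ((1 - t : ℝ) : EReal) * J ν

-- The free energy functional `F`.
open Classical in
noncomputable def freeEnergy [MeasurableSpace X] (T : X → X) (φ : X → ℝ) (P : ℝ)
    (ν : ProbabilityMeasure X) : EReal :=
  if Invariant T (ν : Measure X) ∧ IntegralGtBot φ (ν : Measure X)
  then ((entropy T (ν : Measure X) : ℝ≥0∞) : EReal) + eintegral φ (ν : Measure X) - ((P : ℝ) : EReal)
  else ⊥

/-! ### Countable Markov shifts -/

variable {S : Type*}

/-- The topological Markov shift with alphabet `S` and transition relation `A`. -/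
def Space (A : S → S → Prop) : Type _ := {x : ℕ → S // ∀ i, A (x i) (x (i + 1))}

variable (A : S → S → Prop)

instance [TopologicalSpace S] : TopologicalSpace (Space A) :=
  inferInstanceAs (TopologicalSpace {x : ℕ → S // ∀ i, A (x i) (x (i + 1))})

noncomputable instance [TopologicalSpace S] : MeasurableSpace (Space A) := borel _

instance [TopologicalSpace S] : BorelSpace (Space A) := ⟨rfl⟩

/-- The left shift. -/
def shift : Space A → Space A := fun x => ⟨fun i => x.1 (i + 1), fun i => x.2 (i + 1)⟩

/-- Admissible words. -/
def Admissible (w : List S) : Prop := w ≠ [] ∧ w.Chain' A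

/-- The cylinder set of a word. -/
def cylinder (w : List S) : Set (Space A) := {x | ∀ i : Fin w.length, x.1 i = w.get i}

variable {A}

/-- The initial word of length `n` of a point. -/
def word (x : Space A) (n : ℕ) : List S := List.ofFn (fun i : Fin n => x.1 i)

variable (A)

/-- `μ` is a Gibbs state for the potential `φ` with constants `c₀` and `P`. -/
def IsGibbsWith [TopologicalSpace S] (φ : Space A → ℝ) (μ : Measure (Space A)) (c₀ P : ℝ) :
    Prop :=
  ∀ n : ℕ, 1 ≤ n → ∀ x : Space A,
    c₀⁻¹ * Real.exp (-(P * n) + birkhoff (shift A) φ n x)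
        ≤ (μ (cylinder A (word x n))).toReal ∧
      (μ (cylinder A (word x n))).toReal
        ≤ c₀ * Real.exp (-(P * n) + birkhoff (shift A) φ n x)

/-- `μ` is a Gibbs state for `φ`. -/
def IsGibbs [TopologicalSpace S] (φ : Space A → ℝ) (μ : Measure (Space A)) : Prop :=
  ∃ c₀ P : ℝ, 1 ≤ c₀ ∧ IsGibbsWith A φ μ c₀ P

/-- The transition matrix has no row or column identically zero. -/
def NoZeroRowCol : Prop := (∀ a : S, ∃ b, A a b) ∧ ∀ b : S, ∃ a, A a b

/-- Finite irreducibility. -/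
def FinitelyIrreducible : Prop :=
  ∃ Λ : Finset (List S), ∀ v w : List S, Admissible A v → Admissible A w →
    ∃ l ∈ Λ, Admissible A (v ++ l ++ w)

/-- Finite primitiveness. -/
def FinitelyPrimitive : Prop :=
  ∃ Λ : Finset (List S), (∃ N : ℕ, ∀ l ∈ Λ, l.length = N) ∧
    ∀ v w : List S, Admissible A v → Admissible A w →
      ∃ l ∈ Λ, Admissible A (v ++ l ++ w)

/-- Topological transitivity. -/
def TopTransitive : Prop :=
  ∀ a b : S, ∃ n : ℕ, 1 ≤ n ∧
    (cylinder A [a] ∩ (shift A)^[n] ⁻¹' (cylinder A [b])).Nonempty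

/-- Varadhan's functional `Q(ψ) = sup_μ (∫ψ dμ - I(μ))`. -/
noncomputable def varQ {X : Type*} [MeasurableSpace X] (I : ProbabilityMeasure X → EReal)
    (ψ : X → ℝ) : EReal :=
  ⨆ μ : ProbabilityMeasure X, (((∫ x, ψ x ∂(μ : Measure X)) : ℝ) : EReal) - I μ

/-- `φ` is uniformly continuous for the standard metric of the shift space. -/
def UnifCont (φ : Space A → ℝ) : Prop :=
  ∀ ε : ℝ, 0 < ε → ∃ N : ℕ, ∀ x y : Space A, (∀ i < N, x.1 i = y.1 i) → |φ x - φ y| ≤ ε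

/-- `φ` is bounded. -/
def Bdd (φ : Space A → ℝ) : Prop := ∃ C : ℝ, ∀ x : Space A, |φ x| ≤ C

end CMS

namespace CMS

/-! ### Maps with measurable fibres and partition entropy -/

section PartitionEntropy

variable {X α β : Type*} [MeasurableSpace X]

/-- Every fibre of `g` is measurable. -/
def MeasFibers (g : X → α) : Prop := ∀ a, MeasurableSet (g ⁻¹' {a})

lemma MeasFibers.measurableSet_preimage [Countable α] {g : X → α} (hg : MeasFibers g)
    (s : Set α) : MeasurableSet (g ⁻¹' s) := by
  rw [← biUnion_preimage_singleton]
  exact MeasurableSet.biUnion s.to_countable fun a _ => hg a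

lemma MeasFibers.measurable_comp [Countable α] [MeasurableSpace β] {g : X → α}
    (hg : MeasFibers g) (h : α → β) : Measurable fun x => h (g x) :=
  fun s _ => hg.measurableSet_preimage (h ⁻¹' s)

lemma MeasFibers.comp_measurable {Y : Type*} [MeasurableSpace Y] {g : X → α} (hg : MeasFibers g)
    {T : Y → X} (hT : Measurable T) : MeasFibers fun y => g (T y) :=
  fun a => hT (hg a)

lemma MeasFibers.prodMk {f : X → α} {g : X → β} (hf : MeasFibers f) (hg : MeasFibers g) :
    MeasFibers fun x => (f x, g x) := by
  rintro ⟨a, b⟩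
  convert (hf a).inter (hg b) using 1
  ext x
  simp

lemma MeasFibers.pi {ι : Type*} [Countable ι] {g : ι → X → α} (hg : ∀ i, MeasFibers (g i)) :
    MeasFibers fun x i => g i x := by
  intro w
  convert MeasurableSet.iInter fun i => hg i (w i) using 1
  ext x
  simp [funext_iff]

lemma measFibers_of_measurable [MeasurableSpace α] [MeasurableSingletonClass α] {g : X → α}
    (hg : Measurable g) : MeasFibers g :=
  fun a => hg (measurableSet_singleton a)

lemma MeasFibers.lintegral_comp [Countable α] {g : X → α} (hg : MeasFibers g) (μ : Measure X)
    (h : α → ℝ≥0∞) : ∫⁻ x, h (g x) ∂μ = ∑' a, h a * μ (g ⁻¹' {a}) := by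
  let _ : MeasurableSpace α := ⊤
  have hm : Measurable g := hg.measurable_comp id
  rw [← lintegral_map (measurable_of_countable h) hm, lintegral_countable']
  refine tsum_congr fun a => ?_
  rw [Measure.map_apply hm (measurableSet_singleton a)]

lemma MeasFibers.ae_ne_zero [Countable α] {g : X → α} (_hg : MeasFibers g) (μ : Measure X) :
    ∀ᵐ x ∂μ, μ (g ⁻¹' {g x}) ≠ 0 := by
  rw [ae_iff]
  have : {x | ¬ μ (g ⁻¹' {g x}) ≠ 0} = ⋃ a ∈ {a | μ (g ⁻¹' {a}) = 0}, g ⁻¹' {a} := by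
    ext x; simp
  rw [this, measure_biUnion_null_iff (to_countable _)]
  exact fun a ha => ha

lemma MeasFibers.partitionEntropy_eq_lintegral [Countable α] {g : X → α} (hg : MeasFibers g)
    (μ : Measure X) [IsFiniteMeasure μ] :
    partitionEntropy μ g = ∫⁻ x, ENNReal.ofReal (-Real.log (μ.real (g ⁻¹' {g x}))) ∂μ := by
  rw [hg.lintegral_comp μ fun a => ENNReal.ofReal (-Real.log (μ.real (g ⁻¹' {a})))]
  refine tsum_congr fun a => ?_
  rw [← ENNReal.ofReal_toReal (measure_ne_top μ (g ⁻¹' {a})),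
    ← ENNReal.ofReal_mul' ENNReal.toReal_nonneg]
  simp only [measureReal_def, ENNReal.ofReal_toReal (measure_ne_top μ (g ⁻¹' {a}))]
  ring_nf

/-- A coarser partition has smaller entropy. -/
lemma partitionEntropy_mono [Countable α] [Countable β] {f : X → α} {g : X → β}
    (hf : MeasFibers f) (hg : MeasFibers g) (μ : Measure X) [IsFiniteMeasure μ]
    (hfg : ∀ x y, g x = g y → f x = f y) : partitionEntropy μ f ≤ partitionEntropy μ g := by
  rw [hf.partitionEntropy_eq_lintegral, hg.partitionEntropy_eq_lintegral]
  refine lintegral_mono_ae ?_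
  filter_upwards [hg.ae_ne_zero μ] with x hx
  refine ENNReal.ofReal_le_ofReal (neg_le_neg (Real.log_le_log ?_ ?_))
  · exact ENNReal.toReal_pos hx (measure_ne_top _ _)
  · exact measureReal_mono fun y hy => hfg y x hy

lemma partitionEntropy_congr [Countable α] [Countable β] {f : X → α} {g : X → β}
    (hf : MeasFibers f) (hg : MeasFibers g) (μ : Measure X) [IsFiniteMeasure μ]
    (hfg : ∀ x y, g x = g y ↔ f x = f y) : partitionEntropy μ f = partitionEntropy μ g :=
  le_antisymm (partitionEntropy_mono hf hg μ fun x y => (hfg x y).1)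
    (partitionEntropy_mono hg hf μ fun x y => (hfg x y).2)

lemma MeasFibers.measurable_log_measure [Countable α] {g : X → α} (hg : MeasFibers g)
    (μ : Measure X) : Measurable fun x => Real.log (μ.real (g ⁻¹' {g x})) :=
  hg.measurable_comp fun a => Real.log (μ.real (g ⁻¹' {a}))

/-- Subadditivity of entropy under joins. -/
lemma partitionEntropy_prod_le [Countable α] [Countable β] {f : X → α} {g : X → β}
    (hf : MeasFibers f) (hg : MeasFibers g) (μ : Measure X) [IsProbabilityMeasure μ] :
    partitionEntropy μ (fun x => (f x, g x)) ≤ partitionEntropy μ f + partitionEntropy μ g := by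
  have hfg := hf.prodMk hg
  rw [hf.partitionEntropy_eq_lintegral, hg.partitionEntropy_eq_lintegral,
    hfg.partitionEntropy_eq_lintegral]
  set ρ : α × β → ℝ≥0∞ := fun p => μ (f ⁻¹' {p.1}) * μ (g ⁻¹' {p.2}) /
    μ ((fun x => (f x, g x)) ⁻¹' {p}) with hρ
  have hρ1 : ∫⁻ x, ρ (f x, g x) ∂μ ≤ 1 := by
    rw [hfg.lintegral_comp μ ρ]
    calc ∑' p, ρ p * μ ((fun x => (f x, g x)) ⁻¹' {p})
        ≤ ∑' p : α × β, μ (f ⁻¹' {p.1}) * μ (g ⁻¹' {p.2}) :=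
          ENNReal.tsum_le_tsum fun p => by
            rw [mul_comm]; exact ENNReal.mul_div_le
      _ = (∑' a, μ (f ⁻¹' {a})) * ∑' b, μ (g ⁻¹' {b}) := by
          rw [ENNReal.tsum_prod (f := fun a b => μ (f ⁻¹' {a}) * μ (g ⁻¹' {b}))]
          simp_rw [ENNReal.tsum_mul_left, ENNReal.tsum_mul_right]
      _ = 1 := by
          have h1 := hf.lintegral_comp μ fun _ => 1
          have h2 := hg.lintegral_comp μ fun _ => 1
          simp only [lintegral_const, measure_univ, one_mul] at h1 h2
          rw [← h1, ← h2, one_mul]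
  have key : ∀ᵐ x ∂μ,
      ENNReal.ofReal (-Real.log (μ.real ((fun x => (f x, g x)) ⁻¹' {(f x, g x)}))) + 1 ≤
      (ENNReal.ofReal (-Real.log (μ.real (f ⁻¹' {f x}))) +
        ENNReal.ofReal (-Real.log (μ.real (g ⁻¹' {g x})))) + ρ (f x, g x) := by
    filter_upwards [hf.ae_ne_zero μ, hg.ae_ne_zero μ, hfg.ae_ne_zero μ] with x h1 h2 h3
    have p1 : 0 < μ.real (f ⁻¹' {f x}) := ENNReal.toReal_pos h1 (measure_ne_top _ _)
    have p2 : 0 < μ.real (g ⁻¹' {g x}) := ENNReal.toReal_pos h2 (measure_ne_top _ _)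
    have p3 : 0 < μ.real ((fun x => (f x, g x)) ⁻¹' {(f x, g x)}) :=
      ENNReal.toReal_pos h3 (measure_ne_top _ _)
    have hρx : ρ (f x, g x) = ENNReal.ofReal (μ.real (f ⁻¹' {f x}) * μ.real (g ⁻¹' {g x}) /
        μ.real ((fun x => (f x, g x)) ⁻¹' {(f x, g x)})) := by
      rw [ENNReal.ofReal_div_of_pos p3, ENNReal.ofReal_mul p1.le, ofReal_measureReal,
        ofReal_measureReal, ofReal_measureReal]
    have q1 := Real.log_nonpos p1.le measureReal_le_one
    have q2 := Real.log_nonpos p2.le measureReal_le_one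
    have q3 := Real.log_nonpos p3.le measureReal_le_one
    rw [hρx, ← ENNReal.ofReal_add (by linarith) (by linarith), ← ENNReal.ofReal_one,
      ← ENNReal.ofReal_add (by linarith) (div_nonneg (mul_nonneg p1.le p2.le) p3.le),
      ← ENNReal.ofReal_add (by linarith) (by norm_num)]
    refine ENNReal.ofReal_le_ofReal ?_
    have := Real.log_le_sub_one_of_pos (div_pos (mul_pos p1 p2) p3)
    rw [Real.log_div (by positivity) p3.ne', Real.log_mul p1.ne' p2.ne'] at this
    linarith
  have hfin := lintegral_mono_ae key
  have mf : Measurable fun x => ENNReal.ofReal (-Real.log (μ.real (f ⁻¹' {f x}))) :=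
    (hf.measurable_log_measure μ).neg.ennreal_ofReal
  have mg : Measurable fun x => ENNReal.ofReal (-Real.log (μ.real (g ⁻¹' {g x}))) :=
    (hg.measurable_log_measure μ).neg.ennreal_ofReal
  rw [lintegral_add_right _ measurable_const, lintegral_add_left (by exact mf.add mg),
    lintegral_add_left mf] at hfin
  simp only [lintegral_const, measure_univ, mul_one] at hfin
  exact (ENNReal.add_le_add_iff_right ENNReal.one_ne_top).1
    (hfin.trans (add_le_add_right hρ1 _))

lemma partitionEntropy_map {Y : Type*} [MeasurableSpace Y] {T : Y → X} (hT : Measurable T)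
    (μ : Measure Y) {g : X → α} (hg : MeasFibers g) :
    partitionEntropy (μ.map T) g = partitionEntropy μ fun y => g (T y) := by
  refine tsum_congr fun a => ?_
  rw [Measure.map_apply hT (hg a)]
  rfl

/-- Concavity of entropy. -/
lemma le_partitionEntropy_of_average {ι : Type*} (s : Finset ι) (w : ι → ℝ) (hw : ∀ i, 0 ≤ w i)
    (hw1 : ∑ i ∈ s, w i = 1) (g : X → α) (ν : ι → Measure X) (ν' : Measure X)
    (h : ∀ a, ν'.real (g ⁻¹' {a}) = ∑ i ∈ s, w i * (ν i).real (g ⁻¹' {a}))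
    [∀ i, IsProbabilityMeasure (ν i)] :
    ∑ i ∈ s, ENNReal.ofReal (w i) * partitionEntropy (ν i) g ≤ partitionEntropy ν' g := by
  unfold partitionEntropy
  simp_rw [← ENNReal.tsum_mul_left]
  rw [← Summable.tsum_finsetSum fun i _ => ENNReal.summable]
  refine ENNReal.tsum_le_tsum fun a => ?_
  simp_rw [← ENNReal.ofReal_mul (hw _)]
  have hnn : ∀ i, 0 ≤ -((ν i (g ⁻¹' {a})).toReal * Real.log (ν i (g ⁻¹' {a})).toReal) := fun i =>
    neg_nonneg.2 <| mul_nonpos_of_nonneg_of_nonpos ENNReal.toReal_nonneg <|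
      Real.log_nonpos ENNReal.toReal_nonneg measureReal_le_one
  rw [← ENNReal.ofReal_sum_of_nonneg fun i _ => mul_nonneg (hw i) (hnn i)]
  refine ENNReal.ofReal_le_ofReal ?_
  have := Real.concaveOn_negMulLog.le_map_sum (t := s) (w := w)
    (p := fun i => (ν i).real (g ⁻¹' {a})) (fun i _ => hw i) hw1 (fun i _ => measureReal_nonneg)
  simp only [smul_eq_mul, ← h a] at this
  simpa [Real.negMulLog, measureReal_def] using this

lemma partitionEntropy_le_card [Fintype α] (μ : Measure X) (g : X → α) :
    partitionEntropy μ g ≤ Fintype.card α := by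
  unfold partitionEntropy
  rw [tsum_fintype]
  calc _ ≤ ∑ _a : α, (1 : ℝ≥0∞) := by
        refine Finset.sum_le_sum fun a _ => ?_
        rw [ENNReal.ofReal_le_one]
        set t := (μ (g ⁻¹' {a})).toReal
        rcases (ENNReal.toReal_nonneg : 0 ≤ t).eq_or_lt with h0 | h0
        · simp [t, ← h0]
        · have := Real.one_sub_inv_le_log_of_pos h0
          have h2 : t * (1 - t⁻¹) ≤ t * Real.log t := mul_le_mul_of_nonneg_left this h0.le
          rw [mul_sub, mul_inv_cancel₀ h0.ne'] at h2
          linarith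
    _ = Fintype.card α := by simp

/-- The `n`-fold join of a partition along an invariant measure has entropy at most `n` times
that of the partition. -/
lemma partitionEntropy_iterate_le [Countable α] {T : X → X} (hT : Measurable T) {μ : Measure X}
    [IsProbabilityMeasure μ] (hμ : Invariant T μ) {p : X → α} (hp : MeasFibers p) (n : ℕ) :
    partitionEntropy μ (fun x => fun i : Fin n => p (T^[i] x)) ≤ n * partitionEntropy μ p := by
  have hm : ∀ n : ℕ, MeasFibers fun x => fun i : Fin n => p (T^[i] x) := fun n =>
    MeasFibers.pi fun i => hp.comp_measurable (hT.iterate i)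
  induction n with
  | zero =>
    unfold partitionEntropy
    rw [tsum_fintype]
    simp [Set.preimage, eq_iff_true_of_subsingleton]
  | succ n ih =>
    calc _ ≤ partitionEntropy μ fun x => ((fun i : Fin n => p (T^[i] x)), p (T^[n] x)) := by
          refine partitionEntropy_mono (hm _)
            ((hm n).prodMk (hp.comp_measurable (hT.iterate n))) μ fun x y hxy => ?_
          simp only [Prod.mk.injEq] at hxy
          funext i
          refine Fin.lastCases ?_ (fun i => ?_) i
          · simpa using hxy.2
          · simpa using congrFun hxy.1 i
      _ ≤ _ := partitionEntropy_prod_le (hm n) (hp.comp_measurable (hT.iterate n)) μ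
      _ ≤ n * partitionEntropy μ p + partitionEntropy μ p := by
          refine add_le_add ih (le_of_eq ?_)
          rw [← partitionEntropy_map (hT.iterate n) μ hp]
          congr 1
          clear ih
          induction n with
          | zero => simp
          | succ n ih =>
            rw [Function.iterate_succ, ← Measure.map_map (hT.iterate n) hT, hμ, ih]
      _ = _ := by push_cast; ring

end PartitionEntropy

/-! ### Birkhoff sums -/

section Birkhoff

variable {X : Type*} {T : X → X} {f g : X → ℝ}

lemma birkhoff_add (n m : ℕ) (x : X) :
    birkhoff T f (n + m) x = birkhoff T f n x + birkhoff T f m (T^[n] x) := by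
  simp only [birkhoff, Finset.sum_range_add]
  congr 1
  refine Finset.sum_congr rfl fun i _ => ?_
  rw [add_comm, Function.iterate_add_apply]

lemma birkhoff_abs_le {C : ℝ} (hf : ∀ x, |f x| ≤ C) (n : ℕ) (x : X) :
    |birkhoff T f n x| ≤ n * C := by
  calc |birkhoff T f n x| ≤ ∑ i ∈ Finset.range n, |f (T^[i] x)| := Finset.abs_sum_le_sum_abs _ _
    _ ≤ ∑ _i ∈ Finset.range n, C := Finset.sum_le_sum fun i _ => hf _
    _ = n * C := by simp

lemma birkhoff_add_fun (n : ℕ) (x : X) :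
    birkhoff T (fun x => f x + g x) n x = birkhoff T f n x + birkhoff T g n x := by
  simp only [birkhoff, Finset.sum_add_distrib]

variable [MeasurableSpace X]

lemma measurable_birkhoff (hT : Measurable T) (hf : Measurable f) (n : ℕ) :
    Measurable (birkhoff T f n) :=
  Finset.measurable_sum _ fun i _ => hf.comp (hT.iterate i)

lemma Invariant.measurePreserving {μ : Measure X} (h : Invariant T μ) (hT : Measurable T) :
    MeasurePreserving T μ μ :=
  ⟨hT, h⟩

lemma Invariant.integrable_iterate {μ : Measure X} (h : Invariant T μ) (hT : Measurable T)
    (hf : Integrable f μ) (i : ℕ) : Integrable (fun x => f (T^[i] x)) μ :=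
  ((h.measurePreserving hT).iterate i).integrable_comp_of_integrable hf

lemma Invariant.integral_iterate {μ : Measure X} (h : Invariant T μ) (hT : Measurable T)
    (hf : Measurable f) (i : ℕ) : ∫ x, f (T^[i] x) ∂μ = ∫ x, f x ∂μ := by
  have hp := (h.measurePreserving hT).iterate i
  conv_rhs => rw [← hp.map_eq]
  rw [integral_map hp.measurable.aemeasurable hf.aestronglyMeasurable]

lemma Invariant.integrable_birkhoff {μ : Measure X} (h : Invariant T μ) (hT : Measurable T)
    (hf : Integrable f μ) (n : ℕ) : Integrable (birkhoff T f n) μ :=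
  integrable_finsetSum _ fun i _ => h.integrable_iterate hT hf i

lemma Invariant.integral_birkhoff {μ : Measure X} (h : Invariant T μ) (hT : Measurable T)
    (hfm : Measurable f) (hf : Integrable f μ) (n : ℕ) :
    ∫ x, birkhoff T f n x ∂μ = n * ∫ x, f x ∂μ := by
  simp only [birkhoff]
  rw [integral_finsetSum _ fun i _ => h.integrable_iterate hT hf i]
  simp [h.integral_iterate hT hfm]

end Birkhoff

/-! ### Initial words and their fibres -/

section Words

variable {S : Type*} {A : S → S → Prop}

lemma shift_iterate_val (n : ℕ) (x : Space A) (i : ℕ) :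
    ((shift A)^[n] x).1 i = x.1 (n + i) := by
  induction n generalizing x with
  | zero => simp
  | succ n ih =>
    rw [Function.iterate_succ_apply, ih]
    change x.1 (n + i + 1) = _
    rw [Nat.add_right_comm]

/-- The initial word of length `n`, as a function on `Fin n`. -/
def wd (A : S → S → Prop) (n : ℕ) (x : Space A) : Fin n → S := fun i => x.1 i

lemma wd_eq_iff {n : ℕ} {x y : Space A} : wd A n x = wd A n y ↔ ∀ i < n, x.1 i = y.1 i := by
  simp [wd, funext_iff, Fin.forall_iff]

lemma cylinder_word (n : ℕ) (x : Space A) :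
    cylinder A (word x n) = wd A n ⁻¹' {wd A n x} := by
  ext y
  simp only [cylinder, word, mem_ofPred_eq, mem_preimage, mem_singleton_iff, wd_eq_iff,
    List.get_ofFn, Fin.forall_iff, List.length_ofFn, Fin.val_cast]

lemma wd_shift_eq {n m : ℕ} {x y : Space A} (h : wd A (n + m) x = wd A (n + m) y) :
    wd A m ((shift A)^[n] x) = wd A m ((shift A)^[n] y) := by
  rw [wd_eq_iff] at h ⊢
  intro i hi
  rw [shift_iterate_val, shift_iterate_val]
  exact h _ (by omega)

lemma wd_eq_of_le {n m : ℕ} (hnm : n ≤ m) {x y : Space A} (h : wd A m x = wd A m y) :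
    wd A n x = wd A n y := by
  rw [wd_eq_iff] at h ⊢
  exact fun i hi => h i (hi.trans_le hnm)

lemma wd_add_eq_iff {n m : ℕ} {x y : Space A} : wd A (n + m) x = wd A (n + m) y ↔
    wd A n x = wd A n y ∧ wd A m ((shift A)^[n] x) = wd A m ((shift A)^[n] y) := by
  refine ⟨fun h => ⟨wd_eq_of_le (by omega) h, wd_shift_eq h⟩, fun ⟨h1, h2⟩ => ?_⟩
  rw [wd_eq_iff] at h1 h2 ⊢
  intro i hi
  rcases lt_or_ge i n with h | h
  · exact h1 i h
  · have := h2 (i - n) (by omega)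
    rwa [shift_iterate_val, shift_iterate_val, Nat.add_sub_cancel' h] at this

lemma wd_shift_iterate_eq {k n i : ℕ} (hi : i < n) {x y : Space A}
    (h : wd A (n + k) x = wd A (n + k) y) :
    wd A k ((shift A)^[i] x) = wd A k ((shift A)^[i] y) :=
  wd_shift_eq (wd_eq_of_le (by omega) h)

/-- Infimum of `f` over the points with initial word `w`. -/
noncomputable def lo (f : Space A → ℝ) (n : ℕ) (w : Fin n → S) : ℝ :=
  sInf (f '' (wd A n ⁻¹' {w}))

lemma lo_le {f : Space A → ℝ} {C : ℝ} (hf : ∀ x, |f x| ≤ C) {n : ℕ} {x y : Space A}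
    (h : wd A n y = wd A n x) : lo f n (wd A n x) ≤ f y :=
  csInf_le ⟨-C, by rintro _ ⟨z, _, rfl⟩; exact (abs_le.1 (hf z)).1⟩ ⟨y, h, rfl⟩

lemma le_lo {f : Space A → ℝ} {c : ℝ} {n : ℕ} {x : Space A}
    (h : ∀ y, wd A n y = wd A n x → c ≤ f y) : c ≤ lo f n (wd A n x) :=
  le_csInf ⟨f x, x, rfl, rfl⟩ (by rintro _ ⟨z, hz, rfl⟩; exact h z hz)

lemma abs_lo_le {f : Space A → ℝ} {C : ℝ} (hf : ∀ x, |f x| ≤ C) (n : ℕ) (x : Space A) :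
    |lo f n (wd A n x)| ≤ C :=
  abs_le.2 ⟨le_lo fun y _ => (abs_le.1 (hf y)).1, (lo_le hf rfl).trans (abs_le.1 (hf x)).2⟩

variable [TopologicalSpace S]

lemma continuous_coord (i : ℕ) : Continuous fun x : Space A => x.1 i :=
  (continuous_apply i).comp continuous_subtype_val

lemma continuous_shift : Continuous (shift A) :=
  Continuous.subtype_mk (continuous_pi fun i => continuous_coord (i + 1)) _

lemma measurable_shift : Measurable (shift A) := continuous_shift.measurable

lemma exists_wd_subset_of_mem_nhds {x : Space A} {U : Set (Space A)} (hU : U ∈ 𝓝 x) :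
    ∃ n, ∀ y, wd A n y = wd A n x → y ∈ U := by
  rw [mem_nhds_iff] at hU
  obtain ⟨V, hVU, hV, hxV⟩ := hU
  obtain ⟨W, hW, rfl⟩ := isOpen_induced_iff.1 hV
  obtain ⟨I, u, hu, hIW⟩ := isOpen_pi_iff.1 hW x.1 hxV
  obtain ⟨n, hn⟩ := I.bddAbove
  refine ⟨n + 1, fun y hy => hVU (hIW fun i hi => ?_)⟩
  rw [wd_eq_iff] at hy
  rw [hy i (Nat.lt_succ_of_le (hn hi))]
  exact (hu i hi).2

lemma tendsto_lo {f : Space A → ℝ} {C : ℝ} (hf : ∀ x, |f x| ≤ C) (hc : Continuous f)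
    (x : Space A) : Tendsto (fun n => lo f n (wd A n x)) atTop (𝓝 (f x)) := by
  rw [Metric.tendsto_atTop]
  intro ε hε
  obtain ⟨n, hn⟩ := exists_wd_subset_of_mem_nhds
    (hc.continuousAt.preimage_mem_nhds (Metric.ball_mem_nhds (f x) (half_pos hε)))
  refine ⟨n, fun m hm => ?_⟩
  have h1 : lo f m (wd A m x) ≤ f x := lo_le hf rfl
  have h2 : f x - ε / 2 ≤ lo f m (wd A m x) := le_lo fun y hy => by
    have := hn y (wd_eq_of_le hm hy)
    rw [mem_preimage, Metric.mem_ball, Real.dist_eq] at this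
    linarith [(abs_lt.1 this).1]
  rw [Real.dist_eq, abs_lt]
  constructor <;> linarith

variable [DiscreteTopology S]

lemma isOpen_wd_preimage (n : ℕ) (s : Set (Fin n → S)) : IsOpen (wd A n ⁻¹' s) := by
  have : Continuous (wd A n) := continuous_pi fun i => continuous_coord i
  exact (isOpen_discrete s).preimage this

lemma continuous_wd_comp {Y : Type*} [TopologicalSpace Y] (n : ℕ) (h : (Fin n → S) → Y) :
    Continuous fun x : Space A => h (wd A n x) :=
  ⟨fun s _ => isOpen_wd_preimage n (h ⁻¹' s)⟩

lemma measFibers_wd (n : ℕ) : MeasFibers (wd A n) :=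
  fun w => (isOpen_wd_preimage n {w}).measurableSet

variable [Countable S]

instance : TopologicalSpace.MetrizableSpace (Space A) :=
  (Topology.IsEmbedding.subtypeVal (p := fun x : ℕ → S => ∀ i, A (x i) (x (i + 1)))).metrizableSpace

lemma measurable_lo (f : Space A → ℝ) (n : ℕ) : Measurable fun x => lo f n (wd A n x) :=
  (measFibers_wd n).measurable_comp (lo f n)

lemma tendsto_integral_lo {f : Space A → ℝ} {C : ℝ} (hf : ∀ x, |f x| ≤ C) (hc : Continuous f)
    (ν : Measure (Space A)) [IsProbabilityMeasure ν] :
    Tendsto (fun n => ∫ x, lo f n (wd A n x) ∂ν) atTop (𝓝 (∫ x, f x ∂ν)) :=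
  tendsto_integral_of_dominated_convergence (fun _ => C)
    (fun n => (measurable_lo f n).aestronglyMeasurable) (integrable_const C)
    (fun n => ae_of_all _ fun x => abs_lo_le hf n x) (ae_of_all _ fun x => tendsto_lo hf hc x)

end Words

/-! ### Quasi-Bernoulli estimates for Gibbs states -/

section Gibbs

variable {S : Type*} [TopologicalSpace S] {A : S → S → Prop}

/-- Two-sided Gibbs bounds with a normalised potential, for all word lengths. -/
def GibbsBound (f : Space A → ℝ) (μ : Measure (Space A)) (c : ℝ) : Prop :=
  ∀ n x, c⁻¹ * Real.exp (birkhoff (shift A) f n x) ≤ μ.real (wd A n ⁻¹' {wd A n x}) ∧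
    μ.real (wd A n ⁻¹' {wd A n x}) ≤ c * Real.exp (birkhoff (shift A) f n x)

lemma IsGibbsWith.gibbsBound {φ : Space A → ℝ} {μ : Measure (Space A)} [IsProbabilityMeasure μ]
    {c P : ℝ} (hc : 1 ≤ c) (h : IsGibbsWith A φ μ c P) :
    GibbsBound (fun x => φ x - P) μ c := by
  intro n x
  rcases Nat.eq_zero_or_pos n with rfl | hn
  · have : wd A 0 ⁻¹' {wd A 0 x} = univ := by
      ext y; simp [wd_eq_iff]
    rw [this]
    simp only [birkhoff, Finset.range_zero, Finset.sum_empty, Real.exp_zero, mul_one,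
      probReal_univ]
    exact ⟨inv_le_one_of_one_le₀ hc, hc⟩
  · have := h n hn x
    rw [cylinder_word] at this
    have e : birkhoff (shift A) (fun x => φ x - P) n x =
        -(P * n) + birkhoff (shift A) φ n x := by
      simp only [birkhoff, Finset.sum_sub_distrib, Finset.sum_const, Finset.card_range,
        nsmul_eq_mul]
      ring
    rw [e]
    exact this

variable {f : Space A → ℝ} {μ : Measure (Space A)} {c : ℝ}

lemma GibbsBound.pos (h : GibbsBound f μ c) (hc : 1 ≤ c) (n : ℕ) (x : Space A) :
    0 < μ.real (wd A n ⁻¹' {wd A n x}) :=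
  lt_of_lt_of_le (by positivity) (h n x).1

lemma GibbsBound.log_le (h : GibbsBound f μ c) (hc : 1 ≤ c) (n : ℕ) (x : Space A) :
    Real.log (μ.real (wd A n ⁻¹' {wd A n x})) ≤ birkhoff (shift A) f n x + Real.log c := by
  have := Real.log_le_log (h.pos hc n x) (h n x).2
  rwa [Real.log_mul (by positivity) (Real.exp_ne_zero _), Real.log_exp, add_comm] at this

lemma GibbsBound.le_log (h : GibbsBound f μ c) (hc : 1 ≤ c) (n : ℕ) (x : Space A) :
    birkhoff (shift A) f n x - Real.log c ≤ Real.log (μ.real (wd A n ⁻¹' {wd A n x})) := by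
  have := Real.log_le_log (by positivity) (h n x).1
  rw [Real.log_mul (by positivity) (Real.exp_ne_zero _), Real.log_exp, Real.log_inv] at this
  linarith

lemma GibbsBound.le_log_const [IsProbabilityMeasure μ] (h : GibbsBound f μ c) (hc : 1 ≤ c)
    (x : Space A) : f x ≤ Real.log c := by
  have h1 := h.le_log hc 1 x
  have h2 := Real.log_nonpos measureReal_nonneg
    (measureReal_le_one (μ := μ) (s := wd A 1 ⁻¹' {wd A 1 x}))
  simp only [birkhoff, Finset.sum_range_one, Function.iterate_zero, id] at h1
  linarith

lemma GibbsBound.measure_add_le (h : GibbsBound f μ c) (hc : 1 ≤ c) (n m : ℕ) (x : Space A) :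
    μ.real (wd A (n + m) ⁻¹' {wd A (n + m) x}) ≤
      c ^ 3 * (μ.real (wd A n ⁻¹' {wd A n x}) *
        μ.real (wd A m ⁻¹' {wd A m ((shift A)^[n] x)})) := by
  have hc0 : 0 < c := by linarith
  calc _ ≤ c * Real.exp (birkhoff (shift A) f (n + m) x) := (h _ x).2
    _ = c ^ 3 * ((c⁻¹ * Real.exp (birkhoff (shift A) f n x)) *
        (c⁻¹ * Real.exp (birkhoff (shift A) f m ((shift A)^[n] x)))) := by
        rw [birkhoff_add, Real.exp_add]; field_simp
    _ ≤ _ := by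
        gcongr
        · exact (h n x).1
        · exact (h m _).1

lemma GibbsBound.le_measure_add (h : GibbsBound f μ c) (hc : 1 ≤ c) (n m : ℕ) (x : Space A) :
    μ.real (wd A n ⁻¹' {wd A n x}) * μ.real (wd A m ⁻¹' {wd A m ((shift A)^[n] x)}) ≤
      c ^ 3 * μ.real (wd A (n + m) ⁻¹' {wd A (n + m) x}) := by
  have hc0 : 0 < c := by linarith
  calc _ ≤ (c * Real.exp (birkhoff (shift A) f n x)) *
        (c * Real.exp (birkhoff (shift A) f m ((shift A)^[n] x))) := by
        gcongr
        · exact (h n x).2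
        · exact (h m _).2
    _ = c ^ 3 * (c⁻¹ * Real.exp (birkhoff (shift A) f (n + m) x)) := by
        rw [birkhoff_add, Real.exp_add]; field_simp
    _ ≤ _ := by
        gcongr
        exact (h _ x).1

end Gibbs

/-! ### Entropy bounds -/

/-- The Gibbs inequality. -/
lemma partitionEntropy_le_of_weights {X α : Type*} [MeasurableSpace X] [Countable α] {g : X → α}
    (hg : MeasFibers g) (ν : Measure X) [IsProbabilityMeasure ν] (b : α → ℝ)
    (hb : ∀ x, 0 < b (g x)) {R : ℝ} (hR : 0 < R)
    (hbR : ∑' a, ENNReal.ofReal (b a) ≤ ENNReal.ofReal R)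
    (hi : Integrable (fun x => Real.log (b (g x))) ν) :
    partitionEntropy ν g ≠ ⊤ ∧
      (partitionEntropy ν g).toReal ≤ Real.log R - ∫ x, Real.log (b (g x)) ∂ν := by
  set U : X → ℝ := fun x => Real.log R - Real.log (b (g x)) with hU
  have hUi : Integrable U ν := (integrable_const _).sub hi
  have hUm : Measurable U := measurable_const.sub (hg.measurable_comp fun a => Real.log (b a))
  set ρ : α → ℝ≥0∞ := fun a => ENNReal.ofReal (b a) / ENNReal.ofReal R / ν (g ⁻¹' {a}) with hρ
  have hρ1 : ∫⁻ x, ρ (g x) ∂ν ≤ 1 := by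
    rw [hg.lintegral_comp ν ρ]
    calc ∑' a, ρ a * ν (g ⁻¹' {a}) ≤ ∑' a, ENNReal.ofReal (b a) / ENNReal.ofReal R :=
          ENNReal.tsum_le_tsum fun a => by rw [mul_comm]; exact ENNReal.mul_div_le
      _ ≤ 1 := by
          simp_rw [div_eq_mul_inv]
          rw [ENNReal.tsum_mul_right]
          exact ENNReal.div_le_of_le_mul (by simpa using hbR)
  have key : ∀ᵐ x ∂ν, (ENNReal.ofReal (-Real.log (ν.real (g ⁻¹' {g x}))) +
      ENNReal.ofReal (-U x)) + 1 ≤ ENNReal.ofReal (U x) + ρ (g x) := by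
    filter_upwards [hg.ae_ne_zero ν] with x h1
    have p1 : 0 < ν.real (g ⁻¹' {g x}) := ENNReal.toReal_pos h1 (measure_ne_top _ _)
    have hρx : ρ (g x) = ENNReal.ofReal (b (g x) / R / ν.real (g ⁻¹' {g x})) := by
      rw [ENNReal.ofReal_div_of_pos p1, ENNReal.ofReal_div_of_pos hR, ofReal_measureReal]
    have q1 := Real.log_nonpos p1.le measureReal_le_one
    have hpos : 0 < b (g x) / R / ν.real (g ⁻¹' {g x}) := div_pos (div_pos (hb x) hR) p1
    have := Real.log_le_sub_one_of_pos hpos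
    rw [Real.log_div (div_pos (hb x) hR).ne' p1.ne', Real.log_div (hb x).ne' hR.ne'] at this
    rw [hρx]
    have hUx : U x = Real.log R - Real.log (b (g x)) := rfl
    rcases le_total 0 (U x) with h | h
    · rw [ENNReal.ofReal_of_nonpos (neg_nonpos.2 h), add_zero, ← ENNReal.ofReal_one,
        ← ENNReal.ofReal_add (by linarith) (by norm_num), ← ENNReal.ofReal_add h hpos.le]
      exact ENNReal.ofReal_le_ofReal (by linarith)
    · rw [ENNReal.ofReal_of_nonpos h, zero_add, ← ENNReal.ofReal_one,
        ← ENNReal.ofReal_add (by linarith) (by linarith),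
        ← ENNReal.ofReal_add (by linarith) (by norm_num)]
      exact ENNReal.ofReal_le_ofReal (by linarith)
  have hint := lintegral_mono_ae key
  rw [lintegral_add_right _ measurable_const, lintegral_add_right _
    (show Measurable fun x => ENNReal.ofReal (-U x) from
      hUm.neg.ennreal_ofReal),
    lintegral_add_left hUm.ennreal_ofReal, ← hg.partitionEntropy_eq_lintegral] at hint
  simp only [lintegral_const, measure_univ, mul_one] at hint
  have hfin := (ENNReal.add_le_add_iff_right ENNReal.one_ne_top).1
    (hint.trans (add_le_add_right hρ1 _))
  have t1 : ∫⁻ x, ENNReal.ofReal (U x) ∂ν ≠ ⊤ := hUi.lintegral_lt_top.ne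
  have t2 : ∫⁻ x, ENNReal.ofReal (-U x) ∂ν ≠ ⊤ := hUi.neg.lintegral_lt_top.ne
  have t3 : partitionEntropy ν g ≠ ⊤ :=
    ne_top_of_le_ne_top t1 (le_self_add.trans hfin)
  refine ⟨t3, ?_⟩
  have e1 : Real.log R - ∫ x, Real.log (b (g x)) ∂ν = ∫ x, U x ∂ν := by
    rw [hU, integral_sub (integrable_const _) hi]; simp
  rw [e1, integral_eq_lintegral_pos_part_sub_lintegral_neg_part hUi]
  have := ENNReal.toReal_mono t1 hfin
  rw [ENNReal.toReal_add t3 t2] at this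
  linarith

/-- A partition with one atom of almost full measure has small entropy. -/
lemma exists_partitionEntropy_le (M : ℕ) {η : ℝ} (hη : 0 < η) : ∃ δ > 0, ∀ (X : Type*)
    [MeasurableSpace X] (ν : Measure X) [IsProbabilityMeasure ν] (q : X → ℕ), Measurable q →
    (∀ x, q x ≤ M) → ν.real {x | q x ≠ 0} < δ → partitionEntropy ν q ≤ ENNReal.ofReal η := by
  have hM : (0 : ℝ) < M + 1 := by positivity
  have c0 : ∀ᶠ t in 𝓝 (0 : ℝ), Real.negMulLog t < η / (M + 1) :=
    (Real.continuous_negMulLog.tendsto 0).eventually_lt_const (by simpa using div_pos hη hM)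
  have c1 : ∀ᶠ t in 𝓝 (1 : ℝ), Real.negMulLog t < η / (M + 1) :=
    (Real.continuous_negMulLog.tendsto 1).eventually_lt_const (by simpa using div_pos hη hM)
  obtain ⟨δ0, h0, c0⟩ := Metric.eventually_nhds_iff.1 c0
  obtain ⟨δ1, h1, c1⟩ := Metric.eventually_nhds_iff.1 c1
  refine ⟨min δ0 δ1, lt_min h0 h1, fun X _ ν _ q hq hqM hν => ?_⟩
  have hsmall : ∀ a, Real.negMulLog (ν.real (q ⁻¹' {a})) ≤ η / (M + 1) := by
    intro a
    rcases Nat.eq_zero_or_pos a with rfl | ha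
    · refine (c1 ?_).le
      have : {x | q x ≠ 0} = (q ⁻¹' {0})ᶜ := by ext; simp
      rw [this, probReal_compl_eq_one_sub (hq (measurableSet_singleton 0))] at hν
      rw [Real.dist_eq, abs_sub_comm, abs_of_nonneg (sub_nonneg.2 measureReal_le_one)]
      exact hν.trans_le (min_le_right _ _)
    · refine (c0 ?_).le
      rw [Real.dist_eq, sub_zero, abs_of_nonneg measureReal_nonneg]
      refine lt_of_le_of_lt (measureReal_mono fun x hx => ?_) (hν.trans_le (min_le_left _ _))
      rw [mem_preimage, mem_singleton_iff] at hx
      change q x ≠ 0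
      omega
  unfold partitionEntropy
  rw [tsum_eq_sum (s := Finset.range (M + 1))]
  · calc _ ≤ ∑ _a ∈ Finset.range (M + 1), ENNReal.ofReal (η / (M + 1)) := by
          refine Finset.sum_le_sum fun a _ => ENNReal.ofReal_le_ofReal ?_
          simpa [Real.negMulLog, measureReal_def] using hsmall a
      _ = ENNReal.ofReal η := by
          rw [Finset.sum_const, Finset.card_range, nsmul_eq_mul, ← ENNReal.ofReal_natCast,
            ← ENNReal.ofReal_mul (by positivity)]
          congr 1
          push_cast
          field_simp
  · intro a ha
    have : q ⁻¹' {a} = ∅ := by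
      ext x
      simp only [Finset.mem_range, not_lt] at ha
      simp only [mem_preimage, mem_singleton_iff, mem_empty_iff_false, iff_false]
      have := hqM x
      omega
    simp [this]

section KolmogorovSinai

variable {S : Type*} [TopologicalSpace S] [DiscreteTopology S] [Countable S]
  {A : S → S → Prop}

/-- A finite measurable partition is approximated by a function of finitely many coordinates. -/
lemma exists_wd_approx (ν : Measure (Space A)) [IsProbabilityMeasure ν] {p : Space A → ℕ}
    (hp : Measurable p) {M : ℕ} (hM : ∀ x, p x ≤ M) {δ : ℝ} (hδ : 0 < δ) :
    ∃ (k : ℕ) (h : (Fin k → S) → ℕ), ν.real {x | p x ≠ h (wd A k x)} < δ := by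
  have hpm : Measurable fun x => (p x : ℝ) := measurable_from_top.comp hp
  have hpi : Integrable (fun x => (p x : ℝ)) ν :=
    (integrable_const (M : ℝ)).mono' hpm.aestronglyMeasurable
      (ae_of_all _ fun x => by simpa using hM x)
  obtain ⟨g, hg, -⟩ := hpi.exists_boundedContinuous_integral_sub_le
    (show 0 < δ / 8 by positivity)
  have hgC : ∀ x, |g x| ≤ ‖g‖ := fun x => g.norm_coe_le_norm x
  have hlim : Tendsto (fun n => ∫ x, |g x - lo g n (wd A n x)| ∂ν) atTop (𝓝 0) := by
    have : (0 : ℝ) = ∫ x, (0 : ℝ) ∂ν := by simp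
    rw [this]
    refine tendsto_integral_of_dominated_convergence (fun _ => ‖g‖ + ‖g‖)
      (fun n => (g.continuous.measurable.sub (measurable_lo g n)).abs.aestronglyMeasurable)
      (integrable_const _) (fun n => ae_of_all _ fun x => ?_) (ae_of_all _ fun x => ?_)
    · rw [Real.norm_eq_abs, abs_abs]
      exact (abs_sub _ _).trans (add_le_add (hgC x) (abs_lo_le hgC n x))
    · have := ((tendsto_lo hgC g.continuous x).const_sub (g x)).abs
      simpa using this
  obtain ⟨k, hk⟩ := (hlim.eventually_lt_const (show 0 < δ / 8 by positivity)).exists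
  refine ⟨k, fun w => ⌊lo g k w + 1 / 2⌋₊, ?_⟩
  set F : Space A → ℝ := fun x => |(p x : ℝ) - g x| + |g x - lo g k (wd A k x)| with hF
  have i1 : Integrable (fun x => |(p x : ℝ) - g x|) ν :=
    (hpi.sub (g.integrable ν)).abs
  have i2 : Integrable (fun x => |g x - lo g k (wd A k x)|) ν := by
    refine ((g.integrable ν).sub ?_).abs
    exact (integrable_const ‖g‖).mono' (measurable_lo g k).aestronglyMeasurable
      (ae_of_all _ fun x => abs_lo_le hgC k x)
  have hFi : ∫ x, F x ∂ν < δ / 4 := by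
    rw [hF, integral_add i1 i2]
    have : ∫ x, |(p x : ℝ) - g x| ∂ν ≤ δ / 8 := hg
    linarith
  have hsub : {x | p x ≠ ⌊lo g k (wd A k x) + 1 / 2⌋₊} ⊆ {x | 1 / 2 ≤ F x} := by
    intro x hx
    by_contra hlt
    simp only [mem_ofPred_eq, not_le] at hlt
    refine hx ?_
    have h3 : |(p x : ℝ) - lo g k (wd A k x)| < 1 / 2 :=
      (abs_sub_le _ (g x) _).trans_lt hlt
    rw [abs_lt] at h3
    symm
    rw [Nat.floor_eq_iff (by linarith [Nat.cast_nonneg (α := ℝ) (p x)])]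
    constructor <;> linarith
  have hmk := mul_meas_ge_le_integral_of_nonneg (μ := ν) (f := F)
    (ae_of_all _ fun x => by positivity) (i1.add i2) (1 / 2)
  have := measureReal_mono (μ := ν) hsub
  linarith

/-- The entropy of a finite partition is controlled by that of cylinder partitions. -/
lemma partitionEntropy_iterate_le_wd (ν : Measure (Space A)) [IsProbabilityMeasure ν]
    (hν : Invariant (shift A) ν) {p : Space A → ℕ} (hp : Measurable p) (hr : (range p).Finite)
    {η : ℝ} (hη : 0 < η) : ∃ k : ℕ, ∀ n : ℕ,
      partitionEntropy ν (fun x => fun i : Fin n => p ((shift A)^[i] x)) ≤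
        partitionEntropy ν (wd A (n + k)) + n * ENNReal.ofReal η := by
  obtain ⟨M, hM⟩ := hr.bddAbove
  obtain ⟨δ, hδ, hsmall⟩ := exists_partitionEntropy_le (M + 1) hη
  obtain ⟨k, h, hk⟩ := exists_wd_approx ν hp (M := M) (fun x => hM ⟨x, rfl⟩) hδ
  have hhm : Measurable fun x => h (wd A k x) := (measFibers_wd k).measurable_comp h
  have hset : MeasurableSet {x | p x = h (wd A k x)} := measurableSet_eq_fun hp hhm
  set q : Space A → ℕ := fun x => if p x = h (wd A k x) then 0 else p x + 1 with hq
  have hqm : Measurable q := Measurable.ite hset measurable_const (hp.add_const 1)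
  have hqM : ∀ x, q x ≤ M + 1 := by
    intro x
    have : p x ≤ M := hM ⟨x, rfl⟩
    simp only [hq]
    split_ifs <;> omega
  have hqe : partitionEntropy ν q ≤ ENNReal.ofReal η := by
    refine hsmall _ ν q hqm hqM ?_
    convert hk using 3
    ext x
    simp [hq]
  have hqf : MeasFibers q := measFibers_of_measurable hqm
  have hpf : MeasFibers p := measFibers_of_measurable hp
  have hq1 : ∀ n : ℕ, MeasFibers fun x => fun i : Fin n => q ((shift A)^[i] x) := fun n =>
    MeasFibers.pi fun i => hqf.comp_measurable (measurable_shift.iterate i)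
  have hp1 : ∀ n : ℕ, MeasFibers fun x => fun i : Fin n => p ((shift A)^[i] x) := fun n =>
    MeasFibers.pi fun i => hpf.comp_measurable (measurable_shift.iterate i)
  refine ⟨k, fun n => ?_⟩
  calc _ ≤ partitionEntropy ν
        (fun x => (wd A (n + k) x, fun i : Fin n => q ((shift A)^[i] x))) := by
        refine partitionEntropy_mono (hp1 n) ((measFibers_wd _).prodMk (hq1 n)) ν
          fun x y hxy => ?_
        simp only [Prod.mk.injEq] at hxy
        funext i
        have e1 := congrArg h (wd_shift_iterate_eq i.2 hxy.1)
        have e2 : q ((shift A)^[i] x) = q ((shift A)^[i] y) := congrFun hxy.2 i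
        simp only [hq] at e2
        split_ifs at e2 with h1 h2 h2
        · rw [h1, h2, e1]
        · omega
    _ ≤ _ := partitionEntropy_prod_le (measFibers_wd _) (hq1 n) ν
    _ ≤ _ := by
        gcongr
        exact (partitionEntropy_iterate_le measurable_shift hν hqf n).trans (by gcongr)

end KolmogorovSinai

/-! ### The lower bound -/

section LowerBound

variable {S : Type*} {A : S → S → Prop}

/-- Infimum of the Birkhoff sum over the points with a given initial word. -/
noncomputable def loSum (ψ : Space A → ℝ) (n : ℕ) (w : Fin n → S) : ℝ :=
  lo (birkhoff (shift A) ψ n) n w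

lemma abs_loSum_le {ψ : Space A → ℝ} {C : ℝ} (hC : ∀ x, |ψ x| ≤ C) (n : ℕ) (x : Space A) :
    |loSum ψ n (wd A n x)| ≤ n * C :=
  abs_lo_le (birkhoff_abs_le hC n) n x

lemma loSum_le {ψ : Space A → ℝ} {C : ℝ} (hC : ∀ x, |ψ x| ≤ C) {n : ℕ} {x y : Space A}
    (h : wd A n y = wd A n x) : loSum ψ n (wd A n x) ≤ birkhoff (shift A) ψ n y :=
  lo_le (birkhoff_abs_le hC n) h

variable [TopologicalSpace S]

/-- Logarithm of the moment generating function of the Birkhoff sum. -/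
noncomputable def logZ (μ : Measure (Space A)) (ψ : Space A → ℝ) (n : ℕ) : ℝ :=
  Real.log (∫ x, Real.exp (birkhoff (shift A) ψ n x) ∂μ)

variable {μ : Measure (Space A)} [IsProbabilityMeasure μ] {ψ : Space A → ℝ} {C : ℝ}

lemma integrable_of_abs_le {X : Type*} [MeasurableSpace X] {μ : Measure X}
    [IsProbabilityMeasure μ] {g : X → ℝ} (hg : Measurable g) {C : ℝ} (h : ∀ x, |g x| ≤ C) :
    Integrable g μ :=
  (integrable_const C).mono' hg.aestronglyMeasurable (ae_of_all _ h)

lemma integrable_exp_of_abs_le {X : Type*} [MeasurableSpace X] {μ : Measure X}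
    [IsProbabilityMeasure μ] {g : X → ℝ} (hg : Measurable g) {C : ℝ} (h : ∀ x, |g x| ≤ C) :
    Integrable (fun x => Real.exp (g x)) μ :=
  integrable_of_abs_le hg.exp (C := Real.exp C) fun x => by
    rw [abs_of_pos (Real.exp_pos _)]
    exact Real.exp_le_exp.2 (abs_le.1 (h x)).2

lemma integral_exp_pos' {X : Type*} [MeasurableSpace X] {μ : Measure X}
    [IsProbabilityMeasure μ] {g : X → ℝ} (hg : Measurable g) {C : ℝ} (h : ∀ x, |g x| ≤ C) :
    0 < ∫ x, Real.exp (g x) ∂μ :=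
  integral_exp_pos (integrable_exp_of_abs_le hg h)

lemma logZ_add_le (hψ : Measurable ψ) (hC : ∀ x, |ψ x| ≤ C) (n k : ℕ) :
    logZ μ ψ (n + k) ≤ logZ μ ψ n + k * C := by
  have hm := fun m => measurable_birkhoff (measurable_shift (A := A)) hψ m
  unfold logZ
  rw [← Real.log_exp (k * C), ← Real.log_mul
    (integral_exp_pos' (hm n) (birkhoff_abs_le hC n)).ne' (Real.exp_ne_zero _)]
  refine Real.log_le_log (integral_exp_pos' (hm _) (birkhoff_abs_le hC _)) ?_
  rw [← integral_mul_const]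
  refine integral_mono (integrable_exp_of_abs_le (hm _) (birkhoff_abs_le hC _))
    ((integrable_exp_of_abs_le (hm _) (birkhoff_abs_le hC _)).mul_const _) fun x => ?_
  simp only
  rw [← Real.exp_add, Real.exp_le_exp, birkhoff_add]
  linarith [(abs_le.1 (birkhoff_abs_le (T := shift A) hC k ((shift A)^[n] x))).2]

lemma abs_logZ_le (hψ : Measurable ψ) (hC : ∀ x, |ψ x| ≤ C) (n : ℕ) :
    |logZ μ ψ n| ≤ n * C := by
  have hm := measurable_birkhoff (measurable_shift (A := A)) hψ n
  have hi := integrable_exp_of_abs_le (μ := μ) hm (birkhoff_abs_le hC n)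
  have h1 : ∫ x, Real.exp (birkhoff (shift A) ψ n x) ∂μ ≤ Real.exp (n * C) := by
    have := integral_mono hi (integrable_const (Real.exp (n * C))) fun x =>
      Real.exp_le_exp.2 (abs_le.1 (birkhoff_abs_le hC n x)).2
    simpa using this
  have h2 : Real.exp (-(n * C)) ≤ ∫ x, Real.exp (birkhoff (shift A) ψ n x) ∂μ := by
    have := integral_mono (integrable_const (Real.exp (-(n * C)))) hi fun x =>
      Real.exp_le_exp.2 (abs_le.1 (birkhoff_abs_le hC n x)).1
    simpa using this
  rw [abs_le]
  constructor
  · have := Real.log_le_log (Real.exp_pos _) h2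
    rwa [Real.log_exp] at this
  · have := Real.log_le_log ((Real.exp_pos _).trans_le h2) h1
    rwa [Real.log_exp] at this

variable [DiscreteTopology S] [Countable S]

lemma measurable_loSum (ψ : Space A → ℝ) (n : ℕ) :
    Measurable fun x => loSum ψ n (wd A n x) :=
  measurable_lo _ n

lemma log_integral_loSum_le (hψ : Measurable ψ) (hC : ∀ x, |ψ x| ≤ C) (n : ℕ) :
    Real.log (∫ x, Real.exp (loSum ψ n (wd A n x)) ∂μ) ≤ logZ μ ψ n := by
  refine Real.log_le_log (integral_exp_pos' (measurable_loSum ψ n) (abs_loSum_le hC n)) ?_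
  exact integral_mono (integrable_exp_of_abs_le (measurable_loSum ψ n) (abs_loSum_le hC n))
    (integrable_exp_of_abs_le (measurable_birkhoff measurable_shift hψ n) (birkhoff_abs_le hC n))
    fun x => Real.exp_le_exp.2 (loSum_le hC rfl)

lemma tsum_weight_eq (hC : ∀ x, |ψ x| ≤ C) (n : ℕ) :
    ∑' w, ENNReal.ofReal (μ.real (wd A n ⁻¹' {w}) * Real.exp (loSum ψ n w)) =
      ENNReal.ofReal (∫ x, Real.exp (loSum ψ n (wd A n x)) ∂μ) := by
  rw [ofReal_integral_eq_lintegral_ofReal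
    (integrable_exp_of_abs_le (measurable_loSum ψ n) (abs_loSum_le hC n))
    (ae_of_all _ fun x => (Real.exp_pos _).le),
    (measFibers_wd n).lintegral_comp μ fun w => ENNReal.ofReal (Real.exp (loSum ψ n w))]
  refine tsum_congr fun w => ?_
  rw [mul_comm, ENNReal.ofReal_mul (Real.exp_pos _).le, ofReal_measureReal]

lemma sum_integral_lo_le (ν : Measure (Space A)) [IsProbabilityMeasure ν]
    (hν : Invariant (shift A) ν) (hC : ∀ x, |ψ x| ≤ C) (n : ℕ) :
    ∑ j ∈ Finset.range n, ∫ x, lo ψ (j + 1) (wd A (j + 1) x) ∂ν ≤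
      ∫ x, loSum ψ n (wd A n x) ∂ν := by
  have hi : ∀ k, Integrable (fun x => lo ψ k (wd A k x)) ν := fun k =>
    integrable_of_abs_le (measurable_lo ψ k) (abs_lo_le hC k)
  calc _ = ∑ i ∈ Finset.range n,
        ∫ x, lo ψ (n - i) (wd A (n - i) ((shift A)^[i] x)) ∂ν := by
        rw [← Finset.sum_range_reflect]
        refine Finset.sum_congr rfl fun i hi => ?_
        rw [Finset.mem_range] at hi
        rw [hν.integral_iterate measurable_shift (measurable_lo ψ (n - i)),
          show n - 1 - i + 1 = n - i by omega]
    _ = ∫ x, ∑ i ∈ Finset.range n, lo ψ (n - i) (wd A (n - i) ((shift A)^[i] x)) ∂ν :=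
        (integral_finsetSum _ fun i _ => hν.integrable_iterate measurable_shift (hi _) i).symm
    _ ≤ _ := by
        refine integral_mono (integrable_finsetSum _ fun i _ =>
            hν.integrable_iterate measurable_shift (hi (n - i)) i)
          (integrable_of_abs_le (measurable_loSum ψ n) (abs_loSum_le hC n)) fun x => ?_
        refine le_lo fun y hy => Finset.sum_le_sum fun i hi => lo_le hC (wd_shift_eq ?_)
        rw [Finset.mem_range] at hi
        rw [Nat.add_sub_cancel' hi.le]
        exact hy

variable {f : Space A → ℝ} {c : ℝ}

/-- Entropy of the cylinder partition against a Gibbs state. -/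
lemma GibbsBound.partitionEntropy_wd_le (h : GibbsBound f μ c) (hc : 1 ≤ c)
    (hf : Measurable f) (hψ : Measurable ψ) (hC : ∀ x, |ψ x| ≤ C)
    (ν : Measure (Space A)) [IsProbabilityMeasure ν] (hν : Invariant (shift A) ν)
    (hfi : Integrable f ν) (n : ℕ) :
    partitionEntropy ν (wd A n) ≠ ⊤ ∧ (partitionEntropy ν (wd A n)).toReal ≤
      logZ μ ψ n - n * ∫ x, f x ∂ν + Real.log c -
        ∑ j ∈ Finset.range n, ∫ x, lo ψ (j + 1) (wd A (j + 1) x) ∂ν := by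
  have hbi := hν.integrable_birkhoff measurable_shift hfi n
  have hlm : Measurable fun x => Real.log (μ.real (wd A n ⁻¹' {wd A n x})) :=
    (measFibers_wd n).measurable_log_measure μ
  have i1 : Integrable (fun x => Real.log (μ.real (wd A n ⁻¹' {wd A n x}))) ν := by
    refine (hbi.abs.add (integrable_const (Real.log c))).mono' hlm.aestronglyMeasurable
      (ae_of_all _ fun x => ?_)
    have h1 := h.log_le hc n x
    have h2 := h.le_log hc n x
    have h3 := abs_le.1 (le_refl |birkhoff (shift A) f n x|)
    rw [Real.norm_eq_abs, abs_le, Pi.add_apply]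
    constructor <;> linarith
  have i2 : Integrable (fun x => loSum ψ n (wd A n x)) ν :=
    integrable_of_abs_le (measurable_loSum ψ n) (abs_loSum_le hC n)
  have hlog : ∀ x, Real.log (μ.real (wd A n ⁻¹' {wd A n x}) *
      Real.exp (loSum ψ n (wd A n x))) =
      Real.log (μ.real (wd A n ⁻¹' {wd A n x})) + loSum ψ n (wd A n x) := fun x => by
    rw [Real.log_mul (h.pos hc n x).ne' (Real.exp_ne_zero _), Real.log_exp]
  obtain ⟨h1, h2⟩ := partitionEntropy_le_of_weights (measFibers_wd n) ν
    (fun w => μ.real (wd A n ⁻¹' {w}) * Real.exp (loSum ψ n w))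
    (fun x => mul_pos (h.pos hc n x) (Real.exp_pos _))
    (integral_exp_pos' (μ := μ) (measurable_loSum ψ n) (abs_loSum_le hC n))
    (tsum_weight_eq hC n).le (by simp only [hlog]; exact i1.add i2)
  refine ⟨h1, h2.trans ?_⟩
  simp only [hlog]
  rw [integral_add i1 i2]
  have h3 := log_integral_loSum_le (μ := μ) hψ hC n
  have h4 := sum_integral_lo_le ν hν hC n
  have h5 : n * ∫ x, f x ∂ν - Real.log c ≤
      ∫ x, Real.log (μ.real (wd A n ⁻¹' {wd A n x})) ∂ν := by
    have := integral_mono (hbi.sub (integrable_const (Real.log c))) i1 fun x => h.le_log hc n x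
    rw [integral_sub' hbi (integrable_const _), hν.integral_birkhoff measurable_shift hf hfi]
      at this
    simpa using this
  linarith

/-- The variational lower bound for the moment generating functions. -/
lemma GibbsBound.entropy_add_le_liminf (h : GibbsBound f μ c) (hc : 1 ≤ c)
    (hf : Measurable f) (hψ : Continuous ψ) (hC : ∀ x, |ψ x| ≤ C)
    (ν : Measure (Space A)) [IsProbabilityMeasure ν] (hν : Invariant (shift A) ν)
    (hfi : Integrable f ν) :
    ((entropy (shift A) ν : ℝ≥0∞) : EReal) + ((∫ x, f x ∂ν + ∫ x, ψ x ∂ν : ℝ) : EReal) ≤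
      liminf (fun n : ℕ => (((n : ℝ)⁻¹ * logZ μ ψ n : ℝ) : EReal)) atTop := by
  rw [← EReal.le_of_forall_lt_iff_le]
  intro q hq
  have hfreq := frequently_lt_of_liminf_lt (by isBoundedDefault) hq
  set v : ℕ → ℝ := fun j => ∫ x, lo ψ (j + 1) (wd A (j + 1) x) ∂ν with hv
  have hces : Tendsto (fun n : ℕ => (n : ℝ)⁻¹ * ∑ i ∈ Finset.range n, v i) atTop
      (𝓝 (∫ x, ψ x ∂ν)) :=
    ((tendsto_integral_lo hC hψ ν).comp (tendsto_add_atTop_nat 1)).cesaro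
  set B : ℝ := q - (∫ x, f x ∂ν + ∫ x, ψ x ∂ν) with hB
  have hv1 : ∀ j, |v j| ≤ C := fun j => by
    have := norm_integral_le_of_norm_le_const (μ := ν) (C := C)
      (f := fun x => lo ψ (j + 1) (wd A (j + 1) x))
      (ae_of_all _ fun x => by exact abs_lo_le hC (j + 1) x)
    simpa using this
  have main : ∀ k : ℕ, ∀ η > 0, ∃ᶠ n : ℕ in atTop, 0 < n ∧
      0 ≤ B + η ∧ partitionEntropy ν (wd A (n + k)) ≤ ENNReal.ofReal (n * (B + η)) := by
    intro k η hη
    have hinv : Tendsto (fun n : ℕ => (n : ℝ)⁻¹) atTop (𝓝 0) := tendsto_inv_atTop_nhds_zero_nat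
    have hr : Tendsto (fun n : ℕ => (n : ℝ)⁻¹ *
        (k * C + Real.log c - k * ∫ x, f x ∂ν + k * C) - (n : ℝ)⁻¹ * ∑ i ∈ Finset.range n, v i)
        atTop (𝓝 (0 - ∫ x, ψ x ∂ν)) := by
      simpa using (hinv.mul_const _).sub hces
    have hev := hr.eventually_lt_const (show 0 - ∫ x, ψ x ∂ν < 0 - ∫ x, ψ x ∂ν + η by linarith)
    refine (hfreq.and_eventually (hev.and (eventually_gt_atTop 0))).mono ?_
    rintro n ⟨hn1, hn2, hn⟩
    have hn0 : (0 : ℝ) < n := by exact_mod_cast hn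
    obtain ⟨g1, g2⟩ := h.partitionEntropy_wd_le hc hf hψ.measurable hC ν hν hfi (n + k)
    have hZ := logZ_add_le (μ := μ) hψ.measurable hC n k
    rw [EReal.coe_lt_coe_iff] at hn1
    have hs : ∑ j ∈ Finset.range n, v j - k * C ≤ ∑ j ∈ Finset.range (n + k), v j := by
      rw [Finset.sum_range_add]
      have : ∑ _x ∈ Finset.range k, -C ≤ ∑ x ∈ Finset.range k, v (n + x) :=
        Finset.sum_le_sum fun i _ => (abs_le.1 (hv1 _)).1
      rw [Finset.sum_const, Finset.card_range, nsmul_eq_mul] at this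
      linarith
    have e1 : logZ μ ψ n ≤ n * q := by
      rw [inv_mul_lt_iff₀ hn0] at hn1; exact hn1.le
    have e2 : (k * C + Real.log c - k * ∫ x, f x ∂ν + k * C) - ∑ i ∈ Finset.range n, v i ≤
        n * (η - ∫ x, ψ x ∂ν) := by
      rw [← mul_sub, inv_mul_lt_iff₀ hn0] at hn2
      linarith
    have e3 : (partitionEntropy ν (wd A (n + k))).toReal ≤ n * (B + η) := by
      refine g2.trans ?_
      push_cast
      rw [hB]
      linarith
    refine ⟨hn, ?_, ?_⟩
    · exact nonneg_of_mul_nonneg_right (ENNReal.toReal_nonneg.trans e3) hn0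
    · rw [← ENNReal.ofReal_toReal g1]
      exact ENNReal.ofReal_le_ofReal e3
  have hB0 : 0 ≤ B := le_of_forall_pos_le_add fun η hη => by
    obtain ⟨n, -, hn, -⟩ := (main 0 η hη).exists
    exact hn
  have hent : entropy (shift A) ν ≤ ENNReal.ofReal B := by
    refine iSup₂_le fun p hp => ?_
    refine ENNReal.le_of_forall_pos_le_add fun η hη _ => ?_
    have hη2 : (0 : ℝ) < η / 2 := by positivity
    obtain ⟨k, hk⟩ := partitionEntropy_iterate_le_wd ν hν hp.1 hp.2 hη2
    refine liminf_le_of_frequently_le' ((main k _ hη2).mono ?_)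
    rintro n ⟨hn, -, hn2⟩
    have hn0 : (0 : ℝ) < n := by exact_mod_cast hn
    calc _ ≤ ENNReal.ofReal ((n : ℝ)⁻¹) *
          (ENNReal.ofReal (n * (B + η / 2)) + n * ENNReal.ofReal (η / 2)) := by
          gcongr
          exact (hk n).trans (by gcongr)
      _ = ENNReal.ofReal B + η := by
          rw [← ENNReal.ofReal_natCast, ← ENNReal.ofReal_mul hn0.le,
            ← ENNReal.ofReal_add (by positivity) (by positivity),
            ← ENNReal.ofReal_mul (by positivity), ← ENNReal.ofReal_coe_nnreal (p := η),
            ← ENNReal.ofReal_add hB0 η.coe_nonneg]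
          congr 1
          field_simp
          ring
  calc _ ≤ ((ENNReal.ofReal B : ℝ≥0∞) : EReal) +
        ((∫ x, f x ∂ν + ∫ x, ψ x ∂ν : ℝ) : EReal) := by
        gcongr
        exact EReal.coe_ennreal_le_coe_ennreal_iff.2 hent
    _ = q := by
        rw [EReal.coe_ennreal_ofReal, max_eq_left hB0, ← EReal.coe_add]
        simp [hB]

end LowerBound

/-! ### Exponential tightness and replacement of Birkhoff sums by cylinder functions -/

section ExponentialTightness

variable {S : Type*} {A : S → S → Prop}

/-- The number of `j < k` with `a ∉ F j`. -/
noncomputable def defect (F : ℕ → Finset S) (k : ℕ) (a : S) : ℝ :=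
  open Classical in ∑ j ∈ Finset.range k, if a ∈ F j then 0 else 1

lemma defect_nonneg (F : ℕ → Finset S) (k : ℕ) (a : S) : 0 ≤ defect F k a :=
  Finset.sum_nonneg fun j _ => by split_ifs <;> norm_num

lemma exp_defect_le (F : ℕ → Finset S) {t : ℝ} (ht : 0 ≤ t) (k : ℕ) (a : S) :
    defect F k a ≤ k ∧ ENNReal.ofReal (Real.exp (t * defect F k a)) ≤
      1 + ∑ j ∈ Finset.range k, ENNReal.ofReal (Real.exp (t * (j + 1))) *
        (F j : Set S)ᶜ.indicator 1 a := by
  classical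
  induction k with
  | zero => simp [defect]
  | succ k ih =>
    have e : defect F (k + 1) a = defect F k a + if a ∈ F k then 0 else 1 := by
      simp [defect, Finset.sum_range_succ]
    rw [e, Finset.sum_range_succ, ← add_assoc]
    by_cases h : a ∈ F k
    · simp only [h, if_true, add_zero]
      refine ⟨ih.1.trans (by simp), ih.2.trans le_self_add⟩
    · simp only [h, if_false]
      refine ⟨by push_cast; linarith [ih.1], le_add_of_le_right ?_⟩
      rw [indicator_of_mem (by simpa using h), Pi.one_apply, mul_one]
      refine ENNReal.ofReal_le_ofReal (Real.exp_le_exp.2 ?_)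
      exact mul_le_mul_of_nonneg_left (by linarith [ih.1]) ht

lemma birkhoff_sub_loSum_le {ψ : Space A → ℝ} {C : ℝ} (hC : ∀ x, |ψ x| ≤ C) {F : ℕ → Finset S}
    {ε : ℝ} (hε : 0 < ε) {k : ℕ} (hk : ∀ x y : Space A, (∀ j < k, x.1 j ∈ F j) →
      wd A k y = wd A k x → |ψ x - ψ y| ≤ ε) (n : ℕ) (x : Space A) :
    birkhoff (shift A) ψ n x ≤ loSum ψ n (wd A n x) +
      (n * ε + 2 * C * k + 2 * C * ∑ m ∈ Finset.range n, defect F k (x.1 m)) := by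
  classical
  have hC0 : 0 ≤ C := (abs_nonneg _).trans (hC x)
  have hdiff : ∀ z w : Space A, ψ z - ψ w ≤ 2 * C := fun z w => by
    linarith [(abs_le.1 (hC z)).2, (abs_le.1 (hC w)).1]
  have hd : 0 ≤ ∑ m ∈ Finset.range n, defect F k (x.1 m) :=
    Finset.sum_nonneg fun m _ => defect_nonneg F k _
  rw [← sub_le_iff_le_add]
  refine le_lo fun y hy => ?_
  rw [sub_le_comm]
  have e0 : birkhoff (shift A) ψ n x - birkhoff (shift A) ψ n y =
      ∑ i ∈ Finset.range n, (ψ ((shift A)^[i] x) - ψ ((shift A)^[i] y)) := by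
    simp only [birkhoff, Finset.sum_sub_distrib]
  rw [e0]
  rcases le_total n k with hnk | hnk
  · calc _ ≤ ∑ _i ∈ Finset.range n, 2 * C := Finset.sum_le_sum fun i _ => hdiff _ _
      _ = n * (2 * C) := by simp
      _ ≤ k * (2 * C) := by gcongr
      _ ≤ _ := by nlinarith [mul_nonneg hC0 hd, Nat.cast_nonneg (α := ℝ) n]
  · obtain ⟨N, rfl⟩ := Nat.exists_eq_add_of_le' hnk
    rw [Finset.sum_range_add]
    have t1 : ∑ i ∈ Finset.range k, (ψ ((shift A)^[N + i] x) - ψ ((shift A)^[N + i] y)) ≤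
        k * (2 * C) := by
      calc _ ≤ ∑ _i ∈ Finset.range k, 2 * C := Finset.sum_le_sum fun i _ => hdiff _ _
        _ = _ := by simp
    have t2 : ∑ i ∈ Finset.range N, (ψ ((shift A)^[i] x) - ψ ((shift A)^[i] y)) ≤
        ∑ i ∈ Finset.range N,
          (ε + 2 * C * ∑ j ∈ Finset.range k, if x.1 (i + j) ∈ F j then 0 else 1) := by
      refine Finset.sum_le_sum fun i hi => ?_
      have hnn : 0 ≤ ∑ j ∈ Finset.range k, (if x.1 (i + j) ∈ F j then (0 : ℝ) else 1) :=
        Finset.sum_nonneg fun j _ => by split_ifs <;> norm_num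
      by_cases hgood : ∀ j < k, ((shift A)^[i] x).1 j ∈ F j
      · have := hk _ ((shift A)^[i] y) hgood
          (wd_shift_iterate_eq (Finset.mem_range.1 hi) hy)
        have := (abs_le.1 this).2
        nlinarith
      · push Not at hgood
        obtain ⟨j, hj, hjF⟩ := hgood
        rw [shift_iterate_val] at hjF
        have h1 : (1 : ℝ) ≤ ∑ j ∈ Finset.range k, if x.1 (i + j) ∈ F j then (0 : ℝ) else 1 := by
          have := Finset.single_le_sum
            (f := fun j => if x.1 (i + j) ∈ F j then (0 : ℝ) else 1)
            (fun j _ => by split_ifs <;> norm_num) (Finset.mem_range.2 hj)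
          simpa [hjF] using this
        have := hdiff ((shift A)^[i] x) ((shift A)^[i] y)
        nlinarith
    have t3 : ∑ i ∈ Finset.range N,
        (∑ j ∈ Finset.range k, if x.1 (i + j) ∈ F j then (0 : ℝ) else 1) ≤
        ∑ m ∈ Finset.range (N + k), defect F k (x.1 m) := by
      unfold defect
      rw [Finset.sum_comm, Finset.sum_comm (s := Finset.range (N + k))]
      refine Finset.sum_le_sum fun j hj => ?_
      rw [Finset.mem_range] at hj
      set d : ℕ → ℝ := fun m => if x.1 m ∈ F j then 0 else 1 with hd
      have hd0 : ∀ m, 0 ≤ d m := fun m => by simp only [hd]; split_ifs <;> norm_num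
      calc ∑ i ∈ Finset.range N, d (i + j) ≤
            ∑ i ∈ Finset.range j, d i + ∑ i ∈ Finset.range N, d (j + i) := by
            simp_rw [add_comm j]
            exact le_add_of_nonneg_left (Finset.sum_nonneg fun _ _ => hd0 _)
        _ = ∑ i ∈ Finset.range (j + N), d i := (Finset.sum_range_add _ _ _).symm
        _ ≤ _ := Finset.sum_le_sum_of_subset_of_nonneg
            (Finset.range_subset_range.2 (by omega)) fun _ _ _ => hd0 _
    rw [Finset.sum_add_distrib, ← Finset.mul_sum] at t2
    simp only [Finset.sum_const, Finset.card_range, nsmul_eq_mul] at t2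
    have t4 := mul_le_mul_of_nonneg_left t3 (show 0 ≤ 2 * C by positivity)
    have t5 : 0 ≤ k * ε := by positivity
    push_cast
    linarith

variable [TopologicalSpace S]

/-- Uniform continuity on products of finite sets. -/
lemma exists_uniform_osc {ψ : Space A → ℝ} (hψ : Continuous ψ) (F : ℕ → Finset S) {ε : ℝ}
    (hε : 0 < ε) : ∃ k, ∀ x y : Space A, (∀ j < k, x.1 j ∈ F j) → wd A k y = wd A k x →
      |ψ x - ψ y| ≤ ε := by
  by_contra! hcon
  choose x y hxF hxy hosc using hcon
  let U : Ultrafilter ℕ := hyperfilter ℕ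
  have hU : (U : Filter ℕ) ≤ atTop := Nat.hyperfilter_le_atTop
  have ha : ∀ j, ∃ a ∈ (F j : Set S), ∀ᶠ k in U, (x k).1 j = a := by
    intro j
    rw [← U.eventually_exists_mem_iff (F j).finite_toSet]
    filter_upwards [hU (eventually_gt_atTop j)] with k hk
    exact ⟨_, hxF k j hk, rfl⟩
  choose a _ ha using ha
  have hz : ∀ i, A (a i) (a (i + 1)) := by
    intro i
    obtain ⟨k, h1, h2⟩ := ((ha i).and (ha (i + 1))).exists
    rw [← h1, ← h2]
    exact (x k).2 i
  let z : Space A := ⟨a, hz⟩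
  obtain ⟨n, hn⟩ := exists_wd_subset_of_mem_nhds
    (hψ.continuousAt.preimage_mem_nhds (Metric.ball_mem_nhds (ψ z) (half_pos hε)))
  have hev : ∀ᶠ k in U, ∀ i ∈ Finset.range n, (x k).1 i = a i :=
    (Finset.eventually_all _).2 fun i _ => ha i
  obtain ⟨k, h1, h2⟩ := (hev.and (hU (eventually_ge_atTop n))).exists
  have hx : wd A n (x k) = wd A n z := wd_eq_iff.2 fun i hi => h1 i (Finset.mem_range.2 hi)
  have hy : wd A n (y k) = wd A n z := (wd_eq_of_le h2 (hxy k)).trans hx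
  have e1 := hn _ hx
  have e2 := hn _ hy
  rw [mem_preimage, Metric.mem_ball] at e1 e2
  have := dist_triangle_right (ψ (x k)) (ψ (y k)) (ψ z)
  rw [Real.dist_eq] at this
  linarith [hosc k]

variable [DiscreteTopology S]

lemma measFibers_coord (i : ℕ) : MeasFibers fun x : Space A => x.1 i :=
  fun a => ((isOpen_discrete {a}).preimage (continuous_coord i)).measurableSet

variable [Countable S] {μ : Measure (Space A)} [IsProbabilityMeasure μ]
  {f : Space A → ℝ} {c : ℝ}

lemma GibbsBound.lintegral_prod_le (h : GibbsBound f μ c) (hc : 1 ≤ c) (u : S → ℝ≥0∞) (n : ℕ) :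
    ∫⁻ x, ∏ i ∈ Finset.range n, u (x.1 i) ∂μ ≤
      (ENNReal.ofReal (c ^ 3) * ∫⁻ x, u (x.1 0) ∂μ) ^ n := by
  induction n with
  | zero => simp
  | succ n ih =>
    have hm := (measFibers_wd (A := A) n).prodMk (measFibers_coord n)
    set v : (Fin n → S) → ℝ≥0∞ := fun w => ∏ i, u (w i) with hv
    have e1 : ∀ x : Space A, ∏ i ∈ Finset.range (n + 1), u (x.1 i) =
        (fun p : (Fin n → S) × S => v p.1 * u p.2) (wd A n x, x.1 n) := fun x => by
      rw [Finset.prod_range_succ, Finset.prod_range]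
      rfl
    have e2 : ∀ x : Space A, ∏ i ∈ Finset.range n, u (x.1 i) = v (wd A n x) := fun x => by
      rw [Finset.prod_range]
      rfl
    have hle : ∀ p : (Fin n → S) × S, μ ((fun x => (wd A n x, x.1 n)) ⁻¹' {p}) ≤
        ENNReal.ofReal (c ^ 3) * (μ (wd A n ⁻¹' {p.1}) * μ ((fun x => x.1 0) ⁻¹' {p.2})) := by
      rintro ⟨w, a⟩
      rcases ((fun x => (wd A n x, x.1 n)) ⁻¹' {(w, a)}).eq_empty_or_nonempty with h0 | ⟨x, hx⟩
      · simp [h0]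
      · simp only [mem_preimage, mem_singleton_iff, Prod.mk.injEq] at hx
        obtain ⟨rfl, rfl⟩ := hx
        have s1 : (fun x => (wd A n x, x.1 n)) ⁻¹' {(wd A n x, x.1 n)} =
            wd A (n + 1) ⁻¹' {wd A (n + 1) x} := by
          ext y
          simp only [mem_preimage, mem_singleton_iff, Prod.mk.injEq, wd_add_eq_iff]
          simp [wd_eq_iff (n := 1), shift_iterate_val]
        have s2 : (fun y : Space A => y.1 0) ⁻¹' {x.1 n} =
            wd A 1 ⁻¹' {wd A 1 ((shift A)^[n] x)} := by
          ext y
          simp [wd_eq_iff, shift_iterate_val]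
        simp only
        rw [s1, s2, ← ofReal_measureReal, ← ofReal_measureReal, ← ofReal_measureReal,
          ← ENNReal.ofReal_mul measureReal_nonneg, ← ENNReal.ofReal_mul (by positivity)]
        exact ENNReal.ofReal_le_ofReal (h.measure_add_le hc n 1 x)
    simp_rw [e1]
    rw [hm.lintegral_comp μ fun p => v p.1 * u p.2]
    calc _ ≤ ∑' p : (Fin n → S) × S, ENNReal.ofReal (c ^ 3) *
          ((v p.1 * μ (wd A n ⁻¹' {p.1})) * (u p.2 * μ ((fun x => x.1 0) ⁻¹' {p.2}))) := by
          refine ENNReal.tsum_le_tsum fun p => ?_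
          calc _ ≤ v p.1 * u p.2 * _ := mul_le_mul_right (hle p) _
            _ = _ := by ring
      _ = ENNReal.ofReal (c ^ 3) * ((∫⁻ x, v (wd A n x) ∂μ) * ∫⁻ x, u (x.1 0) ∂μ) := by
          rw [(measFibers_wd n).lintegral_comp μ v, (measFibers_coord 0).lintegral_comp μ u,
            ENNReal.tsum_mul_left, ENNReal.tsum_prod (f := fun w a =>
              (v w * μ (wd A n ⁻¹' {w})) * (u a * μ ((fun x => x.1 0) ⁻¹' {a})))]
          simp_rw [ENNReal.tsum_mul_left, ENNReal.tsum_mul_right]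
      _ ≤ _ := by
          simp_rw [e2] at ih
          rw [pow_succ _ n]
          calc _ ≤ ENNReal.ofReal (c ^ 3) * ((ENNReal.ofReal (c ^ 3) * ∫⁻ x, u (x.1 0) ∂μ) ^ n *
                ∫⁻ x, u (x.1 0) ∂μ) := mul_le_mul_right (mul_le_mul_left ih _) _
            _ = _ := mul_left_comm _ _ _

lemma exists_finset_measure_le (μ : Measure (Space A)) [IsProbabilityMeasure μ] {η : ℝ≥0∞}
    (hη : 0 < η) : ∃ F : Finset S, ∫⁻ x, (F : Set S)ᶜ.indicator 1 (x.1 0) ∂μ ≤ η := by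
  have hfin : ∑' a, μ ((fun x : Space A => x.1 0) ⁻¹' {a}) ≠ ⊤ := by
    have := (measFibers_coord (A := A) 0).lintegral_comp μ fun _ => 1
    simp only [lintegral_const, measure_univ, one_mul] at this
    rw [← this]
    exact ENNReal.one_ne_top
  obtain ⟨F, hF⟩ := ((ENNReal.tendsto_tsum_compl_atTop_zero hfin).eventually_le_const hη).exists
  refine ⟨F, le_trans (le_of_eq ?_) hF⟩
  rw [(measFibers_coord 0).lintegral_comp μ fun a => (F : Set S)ᶜ.indicator 1 a]
  have := tsum_subtype ((F : Set S)ᶜ) fun a => μ ((fun x : Space A => x.1 0) ⁻¹' {a})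
  refine Eq.trans (tsum_congr fun a => ?_) this.symm
  by_cases ha : a ∈ F <;> simp [ha]

/-- Replacing Birkhoff sums by their infima over cylinders does not change exponential growth. -/
lemma GibbsBound.logZ_le (h : GibbsBound f μ c) (hc : 1 ≤ c) {ψ : Space A → ℝ} {C : ℝ}
    (hψ : Continuous ψ) (hC : ∀ x, |ψ x| ≤ C) {ε : ℝ} (hε : 0 < ε) :
    ∃ D : ℝ, ∀ n : ℕ, 1 ≤ n → logZ μ ψ n ≤
      Real.log (∫ x, Real.exp (loSum ψ n (wd A n x)) ∂μ) + n * ε + D := by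
  have hne : Nonempty (Space A) := μ.nonempty_of_neZero
  have hC0 : 0 ≤ C := (abs_nonneg _).trans (hC hne.some)
  have hlc : 0 ≤ Real.log (2 * c ^ 3) := Real.log_nonneg (by nlinarith [one_le_pow₀ hc (n := 3)])
  set δ : ℝ := ε / 2 / (2 * C + 1) with hδ
  have hδ0 : 0 < δ := by positivity
  set t : ℝ := (2 * C + 1 + Real.log (2 * c ^ 3)) / δ with ht
  have ht0 : 0 ≤ t := by positivity
  choose F hF using fun j : ℕ => exists_finset_measure_le μ
    (η := ENNReal.ofReal (Real.exp (-(t * (j + 1))) * (1 / 2) ^ (j + 1)))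
    (ENNReal.ofReal_pos.2 (by positivity))
  obtain ⟨k, hk⟩ := exists_uniform_osc hψ F (half_pos hε)
  refine ⟨2 * C * k + Real.log 2, fun n hn => ?_⟩
  have hn1 : (1 : ℝ) ≤ n := by exact_mod_cast hn
  have hmom : ∫⁻ x : Space A, ENNReal.ofReal (Real.exp (t * defect F k (x.1 0))) ∂μ ≤ 2 := by
    have hmeas : ∀ u : S → ℝ≥0∞, Measurable fun x : Space A => u (x.1 0) := fun u =>
      (measFibers_coord 0).measurable_comp u
    calc _ ≤ ∫⁻ x : Space A, (1 + ∑ j ∈ Finset.range k, ENNReal.ofReal (Real.exp (t * (j + 1))) *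
          (F j : Set S)ᶜ.indicator 1 (x.1 0)) ∂μ :=
          lintegral_mono fun x => (exp_defect_le F ht0 k _).2
      _ = 1 + ∑ j ∈ Finset.range k, ENNReal.ofReal (Real.exp (t * (j + 1))) *
          ∫⁻ x, (F j : Set S)ᶜ.indicator 1 (x.1 0) ∂μ := by
          rw [lintegral_add_left measurable_const, lintegral_const, measure_univ, mul_one,
            lintegral_finsetSum _ fun (j : ℕ) _ => hmeas fun a =>
              ENNReal.ofReal (Real.exp (t * ((j : ℝ) + 1))) * (F j : Set S)ᶜ.indicator 1 a]
          congr 1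
          exact Finset.sum_congr rfl fun j _ => lintegral_const_mul _ (hmeas _)
      _ ≤ 1 + ∑ j ∈ Finset.range k, ENNReal.ofReal ((1 / 2) ^ (j + 1)) := by
          gcongr with j _
          refine (mul_le_mul_right (hF j) _).trans (le_of_eq ?_)
          rw [← ENNReal.ofReal_mul (Real.exp_pos _).le, ← mul_assoc, ← Real.exp_add,
            add_neg_cancel, Real.exp_zero, one_mul]
      _ ≤ 1 + 1 := by
          gcongr
          rw [← ENNReal.ofReal_sum_of_nonneg fun j _ => by positivity, ← ENNReal.ofReal_one]
          refine ENNReal.ofReal_le_ofReal ?_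
          have : ∀ m : ℕ, ∑ j ∈ Finset.range m, (1 / 2 : ℝ) ^ (j + 1) = 1 - (1 / 2) ^ m := by
            intro m
            induction m with
            | zero => simp
            | succ m ih => rw [Finset.sum_range_succ, ih]; ring
          rw [this]
          exact sub_le_self _ (by positivity)
      _ = 2 := by norm_num
  set G : Space A → ℝ := fun x => ∑ m ∈ Finset.range n, defect F k (x.1 m) with hG
  have hGm : Measurable G := Finset.measurable_sum _ fun m _ =>
    (measFibers_coord m).measurable_comp (defect F k)
  set bad : Set (Space A) := {x | n * δ ≤ G x} with hbad
  have hbadm : MeasurableSet bad := measurableSet_le measurable_const hGm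
  have hμbad : μ.real bad ≤ Real.exp (-(n * (2 * C + 1))) := by
    have h1 : ∫⁻ x, ENNReal.ofReal (Real.exp (t * G x)) ∂μ ≤
        ENNReal.ofReal (Real.exp (n * Real.log (2 * c ^ 3))) := by
      calc _ = ∫⁻ x, ∏ m ∈ Finset.range n,
            ENNReal.ofReal (Real.exp (t * defect F k (x.1 m))) ∂μ := by
            refine lintegral_congr fun x => ?_
            rw [← ENNReal.ofReal_prod_of_nonneg fun m _ => (Real.exp_pos _).le, ← Real.exp_sum,
              hG, Finset.mul_sum]
        _ ≤ _ := h.lintegral_prod_le hc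
            (fun a => ENNReal.ofReal (Real.exp (t * defect F k a))) n
        _ ≤ (ENNReal.ofReal (c ^ 3) * 2) ^ n := by gcongr
        _ = _ := by
            rw [Real.exp_nat_mul, Real.exp_log (by positivity),
              ENNReal.ofReal_pow (p := 2 * c ^ 3) (by positivity) n, mul_comm 2,
              ENNReal.ofReal_mul (p := c ^ 3) (by positivity), ENNReal.ofReal_ofNat]
    have h2 := mul_meas_ge_le_lintegral (μ := μ)
      (f := fun x => ENNReal.ofReal (Real.exp (t * G x))) (by fun_prop)
      (ENNReal.ofReal (Real.exp (t * (n * δ))))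
    have h3 : bad ⊆ {x | ENNReal.ofReal (Real.exp (t * (n * δ))) ≤
        ENNReal.ofReal (Real.exp (t * G x))} := fun x hx =>
      ENNReal.ofReal_le_ofReal (Real.exp_le_exp.2 (mul_le_mul_of_nonneg_left hx ht0))
    have h4 : ENNReal.ofReal (Real.exp (t * (n * δ)) * μ.real bad) ≤
        ENNReal.ofReal (Real.exp (n * Real.log (2 * c ^ 3))) := by
      rw [ENNReal.ofReal_mul (Real.exp_pos _).le, ofReal_measureReal]
      exact ((mul_le_mul_right (measure_mono h3) _).trans h2).trans h1
    rw [ENNReal.ofReal_le_ofReal_iff (Real.exp_pos _).le] at h4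
    have h5 : t * (n * δ) = n * (2 * C + 1) + n * Real.log (2 * c ^ 3) := by
      rw [ht]; field_simp
    rw [h5, Real.exp_add, mul_right_comm] at h4
    calc μ.real bad = Real.exp (-(n * (2 * C + 1))) * Real.exp (-(n * Real.log (2 * c ^ 3))) *
          (Real.exp (n * (2 * C + 1)) * μ.real bad * Real.exp (n * Real.log (2 * c ^ 3))) := by
          rw [Real.exp_neg, Real.exp_neg]; field_simp
      _ ≤ Real.exp (-(n * (2 * C + 1))) * Real.exp (-(n * Real.log (2 * c ^ 3))) *
          Real.exp (n * Real.log (2 * c ^ 3)) := by gcongr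
      _ = _ := by rw [mul_assoc, ← Real.exp_add, neg_add_cancel, Real.exp_zero, mul_one]
  set E : ℝ := n * ε + 2 * C * k with hE
  set R : ℝ := ∫ x, Real.exp (loSum ψ n (wd A n x)) ∂μ with hR
  have hSm := measurable_birkhoff (measurable_shift (A := A)) hψ.measurable n
  have hSi := integrable_exp_of_abs_le (μ := μ) hSm (birkhoff_abs_le hC n)
  have hsi := integrable_exp_of_abs_le (μ := μ) (measurable_loSum ψ n) (abs_loSum_le hC n)
  have hR0 : 0 < R := integral_exp_pos hsi
  have hZ0 := integral_exp_pos hSi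
  have hpt : ∀ x, Real.exp (birkhoff (shift A) ψ n x) ≤
      bad.indicator (fun _ => Real.exp (n * C)) x +
        Real.exp E * Real.exp (loSum ψ n (wd A n x)) := by
    intro x
    by_cases hx : x ∈ bad
    · rw [indicator_of_mem hx]
      have := Real.exp_le_exp.2 (abs_le.1 (birkhoff_abs_le (T := shift A) hC n x)).2
      have : 0 < Real.exp E * Real.exp (loSum ψ n (wd A n x)) := by positivity
      linarith
    · rw [indicator_of_notMem hx, zero_add, ← Real.exp_add, Real.exp_le_exp]
      have h1 := birkhoff_sub_loSum_le hC (half_pos hε) hk n x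
      have h2 : G x ≤ n * δ := (not_le.1 hx).le
      have h3 : 2 * C * G x ≤ n * (ε / 2) := by
        calc 2 * C * G x ≤ (2 * C + 1) * (n * δ) := by
              have : 0 ≤ G x := Finset.sum_nonneg fun m _ => defect_nonneg F k _
              nlinarith
          _ = n * (ε / 2) := by rw [hδ]; field_simp
      linarith
  have hint := integral_mono hSi
    (((integrable_const _).indicator hbadm).add (hsi.const_mul (Real.exp E))) hpt
  rw [integral_add' ((integrable_const _).indicator hbadm) (hsi.const_mul _),
    integral_indicator_const _ hbadm, integral_const_mul, smul_eq_mul] at hint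
  have hlow : Real.exp (-(n * C)) ≤ ∫ x, Real.exp (birkhoff (shift A) ψ n x) ∂μ :=
    (Real.le_log_iff_exp_le hZ0).1 (abs_le.1 (abs_logZ_le (μ := μ) hψ.measurable hC n)).1
  have hbad2 : μ.real bad * Real.exp (n * C) ≤
      (∫ x, Real.exp (birkhoff (shift A) ψ n x) ∂μ) / 2 := by
    calc _ ≤ Real.exp (-(n * (2 * C + 1))) * Real.exp (n * C) := by gcongr
      _ = Real.exp (-(n * C)) / Real.exp n := by
          rw [← Real.exp_add, ← Real.exp_sub]; congr 1; ring
      _ ≤ _ := by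
          gcongr
          linarith [Real.add_one_le_exp (n : ℝ)]
  have hfinal : ∫ x, Real.exp (birkhoff (shift A) ψ n x) ∂μ ≤ R * Real.exp E * 2 := by
    linarith
  have := Real.log_le_log hZ0 hfinal
  rw [Real.log_mul (by positivity) (by norm_num), Real.log_mul hR0.ne' (Real.exp_ne_zero _),
    Real.log_exp] at this
  unfold logZ
  linarith

end ExponentialTightness

/-! ### Averaged measures -/

section Average

variable {X : Type*} {T : X → X}

lemma mul_birkhoff_le {F : X → ℝ} {C : ℝ} (hC : ∀ x, |F x| ≤ C) (k n : ℕ) (x : X) :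
    k * birkhoff T F n x ≤
      ∑ i ∈ Finset.range n, birkhoff T F k (T^[i] x) + k * (k * (2 * C)) := by
  have e : ∑ i ∈ Finset.range n, birkhoff T F k (T^[i] x) =
      ∑ j ∈ Finset.range k, birkhoff T F n (T^[j] x) := by
    unfold birkhoff
    rw [Finset.sum_comm]
    refine Finset.sum_congr rfl fun j _ => Finset.sum_congr rfl fun i _ => ?_
    rw [← Function.iterate_add_apply, ← Function.iterate_add_apply, add_comm]
  rw [e]
  have hC0 : 0 ≤ C := (abs_nonneg _).trans (hC x)
  have h : ∀ j ∈ Finset.range k, birkhoff T F n x - k * (2 * C) ≤ birkhoff T F n (T^[j] x) := by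
    intro j hj
    have h1 := birkhoff_add (T := T) (f := F) j n x
    have h2 := birkhoff_add (T := T) (f := F) n j x
    rw [add_comm] at h2
    have h3 := (abs_le.1 (birkhoff_abs_le (T := T) hC j x)).2
    have h4 := (abs_le.1 (birkhoff_abs_le (T := T) hC j (T^[n] x))).1
    have h5 : (j : ℝ) * C ≤ k * C := by
      gcongr
      exact (Finset.mem_range.1 hj).le
    linarith
  have := Finset.sum_le_sum h
  simp only [Finset.sum_const, Finset.card_range, nsmul_eq_mul] at this
  linarith

variable [MeasurableSpace X] {μ : Measure X} [IsProbabilityMeasure μ]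

/-- The average of the first `n` images of a measure. -/
noncomputable def avg (T : X → X) (μ : Measure X) (n : ℕ) : Measure X :=
  (n : ℝ≥0∞)⁻¹ • ∑ i ∈ Finset.range n, μ.map T^[i]

lemma isProbabilityMeasure_avg (hT : Measurable T) {n : ℕ} (hn : 1 ≤ n) :
    IsProbabilityMeasure (avg T μ n) := by
  refine ⟨?_⟩
  have h (i : ℕ) : (μ.map T^[i]) univ = 1 := by
    rw [Measure.map_apply (hT.iterate i) MeasurableSet.univ, preimage_univ, measure_univ]
  simp only [avg, Measure.smul_apply, Measure.finsetSum_apply, h, Finset.sum_const,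
    Finset.card_range, nsmul_eq_mul, mul_one, smul_eq_mul]
  exact ENNReal.inv_mul_cancel (by positivity) (ENNReal.natCast_ne_top n)

lemma integral_avg (hT : Measurable T) {g : X → ℝ} (hg : Measurable g) {C : ℝ}
    (hC : ∀ x, |g x| ≤ C) (n : ℕ) :
    ∫ x, g x ∂(avg T μ n) = (n : ℝ)⁻¹ * ∑ i ∈ Finset.range n, ∫ x, g (T^[i] x) ∂μ := by
  have hp (i : ℕ) : IsProbabilityMeasure (μ.map T^[i]) :=
    Measure.isProbabilityMeasure_map (hT.iterate i).aemeasurable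
  rw [avg, integral_smul_measure, integral_finsetSum_measure fun i _ => integrable_of_abs_le hg hC]
  simp only [ENNReal.toReal_inv, ENNReal.toReal_natCast, smul_eq_mul]
  congr 1
  exact Finset.sum_congr rfl fun i _ =>
    integral_map (hT.iterate i).aemeasurable hg.aestronglyMeasurable

lemma sum_partitionEntropy_le_avg {α : Type*} (hT : Measurable T) {g : X → α} (hg : MeasFibers g)
    {n : ℕ} (hn : 1 ≤ n) :
    ∑ i ∈ Finset.range n, partitionEntropy μ (fun x => g (T^[i] x)) ≤
      n * partitionEntropy (avg T μ n) g := by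
  have hp (i : ℕ) : IsProbabilityMeasure (μ.map T^[i]) :=
    Measure.isProbabilityMeasure_map (hT.iterate i).aemeasurable
  have hn0 : (0 : ℝ) < n := by exact_mod_cast hn
  have := le_partitionEntropy_of_average (Finset.range n) (fun _ => (n : ℝ)⁻¹)
    (fun _ => by positivity) (by simp [hn0.ne']) g (fun i => μ.map T^[i]) (avg T μ n)
    (fun a => by
      rw [← Finset.mul_sum]
      simp only [avg, Measure.real, Measure.smul_apply, Measure.finsetSum_apply, smul_eq_mul,
        ENNReal.toReal_mul, ENNReal.toReal_inv, ENNReal.toReal_natCast]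
      rw [ENNReal.toReal_sum fun i _ => measure_ne_top _ _])
  simp_rw [partitionEntropy_map (hT.iterate _) μ hg, ← Finset.mul_sum] at this
  rw [ENNReal.ofReal_inv_of_pos hn0, ENNReal.ofReal_natCast] at this
  calc _ = (n : ℝ≥0∞) * ((n : ℝ≥0∞)⁻¹ *
        ∑ i ∈ Finset.range n, partitionEntropy μ (fun x => g (T^[i] x))) := by
        rw [← mul_assoc, ENNReal.mul_inv_cancel (by positivity) (ENNReal.natCast_ne_top n), one_mul]
    _ ≤ _ := by gcongr

end Average

/-! ### Limits of averaged measures over a finite alphabet -/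

section FiniteAlphabet

variable {V : Type*} [Fintype V] [TopologicalSpace V] [DiscreteTopology V] {B : V → V → Prop}

instance : CompactSpace (Space B) := by
  refine isCompact_iff_compactSpace.1 (IsClosed.isCompact
    (s := {x : ℕ → V | ∀ i, B (x i) (x (i + 1))}) ?_)
  simp only [ofPred_forall]
  refine isClosed_iInter fun i => ?_
  have : Continuous fun x : ℕ → V => (x i, x (i + 1)) := by fun_prop
  exact (isClosed_discrete {p : V × V | B p.1 p.2}).preimage this

lemma mul_partitionEntropy_wd_le (μ : Measure (Space B)) [IsProbabilityMeasure μ] (k : ℕ) {n : ℕ}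
    (hn : 1 ≤ n) :
    k * partitionEntropy μ (wd B n) ≤
      n * partitionEntropy (avg (shift B) μ n) (wd B k) + k * Fintype.card (Fin k → V) := by
  classical
  have hm : ∀ m s, MeasFibers fun y : Space B => wd B m ((shift B)^[s] y) := fun m s =>
    (measFibers_wd m).comp_measurable (measurable_shift.iterate s)
  set u : ℕ → ℝ≥0∞ := fun s => partitionEntropy μ fun y => wd B (n - s) ((shift B)^[s] y) with hu
  set h : ℕ → ℝ≥0∞ := fun s => partitionEntropy μ fun y => wd B k ((shift B)^[s] y) with hh
  have hufin : ∀ s, u s ≠ ⊤ := fun s =>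
    ((partitionEntropy_le_card μ _).trans_lt (ENNReal.natCast_lt_top _)).ne
  have h1 : ∀ s, u s ≤ h s + u (s + k) := fun s => by
    refine (partitionEntropy_mono (hm _ _) ((hm k s).prodMk (hm (n - (s + k)) (s + k))) μ
      fun x y hxy => ?_).trans (partitionEntropy_prod_le (hm _ _) (hm _ _) μ)
    simp only [Prod.mk.injEq] at hxy
    rw [add_comm s k, Function.iterate_add_apply, Function.iterate_add_apply] at hxy
    exact wd_eq_of_le (by omega) (wd_add_eq_iff.2 hxy)
  have h2 : ∀ s < k, u 0 ≤ Fintype.card (Fin k → V) + u s := fun s hs => by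
    calc u 0 ≤ partitionEntropy μ (wd B k) + u s := by
          refine (partitionEntropy_mono (hm _ 0) ((measFibers_wd k).prodMk (hm (n - s) s)) μ
            fun x y hxy => ?_).trans (partitionEntropy_prod_le (measFibers_wd k) (hm _ _) μ)
          simp only [Prod.mk.injEq] at hxy
          exact wd_eq_of_le (by omega) (wd_add_eq_iff.2 ⟨wd_eq_of_le hs.le hxy.1, hxy.2⟩)
      _ ≤ _ := by
          gcongr
          exact partitionEntropy_le_card μ _
  have h3 : ∀ s, u (n + s) = 0 := fun s => by
    have hns : n - (n + s) = 0 := by omega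
    simp only [hu]
    rw [hns]
    unfold partitionEntropy
    refine ENNReal.tsum_eq_zero.2 fun a => ?_
    have : (fun y : Space B => wd B 0 ((shift B)^[n + s] y)) ⁻¹' {a} = univ := by
      ext y; simp [Subsingleton.elim _ a]
    simp [this]
  have h4 : ∑ s ∈ Finset.range k, u s ≤ ∑ s ∈ Finset.range n, h s := by
    have a1 : ∑ s ∈ Finset.range n, u s ≤
        ∑ s ∈ Finset.range n, h s + ∑ s ∈ Finset.range n, u (s + k) := by
      rw [← Finset.sum_add_distrib]
      exact Finset.sum_le_sum fun s _ => h1 s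
    have a2 : ∑ s ∈ Finset.range n, u s = ∑ s ∈ Finset.range k, u s +
        ∑ s ∈ Finset.range n, u (s + k) := by
      have b1 := Finset.sum_range_add u n k
      have b2 := Finset.sum_range_add u k n
      rw [add_comm k n, b1] at b2
      simp_rw [h3, Finset.sum_const_zero, add_zero] at b2
      simp_rw [b2, add_comm k]
    rw [a2] at a1
    exact (ENNReal.add_le_add_iff_right (ENNReal.sum_ne_top.2 fun s _ => hufin _)).1 a1
  calc (k : ℝ≥0∞) * partitionEntropy μ (wd B n) = ∑ _s ∈ Finset.range k, u 0 := by
        simp [hu]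
    _ ≤ ∑ s ∈ Finset.range k, (Fintype.card (Fin k → V) + u s) :=
        Finset.sum_le_sum fun s hs => h2 s (Finset.mem_range.1 hs)
    _ = ∑ s ∈ Finset.range k, u s + k * Fintype.card (Fin k → V) := by
        rw [Finset.sum_add_distrib, add_comm]
        simp
    _ ≤ _ := by
        gcongr
        exact h4.trans (sum_partitionEntropy_le_avg measurable_shift (measFibers_wd k) hn)

end FiniteAlphabet

section Limits

variable {V : Type*} [Fintype V] [TopologicalSpace V] [DiscreteTopology V] {B : V → V → Prop}

lemma exists_bound_of_continuous {g : Space B → ℝ} (hg : Continuous g) : ∃ C, ∀ y, |g y| ≤ C := by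
  obtain ⟨C, hC⟩ := isCompact_univ.exists_bound_of_continuousOn hg.continuousOn
  exact ⟨C, fun y => hC y (mem_univ y)⟩

lemma tendsto_integral_of_tendsto {ι : Type*} {l : Filter ι} {ρ : ι → ProbabilityMeasure (Space B)}
    {ν : ProbabilityMeasure (Space B)} (h : Tendsto ρ l (𝓝 ν)) {g : Space B → ℝ}
    (hg : Continuous g) : Tendsto (fun i => ∫ y, g y ∂(ρ i : Measure (Space B))) l
      (𝓝 (∫ y, g y ∂(ν : Measure (Space B)))) :=
  (ProbabilityMeasure.tendsto_iff_forall_integral_tendsto.1 h)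
    (BoundedContinuousFunction.mkOfCompact ⟨g, hg⟩)

lemma tendsto_partitionEntropy_wd {ι : Type*} {l : Filter ι}
    {ρ : ι → ProbabilityMeasure (Space B)} {ν : ProbabilityMeasure (Space B)}
    (h : Tendsto ρ l (𝓝 ν)) (k : ℕ) :
    Tendsto (fun i => (partitionEntropy (ρ i : Measure (Space B)) (wd B k)).toReal) l
      (𝓝 (partitionEntropy (ν : Measure (Space B)) (wd B k)).toReal) := by
  classical
  have e : ∀ θ : ProbabilityMeasure (Space B), partitionEntropy (θ : Measure (Space B)) (wd B k) =
      ENNReal.ofReal (∑ w, Real.negMulLog ((θ : Measure (Space B)).real (wd B k ⁻¹' {w}))) := by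
    intro θ
    unfold partitionEntropy
    rw [tsum_fintype, ENNReal.ofReal_sum_of_nonneg fun w _ =>
      Real.negMulLog_nonneg measureReal_nonneg measureReal_le_one]
    simp only [Real.negMulLog, neg_mul]
    rfl
  simp_rw [e]
  refine (ENNReal.tendsto_toReal ENNReal.ofReal_ne_top).comp
    (ENNReal.tendsto_ofReal (tendsto_finsetSum _ fun w _ =>
      (Real.continuous_negMulLog.tendsto _).comp ?_))
  have := tendsto_integral_of_tendsto h (g := (wd B k ⁻¹' {w}).indicator 1)
    (((isClopen_discrete {w}).preimage
      (continuous_pi fun i => continuous_coord i)).continuous_indicator continuous_one)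
  simpa [integral_indicator_one (measFibers_wd k w)] using this

lemma invariant_of_tendsto_avg {ι : Type*} {l : Filter ι} [l.NeBot] {N : ι → ℕ}
    (hN : Tendsto N l atTop) {ρ : ι → Measure (Space B)} [∀ i, IsProbabilityMeasure (ρ i)]
    {ρ' : ι → ProbabilityMeasure (Space B)}
    (hρ' : ∀ᶠ i in l, (ρ' i : Measure _) = avg (shift B) (ρ i) (N i))
    {ν : ProbabilityMeasure (Space B)} (h : Tendsto ρ' l (𝓝 ν)) :
    Invariant (shift B) (ν : Measure (Space B)) := by
  have hp : IsProbabilityMeasure ((ν : Measure (Space B)).map (shift B)) :=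
    Measure.isProbabilityMeasure_map measurable_shift.aemeasurable
  refine ext_of_forall_integral_eq_of_IsFiniteMeasure fun g => ?_
  rw [integral_map measurable_shift.aemeasurable g.continuous.measurable.aestronglyMeasurable]
  have hlim := (tendsto_integral_of_tendsto h (g.continuous.comp continuous_shift)).sub
    (tendsto_integral_of_tendsto h g.continuous)
  refine sub_eq_zero.1 (tendsto_nhds_unique hlim ?_)
  have hinv : Tendsto (fun i => (N i : ℝ)⁻¹ * (2 * ‖g‖)) l (𝓝 0) := by
    simpa using (tendsto_inv_atTop_zero.comp (tendsto_natCast_atTop_atTop.comp hN)).mul_const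
      (2 * ‖g‖)
  refine squeeze_zero_norm' ?_ hinv
  filter_upwards [hρ'] with i hi
  have hgC : ∀ y, |g y| ≤ ‖g‖ := fun y => g.norm_coe_le_norm y
  rw [hi, integral_avg measurable_shift (g := ⇑g ∘ shift B)
    (g.continuous.comp continuous_shift).measurable (fun y => hgC _),
    integral_avg measurable_shift g.continuous.measurable hgC, ← mul_sub,
    ← Finset.sum_sub_distrib, Real.norm_eq_abs, abs_mul, abs_of_nonneg (by positivity)]
  gcongr
  simp only [Function.comp_apply, ← Function.iterate_succ_apply']
  rw [Finset.sum_range_sub (fun j => ∫ y, g ((shift B)^[j] y) ∂(ρ i))]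
  have hb : ∀ j, |∫ y, g ((shift B)^[j] y) ∂(ρ i)| ≤ ‖g‖ := fun j => by
    simpa using norm_integral_le_of_norm_le_const (μ := ρ i)
      (ae_of_all _ fun y => g.norm_coe_le_norm ((shift B)^[j] y))
  have h1 := abs_le.1 (hb (N i))
  have h0 := abs_le.1 (hb 0)
  exact abs_le.2 ⟨by linarith, by linarith⟩

/-- The Misiurewicz construction of invariant measures with large free energy. -/
lemma exists_invariant_of_averages {F : Space B → ℝ} {G : ℕ → Space B → ℝ} {C q D : ℝ}
    (hF : Measurable F) (hC : ∀ y, |F y| ≤ C) (hG : ∀ k, Continuous (G k))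
    (hFG : ∀ k y, birkhoff (shift B) F k y ≤ G k y) {N : ℕ → ℕ} (hN : Tendsto N atTop atTop)
    (ρ : ℕ → Measure (Space B)) [∀ r, IsProbabilityMeasure (ρ r)]
    (h : ∀ r, N r * q ≤ ∫ y, birkhoff (shift B) F (N r) y ∂(ρ r) +
      (partitionEntropy (ρ r) (wd B (N r))).toReal + D) :
    ∃ ν : Measure (Space B), IsProbabilityMeasure ν ∧ Invariant (shift B) ν ∧
      ∀ k : ℕ, k * q ≤ (partitionEntropy ν (wd B k)).toReal + ∫ y, G k y ∂ν := by
  classical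
  have hav : ∀ r, IsProbabilityMeasure (avg (shift B) (ρ r) (max (N r) 1)) := fun r =>
    isProbabilityMeasure_avg measurable_shift (le_max_right _ _)
  set ρ' : ℕ → ProbabilityMeasure (Space B) :=
    fun r => ⟨avg (shift B) (ρ r) (max (N r) 1), hav r⟩ with hρ'
  set U : Ultrafilter ℕ := hyperfilter ℕ with hUdef
  have hU : (U : Filter ℕ) ≤ atTop := Nat.hyperfilter_le_atTop
  obtain ⟨ν, -, hν⟩ := isCompact_univ.ultrafilter_le_nhds (U.map ρ') (by simp)
  have hν' : Tendsto ρ' U (𝓝 ν) := hν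
  have hNU : Tendsto N U atTop := hN.mono_left hU
  have hev : ∀ᶠ r in (U : Filter ℕ), (ρ' r : Measure (Space B)) = avg (shift B) (ρ r) (N r) := by
    filter_upwards [hNU.eventually_ge_atTop 1] with r hr
    simp only [hρ', ProbabilityMeasure.coe_mk]
    rw [max_eq_left hr]
  refine ⟨ν, inferInstance, invariant_of_tendsto_avg hNU hev hν', fun k => ?_⟩
  set E : ℝ := k * Fintype.card (Fin k → V) + k * (k * (2 * C)) + k * D with hE
  have hinv : Tendsto (fun r => (N r : ℝ)⁻¹ * E) U (𝓝 0) := by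
    simpa using (tendsto_inv_atTop_zero.comp (tendsto_natCast_atTop_atTop.comp hNU)).mul_const E
  have hlim := ((tendsto_partitionEntropy_wd hν' k).add
    (tendsto_integral_of_tendsto hν' (hG k))).add hinv
  rw [add_zero] at hlim
  refine ge_of_tendsto hlim ?_
  filter_upwards [hNU.eventually_ge_atTop 1, hev] with r hr hr'
  have hn0 : (0 : ℝ) < N r := by exact_mod_cast hr
  have hmS := fun n => measurable_birkhoff (measurable_shift (A := B)) hF n
  obtain ⟨CG, hCG⟩ := exists_bound_of_continuous (hG k)
  have h1 := ENNReal.toReal_mono (ENNReal.add_ne_top.2 ⟨ENNReal.mul_ne_top (by simp)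
    ((partitionEntropy_le_card _ _).trans_lt (ENNReal.natCast_lt_top _)).ne,
    ENNReal.mul_ne_top (by simp) (by simp)⟩) (mul_partitionEntropy_wd_le (ρ r) k hr)
  rw [ENNReal.toReal_add (ENNReal.mul_ne_top (by simp)
    ((partitionEntropy_le_card _ _).trans_lt (ENNReal.natCast_lt_top _)).ne)
    (ENNReal.mul_ne_top (by simp) (by simp))] at h1
  simp only [ENNReal.toReal_mul, ENNReal.toReal_natCast] at h1
  have h2 : k * ∫ y, birkhoff (shift B) F (N r) y ∂(ρ r) ≤
      N r * ∫ y, G k y ∂(avg (shift B) (ρ r) (N r)) + k * (k * (2 * C)) := by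
    have hint1 : ∀ i ∈ Finset.range (N r), Integrable (fun y => G k ((shift B)^[i] y)) (ρ r) :=
      fun i _ => integrable_of_abs_le ((hG k).measurable.comp (measurable_shift.iterate i))
        fun y => hCG _
    have hint := integrable_finsetSum _ hint1
    rw [integral_avg measurable_shift (hG k).measurable hCG, mul_inv_cancel_left₀ hn0.ne',
      ← integral_const_mul, ← integral_finsetSum _ hint1]
    have := integral_mono ((integrable_of_abs_le (μ := ρ r) (hmS (N r))
      (birkhoff_abs_le hC _)).const_mul (k : ℝ))
      (hint.add (integrable_const (k * (k * (2 * C))))) fun y =>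
      (mul_birkhoff_le hC k (N r) y).trans (add_le_add_left
        (Finset.sum_le_sum fun i _ => hFG k _) _)
    rw [integral_add' hint (integrable_const _)] at this
    simpa using this
  rw [hr']
  have h3 := mul_le_mul_of_nonneg_left (h r) (Nat.cast_nonneg (α := ℝ) k)
  refine le_of_mul_le_mul_left ?_ hn0
  rw [mul_add, mul_inv_cancel_left₀ hn0.ne']
  linarith

end Limits

/-! ### Concatenation of words -/

section Concatenation

variable {S : Type*} {A : S → S → Prop}

lemma admissible_word (x : Space A) {n : ℕ} (hn : n ≠ 0) : Admissible A (word x n) := by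
  refine ⟨fun h => hn (by simpa [word] using congrArg List.length h), ?_⟩
  refine List.isChain_iff_getElem.2 fun i hi => ?_
  simp only [word, List.getElem_ofFn]
  exact x.2 i

lemma exists_connecting {Λ : Finset (List S)} (hΛ : ∀ v w : List S, Admissible A v →
    Admissible A w → ∃ l ∈ Λ, Admissible A (v ++ l ++ w)) {n m : ℕ} (hn : n ≠ 0) (hm : m ≠ 0)
    (x y : Space A) : ∃ l ∈ Λ, ∃ z : Space A, wd A n z = wd A n x ∧
      word ((shift A)^[n] z) l.length = l ∧
      wd A m ((shift A)^[n + l.length] z) = wd A m y := by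
  obtain ⟨l, hl, -, hadm⟩ := hΛ _ _ (admissible_word x hn) (admissible_word y hm)
  set v : List S := word x n ++ l ++ word y m with hv
  have hlen : v.length = n + l.length + m := by simp [hv, word, add_assoc]
  set z : ℕ → S := fun i => if h : i < v.length then v[i] else y.1 (i - (n + l.length)) with hz
  have z3 : ∀ i, z (n + l.length + i) = y.1 i := fun i => by
    simp only [hz]
    split_ifs with h
    · simp [-List.append_assoc, hv, word]
    · simp
  have z1 : ∀ i < n, z i = x.1 i := fun i hi => by
    have h : i < n + l.length + m := by omega
    simp only [hz, hv, h, List.getElem_append, word, List.length_append, List.length_ofFn, hi,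
      dite_true,
      show i < n + l.length by omega, List.getElem_ofFn]
  have z2 : ∀ i (hi : i < l.length), z (n + i) = l[i] := fun i hi => by
    have h : n + i < n + l.length + m := by omega
    simp only [hz, hv, h, List.getElem_append, word, List.length_append, List.length_ofFn, hi,
      dite_true,
      Nat.add_lt_add_left, show ¬ n + i < n by omega, dite_false, Nat.add_sub_cancel_left]
  have hzA : ∀ i, A (z i) (z (i + 1)) := fun i => by
    rcases lt_or_ge (i + 1) v.length with h | h
    · have := List.isChain_iff_getElem.1 hadm i h
      simpa [hz, h, show i < v.length by omega] using this
    · obtain ⟨j, rfl⟩ := Nat.exists_eq_add_of_le (show n + l.length ≤ i by omega)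
      rw [add_assoc _ j, z3, z3]
      exact y.2 j
  obtain ⟨z', hz'⟩ : ∃ z' : Space A, ∀ i, z'.1 i = z i := ⟨⟨z, hzA⟩, fun _ => rfl⟩
  refine ⟨l, hl, z', wd_eq_iff.2 fun i hi => (hz' i).trans (z1 i hi), ?_, wd_eq_iff.2 fun i _ => ?_⟩
  · refine List.ext_getElem (by simp [word]) fun i h1 h2 => ?_
    simp only [word, List.getElem_ofFn, shift_iterate_val, hz']
    exact z2 i h2
  · rw [shift_iterate_val, hz']
    exact z3 i

lemma exists_extension (hs : ∀ a : S, ∃ b, A a b) (n : ℕ) (x : ℕ → S)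
    (hx : ∀ i, i + 1 < n → A (x i) (x (i + 1))) : ∃ y : Space A, ∀ i < n, y.1 i = x i := by
  choose s hs using hs
  refine ⟨⟨fun i => if i < n then x i else s^[i - (n - 1)] (x (n - 1)), fun i => ?_⟩,
    fun i hi => if_pos hi⟩
  beta_reduce
  rcases lt_trichotomy (i + 1) n with h | h | h
  · rw [if_pos (by omega), if_pos h]
    exact hx i h
  · rw [if_pos (by omega), if_neg (by omega), ← h]
    simpa using hs _
  · rw [if_neg (by omega), if_neg (by omega), show i + 1 - (n - 1) = i - (n - 1) + 1 by omega,
      Function.iterate_succ_apply']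
    exact hs _

variable [TopologicalSpace S]

/-- Weight of a word in the partition sums. -/
noncomputable def weight (μ : Measure (Space A)) (ψ : Space A → ℝ) (n : ℕ) (w : Fin n → S) : ℝ :=
  μ.real (wd A n ⁻¹' {w}) * Real.exp (loSum ψ n w)

variable {μ : Measure (Space A)} {f ψ : Space A → ℝ} {c C : ℝ}

lemma weight_nonneg {n : ℕ} (w : Fin n → S) : 0 ≤ weight μ ψ n w :=
  mul_nonneg measureReal_nonneg (Real.exp_pos _).le

lemma exists_wd_of_weight_ne_zero {n : ℕ} {w : Fin n → S} (hw : weight μ ψ n w ≠ 0) :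
    ∃ x, wd A n x = w := by
  by_contra! h
  refine hw ?_
  have : wd A n ⁻¹' {w} = ∅ := by
    ext x; simp [h x]
  simp [weight, this]

lemma GibbsBound.weight_mul_le (h : GibbsBound f μ c) (hc : 1 ≤ c) (hC : ∀ x, |ψ x| ≤ C)
    {δ : ℝ} (hδ : 0 < δ) (n L m : ℕ) {z : Space A}
    (hzδ : δ ≤ μ.real (wd A L ⁻¹' {wd A L ((shift A)^[n] z)})) :
    weight μ ψ n (wd A n z) * weight μ ψ m (wd A m ((shift A)^[n + L] z)) ≤
      c ^ 3 * c ^ 3 * δ⁻¹ * Real.exp (L * C) * weight μ ψ (n + L + m) (wd A (n + L + m) z) := by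
  have hc0 : 0 < c := by linarith
  have h1 := h.le_measure_add hc n L z
  have h2 := h.le_measure_add hc (n + L) m z
  have h3 : loSum ψ n (wd A n z) + loSum ψ m (wd A m ((shift A)^[n + L] z)) ≤
      L * C + loSum ψ (n + L + m) (wd A (n + L + m) z) := by
    rw [← sub_le_iff_le_add']
    refine le_lo fun y hy => ?_
    rw [wd_add_eq_iff, wd_add_eq_iff] at hy
    have a1 := loSum_le hC hy.1.1
    have a2 := loSum_le hC hy.2
    have a3 := (abs_le.1 (birkhoff_abs_le (T := shift A) hC L ((shift A)^[n] y))).1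
    rw [birkhoff_add, birkhoff_add]
    linarith
  have h4 := Real.exp_le_exp.2 h3
  rw [Real.exp_add, Real.exp_add] at h4
  unfold weight
  generalize μ.real (wd A L ⁻¹' {wd A L ((shift A)^[n] z)}) = b at *
  generalize loSum ψ n (wd A n z) = s1 at *
  generalize loSum ψ m _ = s2 at *
  generalize loSum ψ (n + L + m) _ = s3 at *
  generalize hp1 : μ.real (wd A n ⁻¹' {wd A n z}) = p1 at *
  generalize hp2 : μ.real (wd A m ⁻¹' {_}) = p2 at *
  generalize μ.real (wd A (n + L + m) ⁻¹' {_}) = p3 at *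
  generalize μ.real (wd A (n + L) ⁻¹' {_}) = p4 at *
  have hp10 : 0 ≤ p1 := hp1 ▸ measureReal_nonneg
  have hp20 : 0 ≤ p2 := hp2 ▸ measureReal_nonneg
  have h5 : p1 * p2 ≤ c ^ 3 * c ^ 3 * δ⁻¹ * p3 := by
    have b1 : p1 * δ ≤ c ^ 3 * p4 := (mul_le_mul_of_nonneg_left hzδ hp10).trans h1
    have b2 : p1 * δ * p2 ≤ c ^ 3 * (c ^ 3 * p3) :=
      (mul_le_mul_of_nonneg_right b1 hp20).trans
        (by rw [mul_assoc]; exact mul_le_mul_of_nonneg_left h2 (by positivity))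
    calc p1 * p2 = δ⁻¹ * (p1 * δ * p2) := by field_simp
      _ ≤ δ⁻¹ * (c ^ 3 * (c ^ 3 * p3)) := by gcongr
      _ = _ := by ring
  calc p1 * Real.exp s1 * (p2 * Real.exp s2) = (p1 * p2) * (Real.exp s1 * Real.exp s2) := by ring
    _ ≤ (c ^ 3 * c ^ 3 * δ⁻¹ * p3) * (Real.exp (L * C) * Real.exp s3) :=
        mul_le_mul h5 h4 (by positivity) ((mul_nonneg hp10 hp20).trans h5)
    _ = _ := by ring

/-- Partition sum over the words with letters in a finite set. -/
noncomputable def partSum (μ : Measure (Space A)) (ψ : Space A → ℝ) (E : Finset S) (n : ℕ) : ℝ :=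
  ∑ w : Fin n → E, weight μ ψ n fun i => w i

lemma partSum_nonneg (E : Finset S) (n : ℕ) : 0 ≤ partSum μ ψ E n :=
  Finset.sum_nonneg fun _ _ => weight_nonneg _

lemma GibbsBound.exists_partSum_mul_le [IsProbabilityMeasure μ] (h : GibbsBound f μ c)
    (hc : 1 ≤ c) (hC : ∀ x, |ψ x| ≤ C) {Λ : Finset (List S)} (hΛ : ∀ v w : List S,
    Admissible A v → Admissible A w → ∃ l ∈ Λ, Admissible A (v ++ l ++ w)) :
    ∃ D : ℝ, 1 ≤ D ∧ ∀ E : Finset S, (∀ l ∈ Λ, ∀ a ∈ l, a ∈ E) → ∀ n m : ℕ, n ≠ 0 → m ≠ 0 →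
      ∃ l ∈ Λ, partSum μ ψ E n * partSum μ ψ E m ≤ D * partSum μ ψ E (n + l.length + m) := by
  classical
  have hne : Nonempty (Space A) := μ.nonempty_of_neZero
  have hC0 : 0 ≤ C := (abs_nonneg _).trans (hC hne.some)
  have hc0 : 0 < c := by linarith
  have hpos : ∀ z : Space A, ∀ n (l : List S), word ((shift A)^[n] z) l.length = l →
      wd A l.length ⁻¹' {wd A l.length ((shift A)^[n] z)} = cylinder A l := fun z n l hl => by
    rw [← cylinder_word, hl]
  obtain ⟨δ, hδ, hδ1, hδΛ⟩ : ∃ δ : ℝ, 0 < δ ∧ δ ≤ 1 ∧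
      ∀ l ∈ Λ, 0 < μ.real (cylinder A l) → δ ≤ μ.real (cylinder A l) := by
    clear hΛ
    induction Λ using Finset.induction_on with
    | empty => exact ⟨1, one_pos, le_rfl, by simp⟩
    | insert l Λ _ ih =>
      obtain ⟨δ, h1, h2, h3⟩ := ih
      by_cases hl : 0 < μ.real (cylinder A l)
      · refine ⟨min δ (μ.real (cylinder A l)), lt_min h1 hl, (min_le_left _ _).trans h2, ?_⟩
        rintro l' hl' h
        rcases Finset.mem_insert.1 hl' with rfl | hl'
        · exact min_le_right _ _
        · exact (min_le_left _ _).trans (h3 l' hl' h)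
      · refine ⟨δ, h1, h2, fun l' hl' h => ?_⟩
        rcases Finset.mem_insert.1 hl' with rfl | hl'
        · exact absurd h hl
        · exact h3 l' hl' h
  set K : ℕ := Λ.sup List.length with hK
  set D₀ : ℝ := c ^ 3 * c ^ 3 * δ⁻¹ * Real.exp (K * C) with hD₀
  have hD₀1 : 1 ≤ D₀ := by
    have a1 := one_le_pow₀ hc (n := 3)
    have a2 : 1 ≤ δ⁻¹ := (one_le_inv₀ hδ).2 hδ1
    have a3 : 1 ≤ Real.exp (K * C) := Real.one_le_exp (by positivity)
    exact one_le_mul_of_one_le_of_one_le (one_le_mul_of_one_le_of_one_le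
      (one_le_mul_of_one_le_of_one_le a1 a1) a2) a3
  have hΛne : Λ.Nonempty := by
    obtain ⟨l, hl, -⟩ := exists_connecting hΛ one_ne_zero one_ne_zero hne.some hne.some
    exact ⟨l, hl⟩
  have hΛ1 : (1 : ℝ) ≤ Λ.card := by exact_mod_cast hΛne.card_pos
  refine ⟨Λ.card * D₀, one_le_mul_of_one_le_of_one_le hΛ1 hD₀1, fun E hE n m hn hm => ?_⟩
  have key : partSum μ ψ E n * partSum μ ψ E m ≤
      ∑ l ∈ Λ, D₀ * partSum μ ψ E (n + l.length + m) := by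
    set r : ∀ L, (Fin (n + L + m) → E) → (Fin n → E) × (Fin m → E) := fun L u =>
      (fun i => u ⟨i, by omega⟩, fun i => u ⟨n + L + i, by omega⟩) with hr
    have hterm : ∀ p : (Fin n → E) × (Fin m → E),
        weight μ ψ n (fun i => p.1 i) * weight μ ψ m (fun i => p.2 i) ≤
          ∑ l ∈ Λ, ∑ u : Fin (n + l.length + m) → E,
            if r l.length u = p then D₀ * weight μ ψ (n + l.length + m) (fun i => u i) else 0 := by
      rintro ⟨w, w'⟩
      have hnn : ∀ l : List S, ∀ u : Fin (n + l.length + m) → E, 0 ≤ if r l.length u = (w, w') then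
          D₀ * weight μ ψ (n + l.length + m) (fun i => u i) else 0 := fun l u => by
        split_ifs
        · exact mul_nonneg (by linarith) (weight_nonneg _)
        · exact le_rfl
      rcases eq_or_ne (weight μ ψ n fun i => (w i : S)) 0 with h0 | h0
      · simp only [h0, zero_mul]
        exact Finset.sum_nonneg fun l _ => Finset.sum_nonneg fun u _ => hnn l u
      rcases eq_or_ne (weight μ ψ m fun i => (w' i : S)) 0 with h0' | h0'
      · simp only [h0', mul_zero]
        exact Finset.sum_nonneg fun l _ => Finset.sum_nonneg fun u _ => hnn l u
      obtain ⟨x, hx⟩ := exists_wd_of_weight_ne_zero h0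
      obtain ⟨y, hy⟩ := exists_wd_of_weight_ne_zero h0'
      obtain ⟨l, hl, z, hz1, hz2, hz3⟩ := exists_connecting hΛ hn hm x y
      have hzn : ∀ i (hi : i < n), z.1 i = w ⟨i, hi⟩ := fun i hi =>
        congrFun (hz1.trans hx) ⟨i, hi⟩
      have hzm : ∀ i (hi : i < m), z.1 (n + l.length + i) = w' ⟨i, hi⟩ := fun i hi => by
        have := congrFun (hz3.trans hy) ⟨i, hi⟩
        simpa [wd, shift_iterate_val] using this
      have hzl : ∀ i (hi : i < l.length), z.1 (n + i) = l[i] := fun i hi => by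
        have := (List.getElem_of_eq hz2.symm hi).symm
        simpa [word, shift_iterate_val] using this
      have hzE : ∀ i : Fin (n + l.length + m), z.1 i ∈ E := fun i => by
        rcases lt_or_ge i.1 n with h1 | h1
        · rw [hzn i h1]; exact (w _).2
        rcases lt_or_ge i.1 (n + l.length) with h2 | h2
        · have := hzl (i.1 - n) (by omega)
          rw [Nat.add_sub_cancel' h1] at this
          rw [this]
          exact hE l hl _ (List.getElem_mem _)
        · have := hzm (i.1 - (n + l.length)) (by omega)
          rw [Nat.add_sub_cancel' h2] at this
          rw [this]
          exact (w' _).2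
      set u : Fin (n + l.length + m) → E := fun i => ⟨z.1 i, hzE i⟩ with hu
      have hru : r l.length u = (w, w') := by
        refine Prod.ext (funext fun i => Subtype.ext (hzn i i.2))
          (funext fun i => Subtype.ext (hzm i i.2))
      have hδz : δ ≤ μ.real (wd A l.length ⁻¹' {wd A l.length ((shift A)^[n] z)}) := by
        have := h.pos hc l.length ((shift A)^[n] z)
        rw [hpos z n l hz2] at this ⊢
        exact hδΛ l hl this
      have hmain := h.weight_mul_le (ψ := ψ) hc hC hδ n l.length m hδz
      rw [hz1, hz3, hx, hy] at hmain
      have hLK : l.length ≤ K := Finset.le_sup (f := List.length) hl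
      calc _ ≤ _ := hmain
        _ ≤ D₀ * weight μ ψ (n + l.length + m) (fun i => u i) := by
            refine mul_le_mul_of_nonneg_right ?_ (weight_nonneg _)
            simp only [hD₀]
            gcongr
        _ ≤ ∑ u : Fin (n + l.length + m) → E, if r l.length u = (w, w') then
              D₀ * weight μ ψ (n + l.length + m) (fun i => u i) else 0 := by
            have := Finset.single_le_sum (fun u _ => hnn l u) (Finset.mem_univ u)
            rwa [if_pos hru] at this
        _ ≤ _ := Finset.single_le_sum
            (f := fun l : List S => ∑ u : Fin (n + l.length + m) → E, if r l.length u = (w, w') then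
              D₀ * weight μ ψ (n + l.length + m) (fun i => u i) else 0)
            (fun l _ => Finset.sum_nonneg fun u _ => hnn l u) hl
    unfold partSum
    rw [Finset.sum_mul_sum, ← Finset.sum_product']
    refine (Finset.sum_le_sum fun p _ => hterm p).trans (le_of_eq ?_)
    rw [Finset.sum_comm]
    refine Finset.sum_congr rfl fun l _ => ?_
    rw [Finset.sum_comm, Finset.mul_sum]
    refine Finset.sum_congr rfl fun u _ => ?_
    simp
  by_contra! hcon
  have := Finset.sum_lt_sum_of_nonempty hΛne fun l hl => hcon l hl
  simp only [Finset.sum_const, nsmul_eq_mul, mul_assoc, ← Finset.mul_sum] at this key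
  nlinarith

end Concatenation

/-! ### Subsystems over a finite set of letters -/

section Subsystem

variable {S : Type*} {A : S → S → Prop} {E : Finset S}

/-- Restriction of the transition relation to a finite set of letters. -/
def sub (A : S → S → Prop) (E : Finset S) : E → E → Prop := fun a b => A a b

/-- Inclusion of the subsystem. -/
def incl (A : S → S → Prop) (E : Finset S) (y : Space (sub A E)) : Space A :=
  ⟨fun i => y.1 i, fun i => y.2 i⟩

lemma incl_iterate (n : ℕ) (y : Space (sub A E)) :
    incl A E ((shift (sub A E))^[n] y) = (shift A)^[n] (incl A E y) :=
  (Function.Semiconj.iterate_right (f := incl A E) (fun _ => rfl) n) y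

lemma birkhoff_incl (g : Space A → ℝ) (n : ℕ) (y : Space (sub A E)) :
    birkhoff (shift (sub A E)) (fun y => g (incl A E y)) n y =
      birkhoff (shift A) g n (incl A E y) := by
  simp only [birkhoff, incl_iterate]

variable [TopologicalSpace S]

lemma continuous_incl : Continuous (incl A E) :=
  Continuous.subtype_mk (continuous_pi fun i =>
    continuous_subtype_val.comp (continuous_coord (A := sub A E) i)) _

lemma measurable_incl : Measurable (incl A E) := continuous_incl.measurable

lemma Invariant.map_incl {ν : Measure (Space (sub A E))} (hν : Invariant (shift (sub A E)) ν) :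
    Invariant (shift A) (ν.map (incl A E)) := by
  unfold Invariant at *
  rw [Measure.map_map measurable_shift measurable_incl]
  conv_rhs => rw [← hν, Measure.map_map measurable_incl measurable_shift]
  rfl

variable [DiscreteTopology S] {μ : Measure (Space A)}
  {f ψ : Space A → ℝ} {c C : ℝ}

lemma GibbsBound.exists_measure_log_partSum_le (h : GibbsBound f μ c) (hc : 1 ≤ c)
    (hC : ∀ x, |ψ x| ≤ C) (hE : ∀ a : E, ∃ b, sub A E a b) {n : ℕ} (hn : 0 < n)
    (hpos : 0 < partSum μ ψ E n) :
    ∃ ρ : Measure (Space (sub A E)), IsProbabilityMeasure ρ ∧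
      Real.log (partSum μ ψ E n) ≤
        ∫ y, birkhoff (shift (sub A E)) (fun y => f (incl A E y) + ψ (incl A E y)) n y ∂ρ +
          (partitionEntropy ρ (wd (sub A E) n)).toReal + Real.log c := by
  classical
  set Z := partSum μ ψ E n with hZ
  have hext : ∀ w : Fin n → E, weight μ ψ n (fun i => (w i : S)) ≠ 0 →
      ∃ y : Space (sub A E), wd (sub A E) n y = w := by
    intro w hw
    obtain ⟨x, hx⟩ := exists_wd_of_weight_ne_zero hw
    have hxw : ∀ i (hi : i < n), x.1 i = w ⟨i, hi⟩ := fun i hi => congrFun hx ⟨i, hi⟩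
    obtain ⟨y, hy⟩ := exists_extension hE n
      (fun i => if hi : i < n then w ⟨i, hi⟩ else w ⟨0, hn⟩) fun i hi => by
        simp only [hi, show i < n by omega, dite_true]
        have := x.2 i
        rw [hxw i (by omega), hxw (i + 1) hi] at this
        exact this
    refine ⟨y, funext fun i => ?_⟩
    have := hy i i.2
    simpa [wd] using this
  have hy0 : ∃ w : Fin n → E, weight μ ψ n (fun i => (w i : S)) ≠ 0 := by
    by_contra! hcon
    simp [hZ, partSum, hcon] at hpos
  obtain ⟨y0, -⟩ := hext _ hy0.choose_spec
  have hsel : ∀ w : Fin n → E, ∃ y : Space (sub A E), weight μ ψ n (fun i => (w i : S)) ≠ 0 →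
      wd (sub A E) n y = w := fun w => by
    by_cases hw : weight μ ψ n (fun i => (w i : S)) = 0
    · exact ⟨y0, fun h => absurd hw h⟩
    · obtain ⟨y, hy⟩ := hext w hw
      exact ⟨y, fun _ => hy⟩
  choose y hy using hsel
  set p : (Fin n → E) → ℝ := fun w => weight μ ψ n (fun i => (w i : S)) / Z with hp
  have hp0 : ∀ w, 0 ≤ p w := fun w => div_nonneg (weight_nonneg _) hpos.le
  have hp1 : ∑ w, p w = 1 := by
    rw [← Finset.sum_div]
    exact div_self hpos.ne'
  set ρ : Measure (Space (sub A E)) := ∑ w, ENNReal.ofReal (p w) • Measure.dirac (y w) with hρ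
  have hρp : IsProbabilityMeasure ρ := ⟨by
    simp only [hρ, Measure.finsetSum_apply, Measure.smul_apply, measure_univ, smul_eq_mul, mul_one]
    rw [← ENNReal.ofReal_sum_of_nonneg fun w _ => hp0 w, hp1, ENNReal.ofReal_one]⟩
  have hρw : ∀ w, ρ.real (wd (sub A E) n ⁻¹' {w}) = p w := by
    intro w
    have : ∀ u, (ENNReal.ofReal (p u) • Measure.dirac (y u)) (wd (sub A E) n ⁻¹' {w}) =
        if u = w then ENNReal.ofReal (p w) else 0 := by
      intro u
      rw [Measure.smul_apply, Measure.dirac_apply' _ (measFibers_wd n w), smul_eq_mul]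
      rcases eq_or_ne (p u) 0 with h0 | h0
      · rw [h0, ENNReal.ofReal_zero, zero_mul]
        split_ifs with huw
        · rw [← huw, h0, ENNReal.ofReal_zero]
        · rfl
      · have : wd (sub A E) n (y u) = u := hy u fun h0' => h0 (by simp only [hp, h0', zero_div])
        by_cases huw : u = w
        · subst huw; simp [this]
        · simp [this, huw]
    rw [Measure.real, hρ, Measure.finsetSum_apply, Finset.sum_congr rfl fun u _ => this u]
    simp [ENNReal.toReal_ofReal (hp0 w)]
  have hint : ∀ g : Space (sub A E) → ℝ, ∫ z, g z ∂ρ = ∑ w, p w * g (y w) := fun g => by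
    rw [hρ, integral_finsetSum_measure fun w _ =>
      (integrable_dirac (by simp)).smul_measure ENNReal.ofReal_ne_top]
    refine Finset.sum_congr rfl fun w _ => ?_
    rw [integral_smul_measure, integral_dirac, ENNReal.toReal_ofReal (hp0 w), smul_eq_mul]
  have hH : (partitionEntropy ρ (wd (sub A E) n)).toReal = ∑ w, -(p w * Real.log (p w)) := by
    unfold partitionEntropy
    rw [tsum_fintype]
    have e : ∀ w, (ρ (wd (sub A E) n ⁻¹' {w})).toReal = p w := hρw
    simp_rw [e]
    have hnn : ∀ w, 0 ≤ -(p w * Real.log (p w)) := fun w => by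
      have := Real.negMulLog_nonneg (hp0 w) (hρw w ▸ measureReal_le_one)
      rwa [Real.negMulLog, neg_mul] at this
    rw [← ENNReal.ofReal_sum_of_nonneg fun w _ => hnn w, ENNReal.toReal_ofReal
      (Finset.sum_nonneg fun w _ => hnn w)]
  refine ⟨ρ, hρp, ?_⟩
  rw [hint, hH, ← Finset.sum_add_distrib, ← sub_le_iff_le_add]
  calc Real.log Z - Real.log c = ∑ w, p w * (Real.log Z - Real.log c) := by
        rw [← Finset.sum_mul, hp1, one_mul]
    _ ≤ _ := by
        refine Finset.sum_le_sum fun w _ => ?_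
        rcases (hp0 w).eq_or_lt with h0 | h0
        · simp [← h0]
        · rw [← mul_neg, ← mul_add]
          refine mul_le_mul_of_nonneg_left ?_ (hp0 w)
          have hw0 : weight μ ψ n (fun i => (w i : S)) ≠ 0 := fun h0' => by
            simp only [hp, h0', zero_div, lt_irrefl] at h0
          have hwd : wd A n (incl A E (y w)) = fun i => (w i : S) := by
            funext i
            exact congrArg Subtype.val (congrFun (hy w hw0) i)
          have e1 := birkhoff_incl (fun x => f x + ψ x) n (y w)
          rw [e1, birkhoff_add_fun]
          have e2 := h.log_le hc n (incl A E (y w))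
          have e3 := loSum_le hC (n := n) (x := incl A E (y w)) rfl
          rw [hwd] at e2 e3
          have e4 : Real.log (p w) = Real.log (μ.real (wd A n ⁻¹' {fun i => (w i : S)})) +
              loSum ψ n (fun i => (w i : S)) - Real.log Z := by
            rw [hp, Real.log_div hw0 hpos.ne', weight, Real.log_mul _ (Real.exp_ne_zero _),
              Real.log_exp]
            exact fun h0' => hw0 (by rw [weight, h0', zero_mul])
          linarith

end Subsystem

/-! ### Growth of partition sums -/

section Growth

lemma exists_pow_le_of_mul_le {u : ℕ → ℝ} {K n : ℕ} (hu : ∀ n, 0 ≤ u n)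
    (h : ∀ n m, n ≠ 0 → m ≠ 0 → ∃ k ≤ K, u n * u m ≤ u (n + k + m)) (hn : n ≠ 0) (r : ℕ) :
    ∃ N, (r + 1) * n ≤ N ∧ N ≤ (r + 1) * (n + K) ∧ u n ^ (r + 1) ≤ u N := by
  induction r with
  | zero => exact ⟨n, by simp, by simp, by simp⟩
  | succ r ih =>
    obtain ⟨N, h1, h2, h3⟩ := ih
    have hN : N ≠ 0 := fun hN => by
      rw [hN, Nat.le_zero, mul_eq_zero] at h1
      omega
    obtain ⟨k, hk, h4⟩ := h N n hN hn
    refine ⟨N + k + n, by linarith, by linarith, ?_⟩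
    rw [pow_succ]
    exact (mul_le_mul_of_nonneg_right h3 (hu n)).trans h4

variable {S : Type*} {A : S → S → Prop} [TopologicalSpace S] [DiscreteTopology S] [Countable S]
  {μ : Measure (Space A)} [IsProbabilityMeasure μ] {f ψ : Space A → ℝ} {c C : ℝ}

lemma exists_half_le_partSum (hC : ∀ x, |ψ x| ≤ C) (n : ℕ) (E₀ : Finset S) :
    ∃ E, E₀ ⊆ E ∧ (∫ x, Real.exp (loSum ψ n (wd A n x)) ∂μ) / 2 ≤ partSum μ ψ E n := by
  classical
  have ha : 0 < ∫ x, Real.exp (loSum ψ n (wd A n x)) ∂μ :=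
    integral_exp_pos' (measurable_loSum ψ n) (abs_loSum_le hC n)
  have hw : ∑' w, ENNReal.ofReal (weight μ ψ n w) = _ := tsum_weight_eq (μ := μ) hC n
  set a := ∫ x, Real.exp (loSum ψ n (wd A n x)) ∂μ
  have hlt : ENNReal.ofReal (a / 2) < ENNReal.ofReal a :=
    (ENNReal.ofReal_lt_ofReal_iff ha).2 (by linarith)
  rw [← hw, ENNReal.tsum_eq_iSup_sum, lt_iSup_iff] at hlt
  obtain ⟨F, hF⟩ := hlt
  rw [← ENNReal.ofReal_sum_of_nonneg fun w _ => weight_nonneg w] at hF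
  have hF' := (ENNReal.ofReal_lt_ofReal_iff_of_nonneg (by positivity)).1 hF
  refine ⟨E₀ ∪ F.biUnion fun w => Finset.univ.image w, Finset.subset_union_left, hF'.le.trans ?_⟩
  set E := E₀ ∪ F.biUnion fun w => Finset.univ.image w
  have hinj : Function.Injective fun (w : Fin n → E) i => (w i : S) := fun w w' h =>
    funext fun i => Subtype.ext (congrFun h i)
  have : partSum μ ψ E n = ∑ w ∈ Finset.univ.image fun (w : Fin n → E) i => (w i : S),
      weight μ ψ n w := by
    rw [Finset.sum_image hinj.injOn]; rfl
  rw [this]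
  refine Finset.sum_le_sum_of_subset_of_nonneg (fun w hw => ?_) fun w _ _ => weight_nonneg w
  refine Finset.mem_image.2 ⟨fun i => ⟨w i, ?_⟩, Finset.mem_univ _, rfl⟩
  exact Finset.mem_union_right _ (Finset.mem_biUnion.2 ⟨w, hw, Finset.mem_image_of_mem _
    (Finset.mem_univ _)⟩)

lemma GibbsBound.exists_finset_growth (h : GibbsBound f μ c) (hc : 1 ≤ c) (hψ : Continuous ψ)
    (hC : ∀ x, |ψ x| ≤ C) (hirr : FinitelyIrreducible A) {q q' : ℝ} (hq : q < q')
    (hfreq : ∃ᶠ n : ℕ in atTop, q' < (n : ℝ)⁻¹ * logZ μ ψ n) :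
    ∃ E : Finset S, (∀ a : E, ∃ b, sub A E a b) ∧ ∀ r : ℕ, ∃ N, r < N ∧
      0 < partSum μ ψ E N ∧ N * q ≤ Real.log (partSum μ ψ E N) := by
  classical
  obtain ⟨Λ, hΛ⟩ := hirr
  obtain ⟨D, hD, hΛD⟩ := h.exists_partSum_mul_le hc hC hΛ
  set ε := (q' - q) / 2 with hε
  have hε0 : 0 < ε := by linarith [hε]
  obtain ⟨D', hD'⟩ := h.logZ_le hc hψ hC hε0
  set K := Λ.sup List.length
  obtain ⟨n, hn, hn1, hnq⟩ : ∃ n : ℕ, q' < (n : ℝ)⁻¹ * logZ μ ψ n ∧ 1 ≤ n ∧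
      D' + Real.log 2 + Real.log D + K * |q| ≤ n * ε := by
    refine (hfreq.and_eventually ((eventually_ge_atTop 1).and ?_)).exists
    exact (tendsto_natCast_atTop_atTop.atTop_mul_const hε0).eventually_ge_atTop _
  obtain ⟨E, hE₀, hE⟩ := exists_half_le_partSum (μ := μ) hC n (Λ.biUnion List.toFinset)
  have hΛE : ∀ l ∈ Λ, ∀ a ∈ l, a ∈ E := fun l hl a ha =>
    hE₀ (Finset.mem_biUnion.2 ⟨l, hl, List.mem_toFinset.2 ha⟩)
  have ha : 0 < ∫ x, Real.exp (loSum ψ n (wd A n x)) ∂μ :=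
    integral_exp_pos' (measurable_loSum ψ n) (abs_loSum_le hC n)
  have hn0 : (0 : ℝ) < n := by exact_mod_cast hn1
  have hD0 : 0 < D := by linarith
  have hZpos : 0 < partSum μ ψ E n := lt_of_lt_of_le (by positivity) hE
  have hu : n * q + K * |q| ≤ Real.log (partSum μ ψ E n / D) := by
    have h1 := hD' n hn1
    have h2 : n * q' < logZ μ ψ n := by
      rwa [inv_mul_eq_div, lt_div_iff₀ hn0, mul_comm] at hn
    have h3 := Real.log_le_log (by positivity) hE
    rw [Real.log_div ha.ne' two_ne_zero] at h3
    rw [Real.log_div hZpos.ne' hD0.ne']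
    have h4 : (n : ℝ) * q' = n * q + 2 * (n * ε) := by rw [hε]; ring
    linarith
  refine ⟨E, fun a => ?_, fun r => ?_⟩
  · have hadm1 : Admissible A [a.1] := ⟨List.cons_ne_nil _ _, List.isChain_singleton _⟩
    obtain ⟨l, hl, hadm⟩ := hΛ [a.1] [a.1] hadm1 hadm1
    have hch : List.IsChain A ([a.1] ++ l ++ [a.1]) := hadm.2
    cases l with
    | nil => exact ⟨a, by simpa [sub] using hch⟩
    | cons b l =>
      exact ⟨⟨b, hΛE _ hl b (by simp)⟩, by
        simp only [List.cons_append, List.nil_append, List.isChain_cons_cons] at hch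
        exact hch.1⟩
  · obtain ⟨N, h1, h2, h3⟩ := exists_pow_le_of_mul_le (u := fun n => partSum μ ψ E n / D) (K := K)
      (n := n) (fun n => div_nonneg (partSum_nonneg E n) hD0.le) (fun n m hn hm => by
        obtain ⟨l, hl, hle⟩ := hΛD E hΛE n m hn hm
        refine ⟨l.length, Finset.le_sup (f := List.length) hl, ?_⟩
        rw [div_mul_div_comm, div_le_div_iff₀ (by positivity) hD0]
        nlinarith) (by omega) r
    have hpos : 0 < partSum μ ψ E n / D := by positivity
    have hposN : 0 < partSum μ ψ E N := by
      have := (pow_pos hpos (r + 1)).trans_le h3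
      rwa [div_pos_iff_of_pos_right hD0] at this
    refine ⟨N, by nlinarith, hposN, ?_⟩
    have h4 := Real.log_le_log (pow_pos hpos _) h3
    rw [Real.log_pow, Real.log_div hposN.ne' hD0.ne'] at h4
    have h5 := Real.log_nonneg hD
    have h6 : ((r + 1 : ℕ) : ℝ) * (n * q + K * |q|) ≤
      ((r + 1 : ℕ) : ℝ) * Real.log (partSum μ ψ E n / D) := by gcongr
    have h1' : ((r + 1 : ℕ) : ℝ) * n ≤ N := by exact_mod_cast h1
    have h2' : (N : ℝ) ≤ ((r + 1 : ℕ) : ℝ) * (n + K) := by exact_mod_cast h2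
    have h7 : (N - ((r + 1 : ℕ) : ℝ) * n) * q ≤ ((r + 1 : ℕ) : ℝ) * K * |q| :=
      (mul_le_mul_of_nonneg_left (le_abs_self q) (by linarith)).trans
        (mul_le_mul_of_nonneg_right (by linarith) (abs_nonneg q))
    linarith

end Growth

/-! ### Equilibrium measures of finite subsystems -/

section Subsystem

variable {S : Type*} {A : S → S → Prop} {E : Finset S} [TopologicalSpace S] [DiscreteTopology S]
  [Countable S] {μ : Measure (Space A)} [IsProbabilityMeasure μ] {f ψ : Space A → ℝ} {c C : ℝ}

lemma le_entropy_map_incl (ν : Measure (Space (sub A E))) [IsFiniteMeasure ν] {a : ℝ≥0∞}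
    (h : a ≤ liminf (fun n : ℕ => ENNReal.ofReal (n : ℝ)⁻¹ *
      partitionEntropy ν (wd (sub A E) n)) atTop) :
    a ≤ entropy (shift A) (ν.map (incl A E)) := by
  classical
  obtain ⟨e, he⟩ := exists_injective_nat S
  set p : Space A → ℕ := fun x => if x.1 0 ∈ E then e (x.1 0) + 1 else 0 with hp
  have hpc : Continuous p := by
    have : Continuous fun s : S => if s ∈ E then e s + 1 else 0 := continuous_of_discreteTopology
    exact this.comp (continuous_coord 0)
  have hpfin : (Set.range p).Finite := by
    refine ((E.image fun s => e s + 1) ∪ {0}).finite_toSet.subset ?_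
    rintro _ ⟨x, rfl⟩
    simp only [hp]
    split_ifs with h
    · exact Finset.mem_coe.2 (Finset.mem_union_left _
        (Finset.mem_image_of_mem (fun s => e s + 1) h))
    · simp
  refine h.trans (le_iSup₂_of_le p ⟨hpc.measurable, hpfin⟩ (le_of_eq ?_))
  congr 1
  funext n
  congr 1
  have hj : ∀ (n : ℕ), MeasFibers fun x : Space A => fun i : Fin n => p ((shift A)^[i] x) :=
    fun n => measFibers_of_measurable (measurable_pi_lambda _ fun i =>
      hpc.measurable.comp (measurable_shift.iterate i))
  rw [partitionEntropy_map measurable_incl ν (hj n)]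
  have hj' : MeasFibers fun y : Space (sub A E) => fun i : Fin n =>
      p ((shift A)^[i] (incl A E y)) := (hj n).comp_measurable measurable_incl
  refine partitionEntropy_congr (measFibers_wd n) hj' ν fun y z => ?_
  have hpi : ∀ (y : Space (sub A E)) (i : ℕ), p ((shift A)^[i] (incl A E y)) = e (y.1 i) + 1 :=
    fun y i => by
      simp only [hp, shift_iterate_val, Nat.add_zero]
      exact if_pos (y.1 i).2
  rw [wd_eq_iff, funext_iff]
  simp only [hpi, Nat.add_right_cancel_iff, he.eq_iff, ← Subtype.ext_iff]
  exact ⟨fun h i hi => h ⟨i, hi⟩, fun h i => h i i.2⟩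

lemma GibbsBound.exists_invariant_ge (h : GibbsBound f μ c) (hc : 1 ≤ c) (hf : Measurable f)
    (hψ : Continuous ψ) (hC : ∀ x, |ψ x| ≤ C) (hirr : FinitelyIrreducible A) {q q' : ℝ}
    (hq : q < q') (hfreq : ∃ᶠ n : ℕ in atTop, q' < (n : ℝ)⁻¹ * logZ μ ψ n) :
    ∃ ν : Measure (Space A), IsProbabilityMeasure ν ∧ Invariant (shift A) ν ∧ Integrable f ν ∧
      (q : EReal) ≤ (entropy (shift A) ν : EReal) + ((∫ x, f x ∂ν + ∫ x, ψ x ∂ν : ℝ) : EReal) := by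
  classical
  obtain ⟨E, hE, hgrow⟩ := h.exists_finset_growth hc hψ hC hirr hq hfreq
  choose N hN hpos hNq using hgrow
  have hex : ∀ r, _ := fun r =>
    h.exists_measure_log_partSum_le hc hC hE ((Nat.zero_le r).trans_lt (hN r)) (hpos r)
  choose ρ hρp hρ using hex
  set ℓ : ℕ → Space (sub A E) → ℝ := fun k y =>
    Real.log (μ.real (wd A k ⁻¹' {wd A k (incl A E y)})) with hℓ
  have hℓc : ∀ k, Continuous (ℓ k) := fun k =>
    (continuous_wd_comp k fun w => Real.log (μ.real (wd A k ⁻¹' {w}))).comp continuous_incl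
  have hlogc := Real.log_nonneg hc
  obtain ⟨C₁, hC₁⟩ := exists_bound_of_continuous (hℓc 1)
  have hfb : ∀ y, |f (incl A E y)| ≤ C₁ + Real.log c := fun y => by
    have h1 := h.log_le hc 1 (incl A E y)
    have h2 := h.le_log hc 1 (incl A E y)
    have h3 := abs_le.1 (hC₁ y)
    simp only [hℓ] at h3
    simp only [birkhoff, Finset.sum_range_one, Function.iterate_zero, id] at h1 h2
    exact abs_le.2 ⟨by linarith, by linarith⟩
  have hfm : Measurable fun y => f (incl A E y) := hf.comp measurable_incl
  have hψm : Continuous fun y => ψ (incl A E y) := hψ.comp continuous_incl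
  have hψb : ∀ y, |ψ (incl A E y)| ≤ C := fun y => hC _
  obtain ⟨ν, hν, hνi, hνq⟩ := exists_invariant_of_averages
    (F := fun y => f (incl A E y) + ψ (incl A E y))
    (G := fun k y => ℓ k y + Real.log c + birkhoff (shift (sub A E)) (fun y => ψ (incl A E y)) k y)
    (hfm.add hψm.measurable)
    (fun y => (abs_add_le _ _).trans (add_le_add (hfb y) (hψb y)))
    (fun k => ((hℓc k).add continuous_const).add
      (continuous_finsetSum _ fun i _ => hψm.comp (continuous_shift.iterate i)))
    (fun k y => by
      rw [birkhoff_add_fun (f := fun y => f (incl A E y))]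
      have := h.le_log hc k (incl A E y)
      rw [birkhoff_incl f k y]
      simp only [hℓ]
      linarith) (N := N) (tendsto_atTop_mono (fun r => (hN r).le) tendsto_id) ρ
    (fun r => (hNq r).trans (hρ r))
  have hfi : Integrable (fun y => f (incl A E y)) ν := integrable_of_abs_le hfm hfb
  have hψi : Integrable (fun y => ψ (incl A E y)) ν := integrable_of_abs_le hψm.measurable hψb
  set J := ∫ y, f (incl A E y) ∂ν + ∫ y, ψ (incl A E y) ∂ν with hJ
  have hbound : ∀ k : ℕ, 1 ≤ k → ENNReal.ofReal (q - J - (k : ℝ)⁻¹ * (2 * Real.log c)) ≤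
      ENNReal.ofReal (k : ℝ)⁻¹ * partitionEntropy ν (wd (sub A E) k) := fun k hk => by
    have hk0 : (0 : ℝ) < k := by exact_mod_cast hk
    have hfin : partitionEntropy ν (wd (sub A E) k) ≠ ⊤ :=
      ((partitionEntropy_le_card _ _).trans_lt (ENNReal.natCast_lt_top _)).ne
    have e1 : ∫ y, (ℓ k y + Real.log c +
        birkhoff (shift (sub A E)) (fun y => ψ (incl A E y)) k y) ∂ν ≤ k * J + 2 * Real.log c := by
      have i1 := hνi.integrable_birkhoff measurable_shift hfi k
      have i2 := hνi.integrable_birkhoff measurable_shift hψi k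
      obtain ⟨Ck, hCk⟩ := exists_bound_of_continuous (hℓc k)
      have i3 : Integrable (ℓ k) ν := integrable_of_abs_le (hℓc k).measurable hCk
      have := integral_mono ((i3.add (integrable_const (Real.log c))).add i2)
        ((i1.add (integrable_const (2 * Real.log c))).add i2) fun y => by
          have := h.log_le hc k (incl A E y)
          rw [← birkhoff_incl f k y] at this
          simp only [Pi.add_apply, hℓ]
          linarith
      refine this.trans (le_of_eq ?_)
      rw [integral_add' (i1.add (integrable_const _)) i2, integral_add' i1 (integrable_const _),
        hνi.integral_birkhoff measurable_shift hfm hfi,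
        hνi.integral_birkhoff measurable_shift hψm.measurable hψi]
      simp [hJ]
      ring
    have e2 := (hνq k).trans (add_le_add_right e1 _)
    rw [← ENNReal.ofReal_toReal hfin, ← ENNReal.ofReal_mul (by positivity)]
    refine ENNReal.ofReal_le_ofReal ?_
    rw [inv_mul_eq_div, inv_mul_eq_div, le_div_iff₀ hk0]
    field_simp
    linarith
  have hent : ENNReal.ofReal (q - J) ≤ entropy (shift A) (ν.map (incl A E)) := by
    refine le_entropy_map_incl ν ?_
    have hlim : Tendsto (fun k : ℕ => ENNReal.ofReal (q - J - (k : ℝ)⁻¹ * (2 * Real.log c))) atTop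
        (𝓝 (ENNReal.ofReal (q - J))) := by
      refine ENNReal.tendsto_ofReal ?_
      simpa using tendsto_const_nhds.sub
        (tendsto_inv_atTop_nhds_zero_nat.mul_const (2 * Real.log c))
    rw [← hlim.liminf_eq]
    exact liminf_le_liminf ((eventually_ge_atTop 1).mono hbound)
  have hmapf : ∫ x, f x ∂(ν.map (incl A E)) = ∫ y, f (incl A E y) ∂ν :=
    integral_map measurable_incl.aemeasurable hf.aestronglyMeasurable
  have hmapψ : ∫ x, ψ x ∂(ν.map (incl A E)) = ∫ y, ψ (incl A E y) ∂ν :=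
    integral_map measurable_incl.aemeasurable hψ.measurable.aestronglyMeasurable
  refine ⟨ν.map (incl A E), Measure.isProbabilityMeasure_map measurable_incl.aemeasurable,
    hνi.map_incl, (integrable_map_measure hf.aestronglyMeasurable
      measurable_incl.aemeasurable).2 hfi, ?_⟩
  rw [hmapf, hmapψ, ← hJ]
  have h1 : ((q - J : ℝ) : EReal) ≤ (entropy (shift A) (ν.map (incl A E)) : EReal) :=
    (EReal.coe_le_coe_iff.2 (Real.le_coe_toNNReal (q - J))).trans
      (EReal.coe_ennreal_le_coe_ennreal_iff.2 hent)
  calc (q : EReal) = ((q - J : ℝ) : EReal) + (J : EReal) := by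
        rw [← EReal.coe_add]; congr 1; ring
    _ ≤ _ := by gcongr

end Subsystem

/-! ### Concavity of entropy and of the free energy -/

lemma liminf_add_liminf_le (u v : ℕ → ℝ≥0∞) :
    liminf u atTop + liminf v atTop ≤ liminf (fun n => u n + v n) atTop := by
  simp only [liminf_eq_iSup_iInf_of_nat]
  refine ENNReal.iSup_add_iSup_le fun n m => le_iSup_of_le (max n m) (le_iInf₂ fun i hi => ?_)
  exact add_le_add (iInf₂_le i ((le_max_left n m).trans hi))
    (iInf₂_le i ((le_max_right n m).trans hi))

lemma coe_le_coe_ennreal_add_coe {r x : ℝ} {y : ℝ≥0∞} :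
    (r : EReal) ≤ (y : EReal) + (x : EReal) ↔ ENNReal.ofReal (r - x) ≤ y := by
  induction y with
  | top => simp
  | coe y =>
    rw [ENNReal.ofReal_le_iff_le_toReal ENNReal.coe_ne_top, ENNReal.coe_toReal,
      EReal.coe_nnreal_eq_coe_real, ← EReal.coe_add, EReal.coe_le_coe_iff, sub_le_iff_le_add]

section Mixture

variable {X : Type*} [MeasurableSpace X] {T : X → X} {t : ℝ}

lemma Invariant.mix (hT : Measurable T) {μ ν : ProbabilityMeasure X} (h0 : 0 ≤ t) (h1 : t ≤ 1)
    (hμ : Invariant T (μ : Measure X)) (hν : Invariant T (ν : Measure X)) :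
    Invariant T (CMS.mix t h0 h1 μ ν : Measure X) := by
  unfold Invariant at *
  change Measure.map T (_ • _ + _ • _) = _ • _ + _ • _
  rw [Measure.map_add _ _ hT, Measure.map_smul, Measure.map_smul, hμ, hν]

lemma integrable_mix {g : X → ℝ} {μ ν : ProbabilityMeasure X} (h0 : 0 ≤ t) (h1 : t ≤ 1)
    (hμ : Integrable g (μ : Measure X)) (hν : Integrable g (ν : Measure X)) :
    Integrable g (mix t h0 h1 μ ν : Measure X) :=
  (hμ.smul_measure ENNReal.ofReal_ne_top).add_measure (hν.smul_measure ENNReal.ofReal_ne_top)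

lemma integral_mix {g : X → ℝ} {μ ν : ProbabilityMeasure X} (h0 : 0 ≤ t) (h1 : t ≤ 1)
    (hμ : Integrable g (μ : Measure X)) (hν : Integrable g (ν : Measure X)) :
    ∫ x, g x ∂(mix t h0 h1 μ ν : Measure X) =
      t * ∫ x, g x ∂(μ : Measure X) + (1 - t) * ∫ x, g x ∂(ν : Measure X) := by
  change ∫ x, g x ∂(ENNReal.ofReal t • (μ : Measure X) +
    ENNReal.ofReal (1 - t) • (ν : Measure X)) = _
  rw [integral_add_measure (hμ.smul_measure ENNReal.ofReal_ne_top)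
    (hν.smul_measure ENNReal.ofReal_ne_top), integral_smul_measure, integral_smul_measure,
    ENNReal.toReal_ofReal h0, ENNReal.toReal_ofReal (by linarith), smul_eq_mul, smul_eq_mul]

lemma partitionEntropy_mix_ge {α : Type*} (g : X → α) (μ ν : ProbabilityMeasure X)
    (h0 : 0 ≤ t) (h1 : t ≤ 1) :
    ENNReal.ofReal t * partitionEntropy (μ : Measure X) g +
        ENNReal.ofReal (1 - t) * partitionEntropy (ν : Measure X) g ≤
      partitionEntropy (mix t h0 h1 μ ν : Measure X) g := by
  have := le_partitionEntropy_of_average Finset.univ ![t, 1 - t]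
    (by simp [Fin.forall_fin_two, h0, h1]) (by simp) g
    (fun i : Fin 2 => ((![μ, ν] i : ProbabilityMeasure X) : Measure X))
    (mix t h0 h1 μ ν : Measure X) fun a => by
      rw [Measure.real]
      change ((ENNReal.ofReal t • (μ : Measure X) +
        ENNReal.ofReal (1 - t) • (ν : Measure X)) _).toReal
        = _
      rw [Measure.add_apply, Measure.smul_apply, Measure.smul_apply, smul_eq_mul, smul_eq_mul,
        ENNReal.toReal_add (ENNReal.mul_ne_top (by simp) (measure_ne_top _ _))
          (ENNReal.mul_ne_top (by simp) (measure_ne_top _ _)), ENNReal.toReal_mul,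
        ENNReal.toReal_mul, ENNReal.toReal_ofReal h0, ENNReal.toReal_ofReal (by linarith)]
      simp [Measure.real]
  simpa using this

lemma entropy_mix_ge (hT : Measurable T) (μ ν : ProbabilityMeasure X) (h0 : 0 ≤ t) (h1 : t ≤ 1) :
    ENNReal.ofReal t * entropy T (μ : Measure X) +
        ENNReal.ofReal (1 - t) * entropy T (ν : Measure X) ≤
      entropy T (mix t h0 h1 μ ν : Measure X) := by
  unfold entropy
  simp only [ENNReal.mul_iSup]
  have hex : ∃ p : X → ℕ, Measurable p ∧ (Set.range p).Finite :=
    ⟨fun _ => 0, measurable_const, Set.finite_range_const⟩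
  refine ENNReal.biSup_add_biSup_le' hex hex fun p hp q hq => ?_
  set r : X → ℕ := fun x => Nat.pair (p x) (q x) with hr
  have hrm : Measurable r := (measurable_of_countable fun z : ℕ × ℕ => Nat.pair z.1 z.2).comp
    (hp.1.prodMk hq.1)
  have hrfin : (Set.range r).Finite := by
    refine ((hp.2.prod hq.2).image fun z : ℕ × ℕ => Nat.pair z.1 z.2).subset ?_
    rintro _ ⟨x, rfl⟩
    exact ⟨(p x, q x), ⟨⟨x, rfl⟩, ⟨x, rfl⟩⟩, rfl⟩
  refine le_iSup₂_of_le r ⟨hrm, hrfin⟩ ?_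
  rw [← ENNReal.liminf_const_mul_of_ne_top ENNReal.ofReal_ne_top,
    ← ENNReal.liminf_const_mul_of_ne_top ENNReal.ofReal_ne_top]
  refine (liminf_add_liminf_le _ _).trans (liminf_le_liminf (Eventually.of_forall fun n => ?_))
  have hj : ∀ {p : X → ℕ}, Measurable p → MeasFibers fun x => fun i : Fin n => p (T^[i] x) :=
    fun hp => measFibers_of_measurable (measurable_pi_lambda _ fun i => hp.comp (hT.iterate i))
  have hcoord : ∀ x y, ((fun i : Fin n => r (T^[i] x)) = fun i : Fin n => r (T^[i] y)) →
      ∀ i : Fin n, p (T^[i] x) = p (T^[i] y) ∧ q (T^[i] x) = q (T^[i] y) := fun x y h i =>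
    Nat.pair_eq_pair.1 (congrFun h i)
  have e1 := partitionEntropy_mono (hj hp.1) (hj hrm) (μ : Measure X) fun x y h =>
    funext fun i => (hcoord x y h i).1
  have e2 := partitionEntropy_mono (hj hq.1) (hj hrm) (ν : Measure X) fun x y h =>
    funext fun i => (hcoord x y h i).2
  calc _ = ENNReal.ofReal (n : ℝ)⁻¹ * (ENNReal.ofReal t *
        partitionEntropy (μ : Measure X) (fun x => fun i : Fin n => p (T^[i] x)) +
        ENNReal.ofReal (1 - t) *
          partitionEntropy (ν : Measure X) (fun x => fun i : Fin n => q (T^[i] x))) := by ring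
    _ ≤ _ := by
        gcongr
        exact (by gcongr : _ ≤ _).trans (partitionEntropy_mix_ge _ μ ν h0 h1)

end Mixture

section FreeEnergy

variable {X : Type*} [MeasurableSpace X] {T : X → X} {φ : X → ℝ} {P M : ℝ}

lemma freeEnergy_eq {ν : ProbabilityMeasure X} (hν : Invariant T (ν : Measure X))
    (hi : Integrable (fun x => φ x - P) (ν : Measure X)) :
    freeEnergy T φ P ν = (entropy T (ν : Measure X) : EReal) +
      ((∫ x, (φ x - P) ∂(ν : Measure X) : ℝ) : EReal) := by
  have hφi : Integrable φ (ν : Measure X) := by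
    simpa [Pi.add_def] using hi.add (integrable_const P)
  have hfin : ∀ {g : X → ℝ}, Integrable g (ν : Measure X) →
      (∫⁻ x, ENNReal.ofReal (g x) ∂(ν : Measure X)) ≠ ⊤ := fun hg =>
    ((lintegral_mono fun x => Real.ofReal_le_enorm _).trans_lt hg.2).ne
  have hbot : IntegralGtBot φ (ν : Measure X) := hfin hφi.neg
  rw [freeEnergy, if_pos ⟨hν, hbot⟩, integral_sub hφi (integrable_const P)]
  have e : eintegral φ (ν : Measure X) = ((∫ x, φ x ∂(ν : Measure X) : ℝ) : EReal) := by
    rw [eintegral, integral_eq_lintegral_pos_part_sub_lintegral_neg_part hφi, EReal.coe_sub]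
    lift ∫⁻ x, ENNReal.ofReal (φ x) ∂(ν : Measure X) to ℝ≥0 using hfin hφi with a
    lift ∫⁻ x, ENNReal.ofReal (-φ x) ∂(ν : Measure X) to ℝ≥0 using hfin hφi.neg with b
    rfl
  rw [e]
  simp [sub_eq_add_neg, add_assoc]

lemma integrable_of_integralGtBot (hφ : Measurable φ) (hM : ∀ x, φ x ≤ M)
    {ν : ProbabilityMeasure X} (h : IntegralGtBot φ (ν : Measure X)) :
    Integrable φ (ν : Measure X) := by
  refine ⟨hφ.aestronglyMeasurable, ?_⟩
  have h1 : ∀ x, ‖φ x‖ₑ ≤ ENNReal.ofReal M + ENNReal.ofReal (-φ x) := fun x => by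
    rw [Real.enorm_eq_ofReal_abs]
    rcases le_total 0 (φ x) with h | h
    · rw [abs_of_nonneg h]
      exact (ENNReal.ofReal_le_ofReal (hM x)).trans le_self_add
    · rw [abs_of_nonpos h]
      exact le_add_self
  refine (lintegral_mono h1).trans_lt ?_
  rw [lintegral_add_left measurable_const, lintegral_const, measure_univ, mul_one]
  exact ENNReal.add_lt_top.2 ⟨ENNReal.ofReal_lt_top, h.lt_top⟩

lemma invariant_and_integrable_of_freeEnergy_ne_bot (hφ : Measurable φ)
    (hM : ∀ x, φ x - P ≤ M) {ν : ProbabilityMeasure X} (h : freeEnergy T φ P ν ≠ ⊥) :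
    Invariant T (ν : Measure X) ∧ Integrable (fun x => φ x - P) (ν : Measure X) := by
  rw [freeEnergy] at h
  have hc := of_not_not fun hc => h (if_neg hc)
  exact ⟨hc.1, (integrable_of_integralGtBot hφ (M := M + P) (fun x => by linarith [hM x])
    hc.2).sub (integrable_const P)⟩

lemma le_freeEnergy_mix (hT : Measurable T) (hφ : Measurable φ) (hM : ∀ x, φ x - P ≤ M)
    {μ ν : ProbabilityMeasure X} {r s t : ℝ} (h0 : 0 ≤ t) (h1 : t ≤ 1)
    (hr : (r : EReal) ≤ freeEnergy T φ P μ) (hs : (s : EReal) ≤ freeEnergy T φ P ν) :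
    ((t * r + (1 - t) * s : ℝ) : EReal) ≤ freeEnergy T φ P (mix t h0 h1 μ ν) := by
  obtain ⟨hμ, hμi⟩ := invariant_and_integrable_of_freeEnergy_ne_bot hφ hM
    ((EReal.bot_lt_coe r).trans_le hr).ne'
  obtain ⟨hν, hνi⟩ := invariant_and_integrable_of_freeEnergy_ne_bot hφ hM
    ((EReal.bot_lt_coe s).trans_le hs).ne'
  rw [freeEnergy_eq hμ hμi, coe_le_coe_ennreal_add_coe] at hr
  rw [freeEnergy_eq hν hνi, coe_le_coe_ennreal_add_coe] at hs
  rw [freeEnergy_eq (hμ.mix hT h0 h1 hν) (integrable_mix h0 h1 hμi hνi),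
    coe_le_coe_ennreal_add_coe, integral_mix h0 h1 hμi hνi]
  refine le_trans ?_ ((add_le_add (mul_le_mul_right hr (ENNReal.ofReal t))
    (mul_le_mul_right hs (ENNReal.ofReal (1 - t)))).trans (entropy_mix_ge hT μ ν h0 h1))
  rw [← ENNReal.ofReal_mul h0, ← ENNReal.ofReal_mul (by linarith : 0 ≤ 1 - t)]
  refine le_trans (ENNReal.ofReal_le_ofReal (le_of_eq ?_)) ENNReal.ofReal_add_le
  ring

end FreeEnergy

/-! ### Varadhan's functional and convex duality for `rateOf` -/

section Duality

open scoped BoundedContinuousFunction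

lemma integral_sub_varQ_le {X : Type*} [MeasurableSpace X] (I : ProbabilityMeasure X → EReal)
    (ψ : X → ℝ) (μ : ProbabilityMeasure X) :
    ((∫ x, ψ x ∂(μ : Measure X) : ℝ) : EReal) - varQ I ψ ≤ I μ := by
  have h : ((∫ x, ψ x ∂(μ : Measure X) : ℝ) : EReal) - I μ ≤ varQ I ψ :=
    le_iSup (fun μ : ProbabilityMeasure X =>
      ((∫ x, ψ x ∂(μ : Measure X) : ℝ) : EReal) - I μ) μ
  generalize varQ I ψ = V at *
  generalize I μ = J at *
  induction J with
  | top => exact le_top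
  | bot => simp at h; simp [h]
  | coe r =>
    refine EReal.sub_le_of_le_add' ?_
    rwa [EReal.sub_le_iff_le_add (.inl (EReal.coe_ne_bot r)) (.inl (EReal.coe_ne_top r))] at h

variable {X : Type*} [TopologicalSpace X] [MeasurableSpace X] [OpensMeasurableSpace X]
  {F : ProbabilityMeasure X → EReal}

lemma rateOf_le (ν : ProbabilityMeasure X) : rateOf F ν ≤ -F ν := by
  rw [rateOf, EReal.neg_le_neg_iff]
  exact le_iInf₂ fun G hG => le_iSup₂_of_le ν hG.2 le_rfl

lemma varQ_rateOf_le {ψ : X →ᵇ ℝ} {L : ℝ}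
    (h : ∀ ν : ProbabilityMeasure X, F ν ≤ ((L - ∫ x, ψ x ∂(ν : Measure X) : ℝ) : EReal)) :
    varQ (rateOf F) ψ ≤ L := by
  refine iSup_le fun μ => ?_
  rw [rateOf, sub_eq_add_neg, neg_neg, add_comm, ← EReal.le_of_forall_lt_iff_le]
  intro z hz
  rw [EReal.coe_lt_coe_iff] at hz
  have hc := ProbabilityMeasure.continuous_integral_boundedContinuousFunction ψ
  set G : Set (ProbabilityMeasure X) := {ν |
    ∫ x, ψ x ∂(μ : Measure X) - (z - L) < ∫ x, ψ x ∂(ν : Measure X)}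
  have hG : IsOpen G := isOpen_lt continuous_const hc
  have hμG : μ ∈ G := sub_lt_self _ (sub_pos.2 hz)
  have hsup : ⨆ ν ∈ G, F ν ≤ ((z - ∫ x, ψ x ∂(μ : Measure X) : ℝ) : EReal) :=
    iSup₂_le fun ν hν => (h ν).trans <| EReal.coe_le_coe_iff.2 <| by
      have : ∫ x, ψ x ∂(μ : Measure X) - (z - L) < ∫ x, ψ x ∂(ν : Measure X) := hν
      linarith
  have hle : ⨅ (G : Set (ProbabilityMeasure X)) (_ : IsOpen G ∧ μ ∈ G), ⨆ ν ∈ G, F ν ≤ _ :=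
    (iInf₂_le G ⟨hG, hμG⟩).trans hsup
  refine (add_le_add_left hle _).trans ?_
  rw [← EReal.coe_add, sub_add_cancel]

lemma le_varQ_rateOf (ψ : X → ℝ) (ν : ProbabilityMeasure X) :
    ((∫ x, ψ x ∂(ν : Measure X) : ℝ) : EReal) + F ν ≤ varQ (rateOf F) ψ := by
  refine le_iSup_of_le ν ?_
  rw [sub_eq_add_neg]
  gcongr
  rw [EReal.le_neg]
  exact rateOf_le ν

lemma exists_finset_ball_subset {G : Set (ProbabilityMeasure X)} (hG : IsOpen G)
    {μ : ProbabilityMeasure X} (hμ : μ ∈ G) : ∃ (J : Finset (X →ᵇ ℝ)) (W : (J → ℝ) → Prop),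
    IsOpen {v | W v} ∧ Convex ℝ {v | W v} ∧ (W fun θ => ∫ x, (θ : X →ᵇ ℝ) x ∂(μ : Measure X)) ∧
      ∀ ν : ProbabilityMeasure X, (W fun θ => ∫ x, (θ : X →ᵇ ℝ) x ∂(ν : Measure X)) → ν ∈ G := by
  set Φ : ProbabilityMeasure X → (X →ᵇ ℝ) → ℝ := fun ν θ => ∫ x, θ x ∂(ν : Measure X) with hΦ
  have hle : comap Φ (𝓝 (Φ μ)) ≤ 𝓝 μ := by
    refine tendsto_id'.1 (ProbabilityMeasure.tendsto_iff_forall_integral_tendsto.2 fun θ => ?_)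
    have hc : Continuous fun v : (X →ᵇ ℝ) → ℝ => v θ := continuous_apply θ
    exact (hc.tendsto (Φ μ)).comp tendsto_comap
  obtain ⟨s, hs, hsG⟩ := hle (hG.mem_nhds hμ)
  rw [nhds_pi, Filter.mem_pi'] at hs
  obtain ⟨J, t, ht, hJt⟩ := hs
  choose δ hδ hδt using fun θ => Metric.mem_nhds_iff.1 (ht θ)
  refine ⟨J, fun v => v ∈ Set.pi univ fun θ : J => Metric.ball (Φ μ θ) (δ θ),
    isOpen_set_pi finite_univ fun θ _ => Metric.isOpen_ball,
    convex_pi fun θ _ => convex_ball _ _, fun θ _ => Metric.mem_ball_self (hδ θ), fun ν hν => ?_⟩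
  exact hsG (hJt fun θ hθ => hδt θ (hν ⟨θ, hθ⟩ trivial))

/-- Separation of a concave functional from a point at which its rate function is large. -/
lemma exists_le_of_lt_rateOf (hF : ∀ ν, F ν ≤ 0)
    (hconc : ∀ (μ ν : ProbabilityMeasure X) (r s t : ℝ) (h0 : 0 ≤ t) (h1 : t ≤ 1),
      (r : EReal) ≤ F μ → (s : EReal) ≤ F ν →
        ((t * r + (1 - t) * s : ℝ) : EReal) ≤ F (mix t h0 h1 μ ν))
    {μ : ProbabilityMeasure X} {a : ℝ} (ha : (a : EReal) < rateOf F μ) :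
    ∃ θ : X →ᵇ ℝ, ∀ ν : ProbabilityMeasure X,
      F ν ≤ ((∫ x, θ x ∂(μ : Measure X) - a - ∫ x, θ x ∂(ν : Measure X) : ℝ) : EReal) := by
  classical
  rw [rateOf, EReal.lt_neg_comm] at ha
  simp only [iInf_lt_iff] at ha
  obtain ⟨G, ⟨hG, hμG⟩, hGa⟩ := ha
  obtain ⟨J, W, hWo, hWc, hWμ, hWG⟩ := exists_finset_ball_subset hG hμG
  set Φ : ProbabilityMeasure X → J → ℝ := fun ν θ => ∫ x, (θ : X →ᵇ ℝ) x ∂(ν : Measure X) with hΦ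
  have hconv : Convex ℝ {z : (J → ℝ) × ℝ | ∃ ν, z.1 = Φ ν ∧ (z.2 : EReal) ≤ F ν} := by
    rintro ⟨_, r⟩ ⟨ν₁, rfl, h₁⟩ ⟨_, s⟩ ⟨ν₂, rfl, h₂⟩ t u ht hu htu
    obtain rfl : u = 1 - t := by linarith
    refine ⟨mix t ht (by linarith) ν₁ ν₂, funext fun θ => ?_, hconc ν₁ ν₂ r s t ht _ h₁ h₂⟩
    exact (integral_mix ht _ ((θ : X →ᵇ ℝ).integrable _) ((θ : X →ᵇ ℝ).integrable _)).symm
  obtain ⟨g, u, hg₁, hg₂⟩ := geometric_hahn_banach_open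
    (s := {v | W v} ×ˢ Ioi (-a)) (hWc.prod (convex_Ioi _)) (hWo.prod isOpen_Ioi) hconv <| by
      refine Set.disjoint_left.2 ?_
      rintro ⟨_, r⟩ ⟨hv, hr⟩ ⟨ν, rfl, hνr⟩
      have h1 : (r : EReal) < ((-a : ℝ) : EReal) :=
        (hνr.trans (le_iSup₂ (f := fun ν _ => F ν) ν (hWG ν hv))).trans_lt hGa
      exact lt_asymm (EReal.coe_lt_coe_iff.1 h1) hr
  set b : ℝ := g (0, 1) with hb
  set θ₀ : X →ᵇ ℝ := ∑ i : J, g (Pi.single i 1, 0) • (i : X →ᵇ ℝ) with hθ₀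
  have hgΦ : ∀ ν r, g (Φ ν, r) = ∫ x, θ₀ x ∂(ν : Measure X) + r * b := fun ν r => by
    have hdec : (Φ ν, r) = ∑ i : J, Φ ν i • ((Pi.single i 1, 0) : (J → ℝ) × ℝ) +
        r • ((0, 1) : (J → ℝ) × ℝ) := by
      ext j
      · simp [Prod.fst_sum, Finset.sum_apply, Pi.single_apply]
      · simp [Prod.snd_sum]
    have hint : ∫ x, θ₀ x ∂(ν : Measure X) = ∑ i : J, g (Pi.single i 1, 0) * Φ ν i := by
      simp only [hθ₀, BoundedContinuousFunction.coe_sum, Finset.sum_apply,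
        BoundedContinuousFunction.coe_smul, smul_eq_mul]
      rw [integral_finsetSum (f := fun (i : J) x => g (Pi.single i 1, 0) * (i : X →ᵇ ℝ) x) _
        fun i _ => ((i : X →ᵇ ℝ).integrable _).const_mul _]
      simp only [integral_const_mul, hΦ]
    rw [hdec, map_add, map_sum, map_smul, hint, smul_eq_mul, ← hb]
    simp only [map_smul, smul_eq_mul, mul_comm]
  have hmem : ∀ r, -a < r → ∫ x, θ₀ x ∂(μ : Measure X) + r * b < u := fun r hr => by
    rw [← hgΦ]
    exact hg₁ _ ⟨hWμ, hr⟩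
  have hge : ∀ ν (r : ℝ), (r : EReal) ≤ F ν → u ≤ ∫ x, θ₀ x ∂(ν : Measure X) + r * b :=
    fun ν r hr => by
      rw [← hgΦ]
      exact hg₂ _ ⟨ν, rfl, hr⟩
  have hb0 : b ≤ 0 := by
    by_contra! hb0
    have := hmem (max (-a + 1) ((u - ∫ x, θ₀ x ∂(μ : Measure X)) / b))
      (by have := le_max_left (-a + 1) ((u - ∫ x, θ₀ x ∂(μ : Measure X)) / b); linarith)
    have h2 := mul_le_mul_of_nonneg_right
      (le_max_right (-a + 1) ((u - ∫ x, θ₀ x ∂(μ : Measure X)) / b)) hb0.le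
    rw [div_mul_cancel₀ _ hb0.ne'] at h2
    linarith
  have hsmul : ∀ (k : ℝ) (ν : ProbabilityMeasure X),
      ∫ x, (k • θ₀) x ∂(ν : Measure X) = k * ∫ x, θ₀ x ∂(ν : Measure X) := fun k ν => by
    simp [integral_const_mul]
  have hreal : ∀ {z : EReal} {y : ℝ}, (∀ r : ℝ, (r : EReal) ≤ z → r ≤ y) → z ≤ y :=
    fun {z y} h => EReal.ge_of_forall_gt_iff_ge.1 fun r hr => EReal.coe_le_coe_iff.2 (h r hr.le)
  rcases hb0.lt_or_eq with hb0 | hb0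
  · refine ⟨b⁻¹ • θ₀, fun ν => hreal fun r hr => ?_⟩
    have h1 : ∫ x, θ₀ x ∂(μ : Measure X) + -a * b ≤ u := by
      have hlim : Tendsto (fun r : ℝ => ∫ x, θ₀ x ∂(μ : Measure X) + r * b) (𝓝[>] (-a))
          (𝓝 (∫ x, θ₀ x ∂(μ : Measure X) + -a * b)) :=
        (Continuous.tendsto (by fun_prop) _).mono_left nhdsWithin_le_nhds
      exact le_of_tendsto hlim (eventually_nhdsWithin_of_forall fun r hr => (hmem r hr).le)
    have h2 := h1.trans (hge ν r hr)
    rw [hsmul, hsmul]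
    have h3 := mul_le_mul_of_nonpos_left h2 (inv_nonpos.2 hb0.le)
    have e : ∀ k : ℝ, b⁻¹ * (k * b) = k := fun k => by
      rw [mul_comm k, inv_mul_cancel_left₀ hb0.ne]
    rw [mul_add, mul_add, e, e] at h3
    linarith
  · have hη : 0 < u - ∫ x, θ₀ x ∂(μ : Measure X) := by
      have := hmem (-a + 1) (by linarith)
      rw [hb0] at this
      linarith
    set η := u - ∫ x, θ₀ x ∂(μ : Measure X)
    refine ⟨(-(|a| / η)) • θ₀, fun ν => hreal fun r hr => ?_⟩
    have h1 := hge ν r hr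
    rw [hb0, mul_zero, add_zero] at h1
    have h2 : r ≤ 0 := EReal.coe_le_coe_iff.1 (hr.trans (hF ν))
    rw [hsmul, hsmul]
    have h3 : |a| / η * η ≤ |a| / η * (∫ x, θ₀ x ∂(ν : Measure X) - ∫ x, θ₀ x ∂(μ : Measure X)) :=
      mul_le_mul_of_nonneg_left (by linarith) (by positivity)
    rw [div_mul_cancel₀ _ hη.ne'] at h3
    have := le_abs_self a
    linarith

lemma rateOf_eq_iSup (hF : ∀ ν, F ν ≤ 0)
    (hconc : ∀ (μ ν : ProbabilityMeasure X) (r s t : ℝ) (h0 : 0 ≤ t) (h1 : t ≤ 1),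
      (r : EReal) ≤ F μ → (s : EReal) ≤ F ν →
        ((t * r + (1 - t) * s : ℝ) : EReal) ≤ F (mix t h0 h1 μ ν))
    (μ : ProbabilityMeasure X) :
    rateOf F μ = ⨆ (ψ : X → ℝ) (_ : Continuous ψ ∧ ∃ C : ℝ, ∀ x, |ψ x| ≤ C),
      ((∫ x, ψ x ∂(μ : Measure X) : ℝ) : EReal) - varQ (rateOf F) ψ := by
  refine le_antisymm ?_ (iSup₂_le fun ψ _ => integral_sub_varQ_le _ ψ μ)
  refine EReal.ge_of_forall_gt_iff_ge.1 fun a ha => ?_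
  obtain ⟨θ, hθ⟩ := exists_le_of_lt_rateOf hF hconc ha
  refine le_iSup₂_of_le θ ⟨θ.continuous, ‖θ‖, fun x => θ.norm_coe_le_norm x⟩ ?_
  have h := varQ_rateOf_le hθ
  refine le_trans ?_ (EReal.sub_le_sub le_rfl h)
  rw [← EReal.coe_sub, sub_sub_cancel]

end Duality

section Assembly

open scoped BoundedContinuousFunction

variable {S : Type*} [Countable S] [TopologicalSpace S] [DiscreteTopology S] {A : S → S → Prop}
  {φ ψ : Space A → ℝ} {μ : Measure (Space A)} [IsProbabilityMeasure μ] {c P C : ℝ}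

lemma GibbsBound.freeEnergy_add_integral_le_liminf (h : GibbsBound (fun x => φ x - P) μ c)
    (hc : 1 ≤ c) (hφ : Measurable φ) (hψ : Continuous ψ) (hC : ∀ x, |ψ x| ≤ C)
    (ν : ProbabilityMeasure (Space A)) :
    freeEnergy (shift A) φ P ν + ((∫ x, ψ x ∂(ν : Measure (Space A)) : ℝ) : EReal) ≤
      liminf (fun n : ℕ => (((n : ℝ)⁻¹ * logZ μ ψ n : ℝ) : EReal)) atTop := by
  by_cases hbot : freeEnergy (shift A) φ P ν = ⊥
  · simp [hbot]
  obtain ⟨hinv, hint⟩ := invariant_and_integrable_of_freeEnergy_ne_bot hφ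
    (fun x => h.le_log_const hc x) hbot
  rw [freeEnergy_eq hinv hint, add_assoc, ← EReal.coe_add]
  exact h.entropy_add_le_liminf hc (hφ.sub_const P) hψ hC ν hinv hint

lemma GibbsBound.freeEnergy_nonpos (h : GibbsBound (fun x => φ x - P) μ c) (hc : 1 ≤ c)
    (hφ : Measurable φ) (ν : ProbabilityMeasure (Space A)) : freeEnergy (shift A) φ P ν ≤ 0 := by
  have h0 := h.freeEnergy_add_integral_le_liminf (ψ := fun _ => 0) (C := 0) hc hφ
    continuous_const (by simp) ν
  have hZ : ∀ n, logZ μ (fun _ => 0) n = 0 := fun n => by simp [logZ, birkhoff]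
  simpa [hZ] using h0

lemma GibbsBound.tendsto_logZ (h : GibbsBound (fun x => φ x - P) μ c) (hc : 1 ≤ c)
    (hφ : Measurable φ) (hirr : FinitelyIrreducible A) (hψ : Continuous ψ)
    (hC : ∀ x, |ψ x| ≤ C) :
    Tendsto (fun n : ℕ => (((n : ℝ)⁻¹ * logZ μ ψ n : ℝ) : EReal)) atTop
      (𝓝 (varQ (rateOf (freeEnergy (shift A) φ P)) ψ)) := by
  refine tendsto_of_le_liminf_of_limsup_le ?_ ?_
  · refine EReal.le_of_forall_lt_iff_le.1 fun L hL => ?_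
    have hL' := varQ_rateOf_le (F := freeEnergy (shift A) φ P) (L := L)
      (ψ := BoundedContinuousFunction.ofNormedAddCommGroup ψ hψ C hC) fun ν => by
        have hν := (h.freeEnergy_add_integral_le_liminf hc hφ hψ hC ν).trans hL.le
        rw [EReal.coe_sub]
        exact EReal.le_sub_iff_add_le (.inl (EReal.coe_ne_bot _)) (.inl (EReal.coe_ne_top _))
          |>.2 hν
    exact hL'
  · refine EReal.ge_of_forall_gt_iff_ge.1 fun q hq => ?_
    obtain ⟨q', hq₁, hq₂⟩ := EReal.lt_iff_exists_real_btwn.1 hq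
    obtain ⟨ν, hν, hinv, hint, hle⟩ := h.exists_invariant_ge hc (hφ.sub_const P) hψ hC hirr
      (EReal.coe_lt_coe_iff.1 hq₁)
      ((frequently_lt_of_lt_limsup (by isBoundedDefault) hq₂).mono
        fun n hn => EReal.coe_lt_coe_iff.1 hn)
    refine hle.trans (le_trans (le_of_eq ?_) (le_varQ_rateOf ψ ⟨ν, hν⟩))
    rw [freeEnergy_eq (ν := ⟨ν, hν⟩) hinv hint, EReal.coe_add, ← add_assoc, add_comm]
    rfl

end Assembly

end CMS

open CMS in
/-- **Varadhan's principle and convex duality** for the empirical-measure LDP of Theorem A: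
for every bounded continuous `ψ`, `Q(ψ) = lim (1/n) log ∫ exp(S_nψ) dμφ` exists and equals
`sup_μ (∫ψ dμ - I(μ))`; dually, `I(μ) = sup_ψ (∫ψ dμ - Q(ψ))` over bounded continuous `ψ`. -/
theorem varadhan {S : Type*} [Countable S] [TopologicalSpace S] [DiscreteTopology S]
    (A : S → S → Prop) (hA : NoZeroRowCol A) (hirr : FinitelyIrreducible A)
    (φ : Space A → ℝ) (hφ : Measurable φ)
    (μφ : ProbabilityMeasure (Space A)) (c₀ P : ℝ) (hc₀ : 1 ≤ c₀)
    (hGibbs : IsGibbsWith A φ (μφ : Measure (Space A)) c₀ P) :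
    (∀ ψ : Space A → ℝ, Continuous ψ → Bdd A ψ →
      Tendsto
        (fun n : ℕ =>
          (((n : ℝ)⁻¹ *
            Real.log (∫ x, Real.exp (birkhoff (shift A) ψ n x) ∂(μφ : Measure (Space A))) : ℝ) :
            EReal))
        atTop (nhds (varQ (rateOf (freeEnergy (shift A) φ P)) ψ))) ∧
    ∀ μ : ProbabilityMeasure (Space A),
      rateOf (freeEnergy (shift A) φ P) μ =
        ⨆ (ψ : Space A → ℝ) (_ : Continuous ψ ∧ Bdd A ψ),
          (((∫ x, ψ x ∂(μ : Measure (Space A))) : ℝ) : EReal) -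
            varQ (rateOf (freeEnergy (shift A) φ P)) ψ := by
  have h := hGibbs.gibbsBound hc₀
  exact ⟨fun ψ hψ ⟨C, hC⟩ => h.tendsto_logZ hc₀ hφ hirr hψ hC,
    rateOf_eq_iSup (h.freeEnergy_nonpos hc₀ hφ) fun _ _ _ _ _ _ _ hr hs =>
      le_freeEnergy_mix measurable_shift hφ (fun x => h.le_log_const hc₀ x) _ _ hr hs⟩
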